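/- arXiv:2512.19499 — 3 statements merged into one kernel-verified Lean document; each statement's English description precedes it below -/
import Mathlib

section
/- Let k ≥ 1 be an integer and suppose ℓ₋ < 1 and k² < ℓ₊ < (k+1)². Then the boundary value problem −u''(x) − f(u(x)) = −sin(x) for all x ∈ [0, π], with u(0) = u(π) = 0, has exactly 2k solutions u that are twice continuously differentiable on [0, π]. (Costa–Figueiredo–Srikanth) -/
open Real Set Filter Topology MeasureTheory

/-- A continuous function whose derivative is nonnegative off a countable set does not decrease. -/
theorem le_of_deriv_nonneg_off_countable {f f' : ℝ → ℝ} {a b : ℝ} {C : Set ℝ} (hab : a ≤ b)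
    (hC : C.Countable) (hf : ContinuousOn f (Icc a b))
    (hd : ∀ x ∈ Ioo a b, x ∉ C → HasDerivAt f (f' x) x)
    (h0 : ∀ x ∈ Ioo a b, x ∉ C → 0 ≤ f' x) : f a ≤ f b := by
  by_contra! hlt
  have hne : a ≠ b := by rintro rfl; exact lt_irrefl _ hlt
  have hab' : a < b := lt_of_le_of_ne hab hne
  obtain ⟨ε, hε, hε'⟩ : ∃ ε : ℝ, 0 < ε ∧ ε * (b - a) < f a - f b := by
    refine ⟨(f a - f b) / (2 * (b - a)), div_pos (by linarith) (by linarith), ?_⟩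
    have : b - a ≠ 0 := by linarith
    field_simp
    linarith
  set g : ℝ → ℝ := fun x => f x + ε * (x - a) with hg
  have hgc : ContinuousOn g (Icc a b) := hf.add (by fun_prop)
  have hgab : g b < g a := by simp only [hg]; nlinarith
  obtain ⟨c, hc, hcC⟩ : ∃ c ∈ Ioo (g b) (g a), c ∉ g '' C := by
    by_contra! h
    exact (mt Cardinal.Real.Ioo_countable_iff.1 (not_le.2 hgab))
      ((hC.image g).mono h)
  set s := {t ∈ Icc a b | c ≤ g t} with hs
  have hsc : IsClosed s := by
    have := hgc.preimage_isClosed_of_isClosed isClosed_Icc (isClosed_Ici (a := c))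
    exact this
  have hsne : s.Nonempty := ⟨a, ⟨left_mem_Icc.2 hab, hc.2.le⟩⟩
  have hsb : BddAbove s := ⟨b, fun t ht => ht.1.2⟩
  have hx : sSup s ∈ s := hsc.csSup_mem hsne hsb
  set x := sSup s with hxd
  have hxb : x < b := lt_of_le_of_ne hx.1.2 (by
    intro h; have := hx.2; rw [h] at this; linarith [hc.1])
  have hright : ∀ t ∈ Ioo x b, g t < c := by
    intro t ht
    by_contra! h
    exact not_le.2 ht.1 (le_csSup hsb ⟨⟨hx.1.1.trans ht.1.le, ht.2.le⟩, h⟩)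
  have hev : ∀ᶠ t in 𝓝[>] x, t ∈ Ioo x b := Ioo_mem_nhdsGT hxb
  have hgx : g x = c := by
    refine le_antisymm ?_ hx.2
    have h1 : Tendsto g (𝓝[>] x) (𝓝 (g x)) :=
      ((hgc x hx.1).mono_of_mem_nhdsWithin (Icc_mem_nhdsGT_of_mem ⟨hx.1.1, hxb⟩))
    exact le_of_tendsto h1 (hev.mono fun t ht => (hright t ht).le)
  have hxa : a < x := lt_of_le_of_ne hx.1.1 (by
    intro h; rw [← h] at hgx; linarith [hc.2])
  have hxC : x ∉ C := fun h => hcC ⟨x, h, hgx⟩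
  have hgd : HasDerivAt g (f' x + ε * 1) x :=
    (hd x ⟨hxa, hxb⟩ hxC).add (((hasDerivAt_id x).sub_const a).const_mul ε)
  have hpos : 0 < f' x + ε * 1 := by linarith [h0 x ⟨hxa, hxb⟩ hxC]
  have h2 : ∀ᶠ t in 𝓝[>] x, 0 < slope g x t :=
    (hasDerivAt_iff_tendsto_slope.1 hgd |>.mono_left
      (nhdsWithin_mono _ fun t ht => ne_of_gt ht)).eventually (lt_mem_nhds hpos)
  obtain ⟨t, ht, ht2⟩ := (h2.and hev).exists
  rw [slope_def_field] at ht
  have := hright t ht2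
  have h3 : 0 < t - x := by linarith [ht2.1]
  have := (div_pos_iff_of_pos_right h3).1 ht
  linarith

theorem monotoneOn_of_deriv_nonneg_off_countable {f f' : ℝ → ℝ} {a b : ℝ} {C : Set ℝ}
    (hC : C.Countable) (hf : ContinuousOn f (Icc a b))
    (hd : ∀ x ∈ Ioo a b, x ∉ C → HasDerivAt f (f' x) x)
    (h0 : ∀ x ∈ Ioo a b, x ∉ C → 0 ≤ f' x) : MonotoneOn f (Icc a b) := by
  intro x hx y hy hxy
  have hsub : Ioo x y ⊆ Ioo a b := Ioo_subset_Ioo hx.1 hy.2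
  exact le_of_deriv_nonneg_off_countable hxy hC (hf.mono (Icc_subset_Icc hx.1 hy.2))
    (fun t ht => hd t (hsub ht)) (fun t ht => h0 t (hsub ht))

theorem eq_of_deriv_zero_off_countable {f : ℝ → ℝ} {a b : ℝ} {C : Set ℝ}
    (hC : C.Countable) (hf : ContinuousOn f (Icc a b))
    (hd : ∀ x ∈ Ioo a b, x ∉ C → HasDerivAt f 0 x) {x : ℝ} (hx : x ∈ Icc a b) : f x = f a := by
  have ha : a ∈ Icc a b := left_mem_Icc.2 (hx.1.trans hx.2)
  have h1 := monotoneOn_of_deriv_nonneg_off_countable hC hf hd (fun _ _ _ => le_rfl) ha hx hx.1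
  have h2 := monotoneOn_of_deriv_nonneg_off_countable (f := fun x => - f x) hC hf.neg
    (fun x hx hxC => (hd x hx hxC).neg) (fun _ _ _ => by simp) ha hx hx.1
  simp only at h2
  linarith

/-- If a continuous function starts nonnegative and crosses zero only upwards,
it is positive afterwards. -/
theorem pos_of_upcrossing {g : ℝ → ℝ} {a b : ℝ} (hg : ContinuousOn g (Icc a b)) (ha : 0 ≤ g a)
    (hr : ∀ x ∈ Ico a b, g x = 0 → ∀ᶠ y in 𝓝[>] x, 0 < g y)
    (hl : ∀ x ∈ Ioc a b, g x = 0 → ∀ᶠ y in 𝓝[<] x, g y < 0) {x : ℝ} (hx : x ∈ Ioc a b) :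
    0 < g x := by
  by_contra! hle
  obtain ⟨y, hy, hgy⟩ : ∃ y ∈ Ioc a b, g y < 0 := by
    rcases hle.lt_or_eq with h | h
    · exact ⟨x, hx, h⟩
    · obtain ⟨y, h1, h2⟩ := ((hl x hx h).and (Ioo_mem_nhdsLT hx.1)).exists
      exact ⟨y, ⟨h2.1, h2.2.le.trans hx.2⟩, h1⟩
  have hgc : ContinuousOn g (Icc a y) := hg.mono (Icc_subset_Icc le_rfl hy.2)
  set s := {t ∈ Icc a y | 0 ≤ g t} with hs
  have hsc : IsClosed s := hgc.preimage_isClosed_of_isClosed isClosed_Icc (isClosed_Ici (a := 0))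
  have hsne : s.Nonempty := ⟨a, ⟨left_mem_Icc.2 hy.1.le, ha⟩⟩
  have hsb : BddAbove s := ⟨y, fun t ht => ht.1.2⟩
  have hz : sSup s ∈ s := hsc.csSup_mem hsne hsb
  set z := sSup s with hzd
  have hzy : z < y := lt_of_le_of_ne hz.1.2 (by
    intro h; have := hz.2; rw [h] at this; linarith)
  have hright : ∀ t ∈ Ioo z y, g t < 0 := by
    intro t ht
    by_contra! h
    exact not_le.2 ht.1 (le_csSup hsb ⟨⟨hz.1.1.trans ht.1.le, ht.2.le⟩, h⟩)
  have hev : ∀ᶠ t in 𝓝[>] z, t ∈ Ioo z y := Ioo_mem_nhdsGT hzy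
  have hgz : g z = 0 := by
    refine le_antisymm ?_ hz.2
    have h1 : Tendsto g (𝓝[>] z) (𝓝 (g z)) :=
      ((hgc z hz.1).mono_of_mem_nhdsWithin (Icc_mem_nhdsGT_of_mem ⟨hz.1.1, hzy⟩))
    exact le_of_tendsto h1 (hev.mono fun t ht => (hright t ht).le)
  obtain ⟨t, h1, h2⟩ := ((hr z ⟨hz.1.1, hzy.trans_le hy.2⟩ hgz).and hev).exists
  linarith [hright t h2]

/-- One-sided Gronwall: `δ' ≥ -c |δ|` off a countable set and `δ a = 0` force `δ ≥ 0`. -/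
theorem nonneg_of_deriv_ge_off_countable {δ δ' : ℝ → ℝ} {a b c : ℝ} {C : Set ℝ}
    (hC : C.Countable) (hδ : ContinuousOn δ (Icc a b))
    (hd : ∀ x ∈ Ioo a b, x ∉ C → HasDerivAt δ (δ' x) x)
    (hb : ∀ x ∈ Ioo a b, x ∉ C → -(c * |δ x|) ≤ δ' x) (ha : δ a = 0) :
    ∀ x ∈ Icc a b, 0 ≤ δ x := by
  intro y hy
  by_contra! hlt
  have hgc : ContinuousOn δ (Icc a y) := hδ.mono (Icc_subset_Icc le_rfl hy.2)
  set s := {t ∈ Icc a y | 0 ≤ δ t} with hs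
  have hsc : IsClosed s := hgc.preimage_isClosed_of_isClosed isClosed_Icc (isClosed_Ici (a := 0))
  have hsne : s.Nonempty := ⟨a, ⟨left_mem_Icc.2 hy.1, ha.ge⟩⟩
  have hsb : BddAbove s := ⟨y, fun t ht => ht.1.2⟩
  have hz : sSup s ∈ s := hsc.csSup_mem hsne hsb
  set z := sSup s with hzd
  have hright : ∀ t ∈ Ioo z y, δ t < 0 := by
    intro t ht
    by_contra! h
    exact not_le.2 ht.1 (le_csSup hsb ⟨⟨hz.1.1.trans ht.1.le, ht.2.le⟩, h⟩)
  have hsub : Ioo z y ⊆ Ioo a b := Ioo_subset_Ioo hz.1.1 hy.2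
  have h1 := le_of_deriv_nonneg_off_countable (f := fun x => δ x * exp (-c * x))
    (f' := fun x => δ' x * exp (-c * x) + δ x * (exp (-c * x) * (-c * 1))) hz.1.2 hC
    ((hgc.mono (Icc_subset_Icc hz.1.1 le_rfl)).mul (by fun_prop))
    (fun x hx hxC => (hd x (hsub hx) hxC).mul (((hasDerivAt_id x).const_mul (-c)).exp))
    (fun x hx hxC => by
      have h2 := hb x (hsub hx) hxC
      rw [abs_of_neg (hright x hx)] at h2
      have : 0 ≤ (δ' x - c * δ x) * exp (-c * x) :=
        mul_nonneg (by linarith) (exp_pos _).le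
      nlinarith)
  have h3 : 0 ≤ δ z * exp (-c * z) := mul_nonneg hz.2 (exp_pos _).le
  have h4 : δ y * exp (-c * y) < 0 := mul_neg_of_neg_of_pos hlt (exp_pos _)
  linarith

/-- A nonnegative function with `δ' ≥ -c δ` off a countable set that vanishes at the right end
vanishes identically. -/
theorem eq_zero_of_deriv_ge_off_countable {δ δ' : ℝ → ℝ} {a b c : ℝ} {C : Set ℝ}
    (hC : C.Countable) (hδ : ContinuousOn δ (Icc a b))
    (hd : ∀ x ∈ Ioo a b, x ∉ C → HasDerivAt δ (δ' x) x)
    (hb : ∀ x ∈ Ioo a b, x ∉ C → -(c * |δ x|) ≤ δ' x) (h0 : ∀ x ∈ Icc a b, 0 ≤ δ x)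
    (hend : δ b ≤ 0) : ∀ x ∈ Icc a b, δ x = 0 := by
  intro y hy
  have hsub : Ioo y b ⊆ Ioo a b := Ioo_subset_Ioo hy.1 le_rfl
  have h1 := le_of_deriv_nonneg_off_countable (f := fun x => δ x * exp (c * x))
    (f' := fun x => δ' x * exp (c * x) + δ x * (exp (c * x) * (c * 1))) hy.2 hC
    ((hδ.mono (Icc_subset_Icc hy.1 le_rfl)).mul (by fun_prop))
    (fun x hx hxC => (hd x (hsub hx) hxC).mul (((hasDerivAt_id x).const_mul c).exp))
    (fun x hx hxC => by
      have h2 := hb x (hsub hx) hxC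
      rw [abs_of_nonneg (h0 x (Ioo_subset_Icc_self (hsub hx)))] at h2
      have : 0 ≤ (δ' x + c * δ x) * exp (c * x) :=
        mul_nonneg (by linarith) (exp_pos _).le
      nlinarith)
  have h3 : δ b * exp (c * b) ≤ 0 := mul_nonpos_of_nonpos_of_nonneg hend (exp_pos _).le
  have h4 : δ y ≤ 0 := by
    by_contra! h
    have := mul_pos h (exp_pos (c * y))
    linarith
  exact le_antisymm h4 (h0 y hy)

/-- Gronwall's inequality in integral form. -/
theorem le_mul_exp_of_le_integral {N : ℝ → ℝ} {A L T : ℝ} (hN : Continuous N) (hL : 0 ≤ L)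
    (h : ∀ x ∈ Icc 0 T, N x ≤ A + L * ∫ t in (0 : ℝ)..x, N t) :
    ∀ x ∈ Icc 0 T, N x ≤ A * exp (L * x) := by
  intro x hx
  have hG : ∀ y, HasDerivAt (fun y => A + L * ∫ t in (0 : ℝ)..y, N t) (L * N y) y := fun y =>
    ((hN.integral_hasStrictDerivAt 0 y).hasDerivAt.const_mul L).const_add A
  have h1 := le_of_deriv_nonneg_off_countable
    (f := fun y => -((A + L * ∫ t in (0 : ℝ)..y, N t) * exp (-L * y)))
    (f' := fun y => -(L * N y * exp (-L * y) +
      (A + L * ∫ t in (0 : ℝ)..y, N t) * (exp (-L * y) * (-L * 1)))) hx.1 countable_empty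
    (fun y _ => ((hG y).mul (((hasDerivAt_id y).const_mul (-L)).exp)).neg.continuousAt.continuousWithinAt)
    (fun y _ _ => ((hG y).mul (((hasDerivAt_id y).const_mul (-L)).exp)).neg)
    (fun y hy _ => by
      have h2 := h y ⟨hy.1.le, hy.2.le.trans hx.2⟩
      have : 0 ≤ L * (A + L * (∫ t in (0 : ℝ)..y, N t) - N y) * exp (-L * y) :=
        mul_nonneg (mul_nonneg hL (by linarith)) (exp_pos _).le
      nlinarith)
  simp only [intervalIntegral.integral_same, mul_zero, add_zero, exp_zero, mul_one] at h1
  have h3 : (A + L * ∫ t in (0 : ℝ)..x, N t) * exp (-L * x) ≤ A := by linarith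
  have h4 : A + L * ∫ t in (0 : ℝ)..x, N t ≤ A * exp (L * x) := by
    have h5 := mul_le_mul_of_nonneg_right h3 (exp_pos (L * x)).le
    rwa [mul_assoc, ← exp_add, show -L * x + L * x = 0 by ring, exp_zero, mul_one] at h5
  exact (h x hx).trans h4

/-- Global solvability of Volterra equations with a Lipschitz right-hand side. -/
theorem exists_volterra {E : Type*} [NormedAddCommGroup E] [NormedSpace ℝ E] [CompleteSpace E]
    (Φ : ℝ → E → E) {L T : ℝ} (hL : 0 ≤ L) (hT : 0 ≤ T)
    (hlip : ∀ t a b, ‖Φ t a - Φ t b‖ ≤ L * ‖a - b‖)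
    (hint : ∀ z : ℝ → E, Continuous z → ∀ a b, IntervalIntegrable (fun t => Φ t (z t)) volume a b)
    (u₀ : E) :
    ∃ U : ℝ → E, Continuous U ∧ ∀ x ∈ Icc 0 T, U x = u₀ + ∫ t in (0 : ℝ)..x, Φ t (U t) := by
  set M : ℝ := 2 * L + 1 with hM
  have hMpos : 0 < M := by linarith
  let ext : C(Icc (0 : ℝ) T, E) → ℝ → E := fun z t => exp (M * t) • z (projIcc 0 T hT t)
  have hext : ∀ z, Continuous (ext z) := fun z => by
    have : Continuous fun t => z (projIcc 0 T hT t) := z.continuous.comp continuous_projIcc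
    fun_prop
  let F : C(Icc (0 : ℝ) T, E) → C(Icc (0 : ℝ) T, E) := fun z =>
    ⟨fun x => exp (-M * x) • (u₀ + ∫ t in (0 : ℝ)..x, Φ t (ext z t)), by
      have : Continuous fun x : ℝ => ∫ t in (0 : ℝ)..x, Φ t (ext z t) :=
        intervalIntegral.continuous_primitive (hint _ (hext z)) 0
      fun_prop⟩
  have hF : ∀ z z', dist (F z) (F z') ≤ (L / M) * dist z z' := by
    intro z z'
    rw [ContinuousMap.dist_le (by positivity)]
    rintro ⟨x, hx⟩
    have h1 : ‖∫ t in (0 : ℝ)..x, (Φ t (ext z t) - Φ t (ext z' t))‖ ≤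
        ∫ t in (0 : ℝ)..x, L * dist z z' * exp (M * t) := by
      refine intervalIntegral.norm_integral_le_of_norm_le hx.1 ?_
        ((by fun_prop : Continuous fun t => L * dist z z' * exp (M * t)).intervalIntegrable _ _)
      refine Eventually.of_forall fun t _ => (hlip _ _ _).trans ?_
      rw [mul_assoc]
      refine mul_le_mul_of_nonneg_left ?_ hL
      rw [← smul_sub, norm_smul, norm_of_nonneg (exp_pos _).le, mul_comm, ← dist_eq_norm]
      exact mul_le_mul_of_nonneg_right (ContinuousMap.dist_apply_le_dist _) (exp_pos _).le
    have h2 : ∫ t in (0 : ℝ)..x, L * dist z z' * exp (M * t) =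
        L * dist z z' * ((exp (M * x) - 1) / M) := by
      rw [intervalIntegral.integral_const_mul,
        intervalIntegral.integral_comp_mul_left (fun t => exp t) hMpos.ne', integral_exp, mul_zero,
        exp_zero, smul_eq_mul]
      ring
    have h3 : F z ⟨x, hx⟩ - F z' ⟨x, hx⟩ =
        exp (-M * x) • ∫ t in (0 : ℝ)..x, (Φ t (ext z t) - Φ t (ext z' t)) := by
      rw [intervalIntegral.integral_sub (hint _ (hext z) _ _) (hint _ (hext z') _ _)]
      simp only [F, ContinuousMap.coe_mk, ← smul_sub, add_sub_add_left_eq_sub]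
    rw [dist_eq_norm, h3, norm_smul, norm_of_nonneg (exp_pos _).le]
    calc exp (-M * x) * _ ≤ exp (-M * x) * (L * dist z z' * ((exp (M * x) - 1) / M)) :=
          mul_le_mul_of_nonneg_left (h1.trans h2.le) (exp_pos _).le
      _ = L / M * dist z z' * (exp (-M * x) * exp (M * x) - exp (-M * x)) := by ring
      _ ≤ L / M * dist z z' * 1 := by
          refine mul_le_mul_of_nonneg_left ?_ (by positivity)
          rw [← exp_add, show -M * x + M * x = 0 by ring, exp_zero]
          linarith [exp_pos (-M * x)]
      _ = L / M * dist z z' := mul_one _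
  have hcontr : ContractingWith (L / M).toNNReal F := by
    refine ⟨?_, LipschitzWith.of_dist_le_mul fun z z' => ?_⟩
    · rw [← NNReal.coe_lt_coe, Real.coe_toNNReal _ (by positivity), NNReal.coe_one,
        div_lt_one hMpos]
      linarith
    · rw [Real.coe_toNNReal _ (by positivity)]
      exact hF z z'
  set z := ContractingWith.fixedPoint F hcontr
  have hz : F z = z := hcontr.fixedPoint_isFixedPt
  refine ⟨ext z, hext z, fun x hx => ?_⟩
  have h1 : z ⟨x, hx⟩ = exp (-M * x) • (u₀ + ∫ t in (0 : ℝ)..x, Φ t (ext z t)) := by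
    conv_lhs => rw [← hz]
    rfl
  have h2 : ext z x = exp (M * x) • z ⟨x, hx⟩ := by
    simp only [ext, projIcc_of_mem hT hx]
  rw [h2, h1, smul_smul, ← exp_add, show M * x + -M * x = 0 by ring, exp_zero, one_smul]

/-- Stability of Volterra equations. -/
theorem volterra_norm_sub_le {E : Type*} [NormedAddCommGroup E] [NormedSpace ℝ E]
    {U V Φ Ψ : ℝ → E} {e : ℝ → ℝ} {L T : ℝ} (hL : 0 ≤ L) {u₀ v₀ : E}
    (hU : Continuous U) (hV : Continuous V)
    (hΦ : ∀ a b, IntervalIntegrable Φ volume a b) (hΨ : ∀ a b, IntervalIntegrable Ψ volume a b)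
    (he : ∀ a b, IntervalIntegrable e volume a b) (he0 : ∀ t, 0 ≤ e t)
    (hUeq : ∀ x ∈ Icc 0 T, U x = u₀ + ∫ t in (0 : ℝ)..x, Φ t)
    (hVeq : ∀ x ∈ Icc 0 T, V x = v₀ + ∫ t in (0 : ℝ)..x, Ψ t)
    (hle : ∀ t ∈ Icc 0 T, ‖Φ t - Ψ t‖ ≤ L * ‖U t - V t‖ + e t) :
    ∀ x ∈ Icc 0 T, ‖U x - V x‖ ≤ (‖u₀ - v₀‖ + ∫ t in (0 : ℝ)..T, e t) * exp (L * x) := by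
  refine le_mul_exp_of_le_integral (N := fun x => ‖U x - V x‖) (by fun_prop) hL ?_
  intro x hx
  have hNi : ∀ a b, IntervalIntegrable (fun t => L * ‖U t - V t‖) volume a b := fun a b =>
    (by fun_prop : Continuous fun t => L * ‖U t - V t‖).intervalIntegrable _ _
  have h1 : U x - V x = (u₀ - v₀) + ∫ t in (0 : ℝ)..x, (Φ t - Ψ t) := by
    rw [intervalIntegral.integral_sub (hΦ _ _) (hΨ _ _), hUeq x hx, hVeq x hx]
    abel
  have h2 : ‖∫ t in (0 : ℝ)..x, (Φ t - Ψ t)‖ ≤ ∫ t in (0 : ℝ)..x, (L * ‖U t - V t‖ + e t) := by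
    refine intervalIntegral.norm_integral_le_of_norm_le hx.1 ?_ ((hNi _ _).add (he _ _))
    exact Eventually.of_forall fun t ht => hle t ⟨ht.1.le, ht.2.trans hx.2⟩
  have h3 : ∫ t in (0 : ℝ)..x, e t ≤ ∫ t in (0 : ℝ)..T, e t :=
    intervalIntegral.integral_mono_interval le_rfl hx.1 hx.2 (Eventually.of_forall he0) (he _ _)
  rw [intervalIntegral.integral_add (hNi _ _) (he _ _), intervalIntegral.integral_const_mul] at h2
  calc ‖U x - V x‖ ≤ ‖u₀ - v₀‖ + ‖∫ t in (0 : ℝ)..x, (Φ t - Ψ t)‖ := by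
        rw [h1]; exact norm_add_le _ _
    _ ≤ _ := by linarith

/-- A scalar trajectory `y' = y₁`, `y₁' = -n` on `(0, π)` (the latter off a countable set `C`), with
`|n| ≤ K |y|` and starting from `y 0 = 0`, `y₁ 0 ≠ 0`. -/
structure Traj (n y y₁ : ℝ → ℝ) (C : Set ℝ) (K : ℝ) : Prop where
  cont : Continuous y
  cont₁ : Continuous y₁
  meas : Measurable n
  nonneg : 0 ≤ K
  bound : ∀ x, |n x| ≤ K * |y x|
  countable : C.Countable
  deriv : ∀ x ∈ Ioo 0 π, HasDerivAt y (y₁ x) x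
  deriv₁ : ∀ x ∈ Ioo 0 π, x ∉ C → HasDerivAt y₁ (-n x) x
  cont_n : ∀ x ∈ Ioo 0 π, x ∉ C → ContinuousAt n x
  init : y 0 = 0
  init₁ : y₁ 0 ≠ 0

/-- The rotation speed of the weighted Prüfer angle. -/
noncomputable def pruferSpeed (ω : ℝ) (n y y₁ : ℝ → ℝ) (t : ℝ) : ℝ :=
  ω * (y₁ t ^ 2 + y t * n t) / (y₁ t ^ 2 + ω ^ 2 * y t ^ 2)

/-- The lifted Prüfer angle: the argument of `y₁ + i ω y`. -/
noncomputable def prufer (ω : ℝ) (n y y₁ : ℝ → ℝ) (x : ℝ) : ℝ :=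
  ∫ t in (0 : ℝ)..x, pruferSpeed ω n y y₁ t

theorem abs_pruferSpeed_le {ω K : ℝ} (hω : 0 < ω) (hK : 0 ≤ K) {n y y₁ : ℝ → ℝ} {t : ℝ}
    (h : |n t| ≤ K * |y t|) : |pruferSpeed ω n y y₁ t| ≤ ω * (1 + K / ω ^ 2) := by
  have hR : 0 ≤ y₁ t ^ 2 + ω ^ 2 * y t ^ 2 := by positivity
  have h1 : |y t * n t| ≤ K * y t ^ 2 := by
    rw [abs_mul, ← sq_abs (y t)]
    nlinarith [abs_nonneg (y t)]
  have h2 : |y₁ t ^ 2 + y t * n t| ≤ (1 + K / ω ^ 2) * (y₁ t ^ 2 + ω ^ 2 * y t ^ 2) := by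
    have h3 : (1 + K / ω ^ 2) * (y₁ t ^ 2 + ω ^ 2 * y t ^ 2) =
        y₁ t ^ 2 + K * y t ^ 2 + (ω ^ 2 * y t ^ 2 + K / ω ^ 2 * y₁ t ^ 2) := by
      field_simp
      ring
    have h4 : 0 ≤ ω ^ 2 * y t ^ 2 + K / ω ^ 2 * y₁ t ^ 2 := by positivity
    refine (abs_add_le _ _).trans ?_
    rw [abs_of_nonneg (sq_nonneg (y₁ t)), h3]
    linarith
  unfold pruferSpeed
  rw [abs_div, abs_mul, abs_of_pos hω, abs_of_nonneg hR]
  refine div_le_of_le_mul₀ hR (by positivity) ?_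
  rw [mul_assoc]
  exact mul_le_mul_of_nonneg_left h2 hω.le

namespace Traj

variable {n y y₁ : ℝ → ℝ} {C : Set ℝ} {K ω : ℝ}

theorem energy_pos (h : Traj n y y₁ C K) (hω : 0 < ω) {x : ℝ} (hx : x ∈ Icc 0 π) :
    0 < y₁ x ^ 2 + ω ^ 2 * y x ^ 2 := by
  set c := K / ω + ω with hc
  have hcy := h.cont
  have hcy₁ := h.cont₁
  have h1 := le_of_deriv_nonneg_off_countable
    (f := fun t => (y₁ t ^ 2 + ω ^ 2 * y t ^ 2) * exp (c * t))
    (f' := fun t => (2 * y₁ t ^ (2 - 1) * (-n t) + ω ^ 2 * (2 * y t ^ (2 - 1) * y₁ t)) *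
      exp (c * t) + (y₁ t ^ 2 + ω ^ 2 * y t ^ 2) * (exp (c * t) * (c * 1))) hx.1 h.countable
    (by fun_prop)
    (fun t ht htC => by
      have ht' : t ∈ Ioo 0 π := ⟨ht.1, ht.2.trans_le hx.2⟩
      exact (((h.deriv₁ t ht' htC).pow 2).add (((h.deriv t ht').pow 2).const_mul (ω ^ 2))).mul
        (((hasDerivAt_id t).const_mul c).exp))
    (fun t ht htC => by
      have h2 : 0 ≤ 2 * y₁ t ^ (2 - 1) * (-n t) + ω ^ 2 * (2 * y t ^ (2 - 1) * y₁ t) +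
          c * (y₁ t ^ 2 + ω ^ 2 * y t ^ 2) := by
        have h3 : |y₁ t * n t| ≤ K * (|y₁ t| * |y t|) := by
          rw [abs_mul]
          nlinarith [h.bound t, abs_nonneg (y₁ t)]
        have h4 : 2 * ω * (|y₁ t| * |y t|) ≤ y₁ t ^ 2 + ω ^ 2 * y t ^ 2 := by
          rw [← sq_abs (y t), ← sq_abs (y₁ t)]
          nlinarith [sq_nonneg (|y₁ t| - ω * |y t|)]
        have h5 : |y₁ t * y t| = |y₁ t| * |y t| := abs_mul _ _
        have h6 := (abs_le.1 h3).2
        have h7 := (abs_le.1 h5.le).1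
        have h8 : K / ω * (2 * ω * (|y₁ t| * |y t|)) ≤
            K / ω * (y₁ t ^ 2 + ω ^ 2 * y t ^ 2) :=
          mul_le_mul_of_nonneg_left h4 (div_nonneg h.nonneg hω.le)
        have h9 : K / ω * (2 * ω * (|y₁ t| * |y t|)) = 2 * K * (|y₁ t| * |y t|) := by
          field_simp
        have h10 : ω * (2 * ω * (|y₁ t| * |y t|)) ≤ ω * (y₁ t ^ 2 + ω ^ 2 * y t ^ 2) :=
          mul_le_mul_of_nonneg_left h4 hω.le
        have h11 := mul_le_mul_of_nonneg_left h7 (sq_nonneg ω)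
        rw [hc]
        norm_num
        nlinarith
      have := mul_nonneg h2 (exp_pos (c * t)).le
      nlinarith)
  have h12 : 0 < y₁ 0 ^ 2 := by have := h.init₁; positivity
  simp only [h.init, mul_zero, exp_zero, mul_one] at h1
  by_contra! hle
  have := mul_nonpos_of_nonpos_of_nonneg hle (exp_pos (c * x)).le
  norm_num at h1
  linarith

theorem speed_intervalIntegrable (h : Traj n y y₁ C K) (hω : 0 < ω) (a b : ℝ) :
    IntervalIntegrable (pruferSpeed ω n y y₁) volume a b := by
  have hcy := h.cont.measurable
  have hcy₁ := h.cont₁.measurable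
  have hn := h.meas
  refine (intervalIntegrable_const (c := ω * (1 + K / ω ^ 2))).mono_fun ?_ ?_
  · unfold pruferSpeed
    exact (by fun_prop : Measurable _).aestronglyMeasurable
  · refine Eventually.of_forall fun t => ?_
    exact (abs_pruferSpeed_le hω h.nonneg (h.bound t)).trans (le_abs_self _)

theorem continuous_prufer (h : Traj n y y₁ C K) (hω : 0 < ω) :
    Continuous (prufer ω n y y₁) :=
  intervalIntegral.continuous_primitive (h.speed_intervalIntegrable hω) 0

theorem prufer_zero : prufer ω n y y₁ 0 = 0 := intervalIntegral.integral_same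

theorem hasDerivAt_prufer_of_continuousAt (h : Traj n y y₁ C K) (hω : 0 < ω) {x : ℝ}
    (hx : x ∈ Icc 0 π) (hc : ContinuousAt (fun t => y t * n t) x) :
    HasDerivAt (prufer ω n y y₁) (pruferSpeed ω n y y₁ x) x := by
  have hcy := h.cont
  have hcy₁ := h.cont₁
  have hm := h.cont.measurable
  have hm₁ := h.cont₁.measurable
  have hn := h.meas
  refine intervalIntegral.integral_hasDerivAt_right (h.speed_intervalIntegrable hω _ _) ?_ ?_
  · refine Measurable.stronglyMeasurable ?_ |>.stronglyMeasurableAtFilter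
    unfold pruferSpeed
    fun_prop
  · unfold pruferSpeed
    exact (continuousAt_const.mul ((hcy₁.continuousAt.pow 2).add hc)).div
      (by fun_prop) (h.energy_pos hω hx).ne'

theorem hasDerivAt_prufer (h : Traj n y y₁ C K) (hω : 0 < ω) {x : ℝ}
    (hx : x ∈ Ioo 0 π) (hxC : x ∉ C) :
    HasDerivAt (prufer ω n y y₁) (pruferSpeed ω n y y₁ x) x :=
  h.hasDerivAt_prufer_of_continuousAt hω (Ioo_subset_Icc_self hx)
    (h.cont.continuousAt.mul (h.cont_n x hx hxC))

theorem hasDerivAt_prufer_of_eq_zero (h : Traj n y y₁ C K) (hω : 0 < ω) {x : ℝ}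
    (hx : x ∈ Icc 0 π) (hy : y x = 0) : HasDerivAt (prufer ω n y y₁) ω x := by
  have hcy := h.cont
  have h1 : ContinuousAt (fun t => y t * n t) x := by
    show Tendsto _ _ (𝓝 (y x * n x))
    rw [hy, zero_mul]
    refine squeeze_zero_norm (a := fun t => K * y t ^ 2) (fun t => ?_) ?_
    · rw [Real.norm_eq_abs, abs_mul, ← sq_abs (y t)]
      nlinarith [h.bound t, abs_nonneg (y t)]
    · have : Continuous fun t => K * y t ^ 2 := by fun_prop
      have h2 := this.tendsto x
      simpa [hy] using h2
  have h2 := h.hasDerivAt_prufer_of_continuousAt hω hx h1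
  have h3 : pruferSpeed ω n y y₁ x = ω := by
    have := h.energy_pos hω hx
    unfold pruferSpeed
    rw [hy] at this ⊢
    simp only [zero_mul, add_zero, ne_eq, OfNat.ofNat_ne_zero, not_false_eq_true, zero_pow,
      mul_zero] at this ⊢
    rw [mul_div_cancel_right₀ _ this.ne']
  rwa [h3] at h2

/-- Polar form of a trajectory with respect to its Prüfer angle. -/
theorem polar (h : Traj n y y₁ C K) (hω : 0 < ω) : ∃ Z : ℝ → ℝ, ∀ x ∈ Icc 0 π,
    ω * y x = Z x * sin (prufer ω n y y₁ x) ∧ y₁ x = Z x * cos (prufer ω n y y₁ x) ∧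
    0 < Z x * y₁ 0 := by
  set θ := prufer ω n y y₁ with hθ
  have hcy := h.cont
  have hcy₁ := h.cont₁
  have hcθ : Continuous θ := h.continuous_prufer hω
  have hθ0 : θ 0 = 0 := prufer_zero
  have hX : ∀ x ∈ Icc 0 π, ω * y x * cos (θ x) - y₁ x * sin (θ x) = 0 := by
    intro x hx
    have h1 := eq_of_deriv_zero_off_countable (a := 0) (b := π)
      (f := fun x => (ω * y x * cos (θ x) - y₁ x * sin (θ x)) ^ 2 /
        (y₁ x ^ 2 + ω ^ 2 * y x ^ 2)) h.countable
      (ContinuousOn.div (by fun_prop) (by fun_prop) fun t ht => (h.energy_pos hω ht).ne')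
      (fun t ht htC => by
        have hd := h.deriv t ht
        have hd₁ := h.deriv₁ t ht htC
        have hdθ := h.hasDerivAt_prufer hω ht htC
        have hR := h.energy_pos hω (Ioo_subset_Icc_self ht)
        have h2 := ((((hd.const_mul ω).mul hdθ.cos).sub (hd₁.mul hdθ.sin)).pow 2).div
          ((hd₁.pow 2).add ((hd.pow 2).const_mul (ω ^ 2))) hR.ne'
        refine HasDerivAt.congr_deriv (g' := (0 : ℝ)) h2 ?_
        rw [div_eq_zero_iff]
        left
        simp only [Pi.mul_apply, Pi.sub_apply, Pi.add_apply, Pi.pow_apply, Nat.cast_ofNat]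
        rw [← hθ]
        have hs : pruferSpeed ω n y y₁ t * (y₁ t ^ 2 + ω ^ 2 * y t ^ 2) =
            ω * (y₁ t ^ 2 + y t * n t) := by
          unfold pruferSpeed
          rw [div_mul_cancel₀ _ hR.ne']
        generalize pruferSpeed ω n y y₁ t = S at hs
        norm_num
        linear_combination (-2 * (ω * y t * cos (θ t) - y₁ t * sin (θ t)) *
          (ω * y t * sin (θ t) + y₁ t * cos (θ t))) * hs)
      hx
    simp only [hθ0, h.init] at h1
    norm_num at h1
    rcases h1 with h1 | h1
    · exact h1
    · exact absurd h1 (h.energy_pos hω hx).ne'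
  refine ⟨fun x => ω * y x * sin (θ x) + y₁ x * cos (θ x), fun x hx => ⟨?_, ?_, ?_⟩⟩
  · linear_combination cos (θ x) * hX x hx - (ω * y x) * sin_sq_add_cos_sq (θ x)
  · linear_combination (-sin (θ x)) * hX x hx - (y₁ x) * sin_sq_add_cos_sq (θ x)
  · by_contra! hle
    have hc : ContinuousOn (fun x => (ω * y x * sin (θ x) + y₁ x * cos (θ x)) * y₁ 0) (Icc 0 x) :=
      by fun_prop
    have h0 : (0 : ℝ) ∈ Icc ((ω * y x * sin (θ x) + y₁ x * cos (θ x)) * y₁ 0)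
        ((ω * y 0 * sin (θ 0) + y₁ 0 * cos (θ 0)) * y₁ 0) := by
      refine ⟨hle, ?_⟩
      rw [hθ0, h.init]
      simp only [sin_zero, cos_zero, mul_zero, mul_one, zero_add]
      exact mul_self_nonneg _
    obtain ⟨z, hz, hz0⟩ := intermediate_value_Icc' hx.1 hc h0
    have hz' : z ∈ Icc 0 π := ⟨hz.1, hz.2.trans hx.2⟩
    have h1 := h.energy_pos hω hz'
    have h2 : ω * y z * sin (θ z) + y₁ z * cos (θ z) = 0 := by
      simpa [h.init₁] using hz0
    have h3 : y₁ z ^ 2 + ω ^ 2 * y z ^ 2 = 0 := by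
      linear_combination (ω * y z * cos (θ z) - y₁ z * sin (θ z)) * hX z hz' +
        (ω * y z * sin (θ z) + y₁ z * cos (θ z)) * h2 -
        (y₁ z ^ 2 + ω ^ 2 * y z ^ 2) * sin_sq_add_cos_sq (θ z)
    exact h1.ne' h3

theorem eq_zero_iff_sin_prufer (h : Traj n y y₁ C K) (hω : 0 < ω) {x : ℝ} (hx : x ∈ Icc 0 π) :
    y x = 0 ↔ sin (prufer ω n y y₁ x) = 0 := by
  obtain ⟨Z, hZ⟩ := h.polar hω
  obtain ⟨h1, -, h3⟩ := hZ x hx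
  have hZ0 : Z x ≠ 0 := by rintro h; simp [h] at h3
  constructor
  · intro h
    rw [h, mul_zero] at h1
    simpa [hZ0] using h1.symm
  · intro h
    rw [h, mul_zero] at h1
    simpa [hω.ne'] using h1

/-- The Prüfer angle crosses the multiples of `π` only upwards. -/
theorem lt_prufer (h : Traj n y y₁ C K) (hω : 0 < ω) {x₀ x : ℝ} (hx₀ : 0 ≤ x₀) (hxx : x₀ < x)
    (hx : x ≤ π) {i : ℤ} (hi : i * π ≤ prufer ω n y y₁ x₀) : i * π < prufer ω n y y₁ x := by
  have hder : ∀ t ∈ Icc x₀ x, prufer ω n y y₁ t - i * π = 0 →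
      HasDerivAt (fun t => prufer ω n y y₁ t - i * π) ω t := by
    intro t ht h0
    have ht' : t ∈ Icc 0 π := ⟨hx₀.trans ht.1, ht.2.trans hx⟩
    refine (h.hasDerivAt_prufer_of_eq_zero hω ht' ?_).sub_const _
    rw [h.eq_zero_iff_sin_prufer hω ht', sub_eq_zero.1 h0, sin_int_mul_pi]
  have hslope : ∀ t ∈ Icc x₀ x, prufer ω n y y₁ t - i * π = 0 →
      ∀ᶠ s in 𝓝[≠] t, 0 < (prufer ω n y y₁ s - i * π) / (s - t) := by
    intro t ht h0
    have h1 := (hasDerivAt_iff_tendsto_slope.1 (hder t ht h0)).eventually (lt_mem_nhds hω)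
    refine h1.mono fun s hs => ?_
    rwa [slope_def_field, h0, sub_zero] at hs
  have := pos_of_upcrossing (g := fun t => prufer ω n y y₁ t - i * π) (a := x₀) (b := x)
    ((h.continuous_prufer hω).sub continuous_const).continuousOn (by simpa using hi)
    (fun t ht h0 => by
      have h1 := (hslope t (Ico_subset_Icc_self ht) h0).filter_mono
        (nhdsWithin_mono t fun s (hs : s ∈ Ioi t) => ne_of_gt hs)
      filter_upwards [h1, self_mem_nhdsWithin] with s hs hst
      exact (div_pos_iff_of_pos_right (sub_pos.2 hst)).1 hs)
    (fun t ht h0 => by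
      have h1 := (hslope t (Ioc_subset_Icc_self ht) h0).filter_mono
        (nhdsWithin_mono t fun s (hs : s ∈ Iio t) => ne_of_lt hs)
      filter_upwards [h1, self_mem_nhdsWithin] with s hs hst
      by_contra! hcon
      exact not_lt.2 (div_nonpos_of_nonneg_of_nonpos hcon (sub_neg.2 hst).le) hs)
    (x := x) ⟨hxx, le_rfl⟩
  simpa using this

end Traj

theorem fst_snd_of_volterra {u₀ : ℝ × ℝ} {U : ℝ → ℝ × ℝ} {a b : ℝ → ℝ} {x : ℝ}
    (ha : IntervalIntegrable a volume 0 x) (hb : IntervalIntegrable b volume 0 x)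
    (hU : U x = u₀ + ∫ t in (0 : ℝ)..x, (a t, b t)) :
    (U x).1 = u₀.1 + ∫ t in (0 : ℝ)..x, a t ∧ (U x).2 = u₀.2 + ∫ t in (0 : ℝ)..x, b t := by
  have hab : IntervalIntegrable (fun t => (a t, b t)) volume 0 x :=
    ⟨ha.1.prodMk hb.1, ha.2.prodMk hb.2⟩
  have h1 := (ContinuousLinearMap.fst ℝ ℝ ℝ).intervalIntegral_comp_comm hab
  have h2 := (ContinuousLinearMap.snd ℝ ℝ ℝ).intervalIntegral_comp_comm hab
  simp only [ContinuousLinearMap.coe_fst', ContinuousLinearMap.coe_snd'] at h1 h2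
  rw [hU, Prod.fst_add, Prod.snd_add, h1, h2]
  exact ⟨rfl, rfl⟩

theorem volterra_of_fst_snd {u₀ : ℝ × ℝ} {y y₁ : ℝ → ℝ} {a b : ℝ → ℝ} {x : ℝ}
    (ha : IntervalIntegrable a volume 0 x) (hb : IntervalIntegrable b volume 0 x)
    (h₁ : y x = u₀.1 + ∫ t in (0 : ℝ)..x, a t) (h₂ : y₁ x = u₀.2 + ∫ t in (0 : ℝ)..x, b t) :
    (y x, y₁ x) = u₀ + ∫ t in (0 : ℝ)..x, (a t, b t) := by
  obtain ⟨h3, h4⟩ := fst_snd_of_volterra (u₀ := u₀) (x := x)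
    (U := fun x => u₀ + ∫ t in (0 : ℝ)..x, (a t, b t)) ha hb rfl
  refine Prod.ext ?_ ?_
  · rw [h3]; exact h₁
  · rw [h4]; exact h₂

theorem hasDerivAt_of_eq_integral {y a : ℝ → ℝ} {s x : ℝ} (hx : x ∈ Ioo 0 π)
    (ha : Measurable a) (hai : IntervalIntegrable a volume 0 x)
    (hy : ∀ x ∈ Icc 0 π, y x = s + ∫ t in (0 : ℝ)..x, a t) (hc : ContinuousAt a x) :
    HasDerivAt y (a x) x := by
  have h1 := (intervalIntegral.integral_hasDerivAt_right hai
    (ha.stronglyMeasurable.stronglyMeasurableAtFilter) hc).const_add s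
  refine h1.congr_of_eventuallyEq ?_
  filter_upwards [Ioo_mem_nhds hx.1 hx.2] with t ht
  exact hy t (Ioo_subset_Icc_self ht)

theorem intervalIntegrable_of_abs_le {n g : ℝ → ℝ} (hn : Measurable n) (hg : Continuous g)
    (h : ∀ x, |n x| ≤ g x) (a b : ℝ) : IntervalIntegrable n volume a b := by
  refine (hg.intervalIntegrable a b).mono_fun hn.aestronglyMeasurable
    (Eventually.of_forall fun t => ?_)
  exact (h t).trans (le_abs_self _)

theorem Traj.of_integral {n y y₁ : ℝ → ℝ} {C : Set ℝ} {K s : ℝ} (hs : s ≠ 0)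
    (hy : Continuous y) (hy₁ : Continuous y₁) (hn : Measurable n) (hK : 0 ≤ K)
    (hb : ∀ x, |n x| ≤ K * |y x|) (hC : C.Countable)
    (hcn : ∀ x ∈ Ioo 0 π, x ∉ C → ContinuousAt n x)
    (h₁ : ∀ x ∈ Icc 0 π, y x = 0 + ∫ t in (0 : ℝ)..x, y₁ t)
    (h₂ : ∀ x ∈ Icc 0 π, y₁ x = s + ∫ t in (0 : ℝ)..x, -n t) : Traj n y y₁ C K := by
  have hni := intervalIntegrable_of_abs_le hn (continuous_const.mul hy.abs) hb
  refine ⟨hy, hy₁, hn, hK, hb, hC, fun x hx => ?_, fun x hx hxC => ?_, hcn, ?_, ?_⟩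
  · exact hasDerivAt_of_eq_integral hx hy₁.measurable (hy₁.intervalIntegrable _ _) h₁
      hy₁.continuousAt
  · exact hasDerivAt_of_eq_integral (a := fun t => -n t) hx hn.neg (hni _ _).neg h₂
      (hcn x hx hxC).neg
  · simpa using h₁ 0 ⟨le_rfl, pi_pos.le⟩
  · rw [h₂ 0 ⟨le_rfl, pi_pos.le⟩]
    simpa using hs

/-- The jumping reaction term, in the variable shifted by the multiple `τ` of `sin`. -/
noncomputable def reaction (ω κ τ x y : ℝ) : ℝ :=
  ω ^ 2 * y + κ * max (-(y + τ * |sin x|)) 0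

/-- `U = (y, y')` solves `y'' = -reaction ω κ τ x y` on `[0, π]` with `y 0 = 0`, `y' 0 = s`. -/
structure IsSol (ω κ τ s : ℝ) (U : ℝ → ℝ × ℝ) : Prop where
  cont : Continuous U
  eq : ∀ x ∈ Icc 0 π, U x = (0, s) + ∫ t in (0 : ℝ)..x, ((U t).2, -reaction ω κ τ t (U t).1)

@[fun_prop]
theorem continuous_reaction {ω κ τ : ℝ} {y : ℝ → ℝ} (hy : Continuous y) :
    Continuous fun t => reaction ω κ τ t (y t) := by
  unfold reaction
  fun_prop

theorem abs_max_neg_sub_le (a b c d : ℝ) :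
    |max (-(a + c)) 0 - max (-(b + d)) 0| ≤ |a - b| + |c - d| := by
  refine (abs_max_sub_max_le_abs _ _ _).trans ?_
  rw [show -(a + c) - -(b + d) = -((a - b) + (c - d)) by ring, abs_neg]
  exact abs_add_le _ _

theorem abs_reaction_sub_le {ω κ τ τ' x : ℝ} (hκ : 0 ≤ κ) (a b : ℝ) :
    |reaction ω κ τ x a - reaction ω κ τ' x b| ≤ (ω ^ 2 + κ) * |a - b| + κ * |τ - τ'| := by
  have h1 := abs_max_neg_sub_le a b (τ * |sin x|) (τ' * |sin x|)
  have h2 : |(τ * |sin x|) - (τ' * |sin x|)| ≤ |τ - τ'| := by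
    rw [← sub_mul, abs_mul, abs_abs]
    exact mul_le_of_le_one_right (abs_nonneg _) (abs_sin_le_one x)
  have h3 : reaction ω κ τ x a - reaction ω κ τ' x b = ω ^ 2 * (a - b) +
      κ * (max (-(a + τ * |sin x|)) 0 - max (-(b + τ' * |sin x|)) 0) := by
    unfold reaction
    ring
  rw [h3]
  refine (abs_add_le _ _).trans ?_
  rw [abs_mul, abs_mul, abs_of_nonneg hκ, abs_of_nonneg (sq_nonneg ω)]
  nlinarith

theorem abs_reaction_le {ω κ τ x : ℝ} (hκ : 0 ≤ κ) (hτ : 0 ≤ τ) (a : ℝ) :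
    |reaction ω κ τ x a| ≤ (ω ^ 2 + κ) * |a| := by
  have h0 : reaction ω κ τ x 0 = 0 := by
    have : 0 ≤ τ * |sin x| := by positivity
    simp [reaction, this]
  simpa [h0] using abs_reaction_sub_le (ω := ω) (τ := τ) (τ' := τ) (x := x) hκ a 0

theorem norm_field_sub_le {ω κ τ τ' t : ℝ} (hκ : 0 ≤ κ) (p q : ℝ × ℝ) :
    ‖(p.2, -reaction ω κ τ t p.1) - (q.2, -reaction ω κ τ' t q.1)‖ ≤
      (1 + ω ^ 2 + κ) * ‖p - q‖ + κ * |τ - τ'| := by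
  have h1 : |p.1 - q.1| ≤ ‖p - q‖ := norm_fst_le (p - q)
  have h2 : |p.2 - q.2| ≤ ‖p - q‖ := norm_snd_le (p - q)
  have h3 := abs_reaction_sub_le (ω := ω) (τ := τ) (τ' := τ') (x := t) hκ p.1 q.1
  have h4 := abs_nonneg (τ - τ')
  have h5 := norm_nonneg (p - q)
  have h6 := sq_nonneg ω
  have h7 : 0 ≤ κ * |τ - τ'| := by positivity
  have h8 : 0 ≤ (ω ^ 2 + κ) * ‖p - q‖ := by positivity
  have h9 : (ω ^ 2 + κ) * |p.1 - q.1| ≤ (ω ^ 2 + κ) * ‖p - q‖ :=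
    mul_le_mul_of_nonneg_left h1 (by positivity)
  rw [Prod.mk_sub_mk, Prod.norm_mk]
  refine max_le ?_ ?_
  · rw [Real.norm_eq_abs]
    linarith
  · rw [Real.norm_eq_abs, neg_sub_neg, abs_sub_comm]
    linarith

theorem exists_isSol {ω κ : ℝ} (hκ : 0 ≤ κ) (τ s : ℝ) : ∃ U, IsSol ω κ τ s U := by
  obtain ⟨U, hU, h⟩ := exists_volterra (E := ℝ × ℝ)
    (fun t p => (p.2, -reaction ω κ τ t p.1)) (L := 1 + ω ^ 2 + κ) (T := π)
    (by positivity) pi_pos.le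
    (fun t a b => by simpa using norm_field_sub_le (ω := ω) (τ := τ) (τ' := τ) (t := t) hκ a b)
    (fun z hz a b => by
      refine Continuous.intervalIntegrable ?_ _ _
      fun_prop)
    (0, s)
  exact ⟨U, hU, h⟩

namespace IsSol

variable {ω κ τ τ' s s' : ℝ} {U V : ℝ → ℝ × ℝ}

theorem norm_sub_le (hκ : 0 ≤ κ) (hU : IsSol ω κ τ s U) (hV : IsSol ω κ τ' s' V) {x : ℝ}
    (hx : x ∈ Icc 0 π) :
    ‖U x - V x‖ ≤ (|s - s'| + π * (κ * |τ - τ'|)) * exp ((1 + ω ^ 2 + κ) * π) := by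
  have hUc := hU.cont
  have hVc := hV.cont
  have h1 := volterra_norm_sub_le (L := 1 + ω ^ 2 + κ) (T := π) (e := fun _ => κ * |τ - τ'|)
    (by positivity) hU.cont hV.cont
    (fun a b => Continuous.intervalIntegrable (by fun_prop) _ _)
    (fun a b => Continuous.intervalIntegrable (by fun_prop) _ _)
    (fun a b => intervalIntegrable_const) (fun t => by positivity) hU.eq hV.eq
    (fun t _ => norm_field_sub_le hκ (U t) (V t)) x hx
  have h2 : ‖((0, s) : ℝ × ℝ) - (0, s')‖ = |s - s'| := by
    rw [Prod.mk_sub_mk, sub_self, Prod.norm_mk, norm_zero, Real.norm_eq_abs]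
    exact max_eq_right (abs_nonneg _)
  rw [h2, intervalIntegral.integral_const, sub_zero, smul_eq_mul] at h1
  refine h1.trans (mul_le_mul_of_nonneg_left (exp_le_exp.2 ?_) (by positivity))
  exact mul_le_mul_of_nonneg_left hx.2 (by positivity)

theorem eqOn (hκ : 0 ≤ κ) (hU : IsSol ω κ τ s U) (hV : IsSol ω κ τ s V) {x : ℝ}
    (hx : x ∈ Icc 0 π) : U x = V x := by
  simpa [sub_eq_zero] using hU.norm_sub_le hκ hV hx

theorem smul {c : ℝ} (hc : 0 ≤ c) (hU : IsSol ω κ τ s U) :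
    IsSol ω κ (c * τ) (c * s) (fun x => c • U x) := by
  refine ⟨hU.cont.const_smul c, fun x hx => ?_⟩
  have h1 : ∀ t, reaction ω κ (c * τ) t (c * (U t).1) = c * reaction ω κ τ t (U t).1 := by
    intro t
    have : max (-(c * (U t).1 + c * τ * |sin t|)) 0 = c * max (-((U t).1 + τ * |sin t|)) 0 := by
      rw [mul_max_of_nonneg _ _ hc, mul_zero]
      congr 1
      ring
    unfold reaction
    rw [this]
    ring
  rw [hU.eq x hx, smul_add, ← intervalIntegral.integral_smul]
  simp [h1]

theorem fst_eq (hU : IsSol ω κ τ s U) {x : ℝ} (hx : x ∈ Icc 0 π) :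
    (U x).1 = 0 + ∫ t in (0 : ℝ)..x, (U t).2 := by
  have hUc := hU.cont
  exact (fst_snd_of_volterra (Continuous.intervalIntegrable (by fun_prop) _ _)
    (Continuous.intervalIntegrable (by fun_prop) _ _) (hU.eq x hx)).1

theorem snd_eq (hU : IsSol ω κ τ s U) {x : ℝ} (hx : x ∈ Icc 0 π) :
    (U x).2 = s + ∫ t in (0 : ℝ)..x, -reaction ω κ τ t (U t).1 := by
  have hUc := hU.cont
  exact (fst_snd_of_volterra (Continuous.intervalIntegrable (by fun_prop) _ _)
    (Continuous.intervalIntegrable (by fun_prop) _ _) (hU.eq x hx)).2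

theorem init₁ (hU : IsSol ω κ τ s U) : (U 0).2 = s := by
  simpa using hU.snd_eq ⟨le_rfl, pi_pos.le⟩

theorem traj (hκ : 0 ≤ κ) (hτ : 0 ≤ τ) (hs : s ≠ 0) (hU : IsSol ω κ τ s U) :
    Traj (fun t => reaction ω κ τ t (U t).1) (fun t => (U t).1) (fun t => (U t).2) ∅
      (ω ^ 2 + κ) := by
  have hUc := hU.cont
  exact Traj.of_integral hs (by fun_prop) (by fun_prop)
    (continuous_reaction (by fun_prop)).measurable (by positivity)
    (fun x => abs_reaction_le hκ hτ _) countable_empty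
    (fun x _ _ => (continuous_reaction (by fun_prop)).continuousAt)
    (fun x hx => hU.fst_eq hx) (fun x hx => hU.snd_eq hx)

end IsSol

namespace Traj

variable {n y y₁ : ℝ → ℝ} {C : Set ℝ} {K ω : ℝ}

/-- Between two consecutive multiples of `π`, the Prüfer angle determines the sign of `y`. -/
theorem sign_of_mem_Ioo (h : Traj n y y₁ C K) (hω : 0 < ω) {x : ℝ} (hx : x ∈ Icc 0 π) {i : ℤ}
    (h₁ : i * π < prufer ω n y y₁ x) (h₂ : prufer ω n y y₁ x < (i + 1) * π) :
    0 < (-1) ^ i * (y₁ 0 * y x) := by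
  obtain ⟨Z, hZ⟩ := h.polar hω
  obtain ⟨h3, -, h4⟩ := hZ x hx
  have h5 : 0 < sin (prufer ω n y y₁ x - i * π) :=
    sin_pos_of_pos_of_lt_pi (by linarith) (by linarith)
  rw [sin_sub_int_mul_pi] at h5
  have h6 := mul_pos h4 h5
  have h7 : ω * ((-1) ^ i * (y₁ 0 * y x)) =
      Z x * y₁ 0 * ((-1) ^ i * sin (prufer ω n y y₁ x)) := by
    linear_combination ((-1) ^ i * y₁ 0) * h3
  rw [← h7] at h6
  exact (mul_pos_iff_of_pos_left hω).1 h6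

/-- At a multiple of `π`, the Prüfer angle determines the sign of `y₁`. -/
theorem sign₁_of_eq (h : Traj n y y₁ C K) (hω : 0 < ω) {x : ℝ} (hx : x ∈ Icc 0 π) {i : ℤ}
    (hi : prufer ω n y y₁ x = i * π) : 0 < (-1) ^ i * (y₁ 0 * y₁ x) := by
  obtain ⟨Z, hZ⟩ := h.polar hω
  obtain ⟨-, h3, h4⟩ := hZ x hx
  rw [hi, cos_int_mul_pi] at h3
  have h5 : ((-1 : ℝ) ^ i) * (-1) ^ i = 1 := by
    rw [← zpow_add₀ (by norm_num), ← two_mul, zpow_mul]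
    norm_num
  rw [h3]
  linear_combination h4 - (y₁ 0 * Z x) * h5

theorem prufer_pos (h : Traj n y y₁ C K) (hω : 0 < ω) {x : ℝ} (hx : x ∈ Ioc 0 π) :
    0 < prufer ω n y y₁ x := by
  simpa using h.lt_prufer hω le_rfl hx.1 hx.2 (i := 0) (by simp [prufer_zero])

theorem prufer_le_mul (h : Traj n y y₁ C K) (hω : 0 < ω) {x : ℝ} (hx : x ∈ Icc 0 π)
    (hn : ∀ t ∈ Icc 0 x, y t * n t ≤ ω ^ 2 * y t ^ 2) : prufer ω n y y₁ x ≤ ω * x := by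
  have h1 := intervalIntegral.integral_mono_on hx.1 (h.speed_intervalIntegrable hω 0 x)
    (intervalIntegrable_const (c := ω)) (fun t ht => by
      have ht' : t ∈ Icc 0 π := ⟨ht.1, ht.2.trans hx.2⟩
      unfold pruferSpeed
      rw [div_le_iff₀ (h.energy_pos hω ht')]
      exact mul_le_mul_of_nonneg_left (by linarith [hn t ht]) hω.le)
  rw [intervalIntegral.integral_const, sub_zero, smul_eq_mul, mul_comm] at h1
  exact h1

theorem prufer_eq_mul (h : Traj n y y₁ C K) (hω : 0 < ω) {x : ℝ} (hx : x ∈ Icc 0 π)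
    (hn : ∀ t ∈ Icc 0 x, n t = ω ^ 2 * y t) : prufer ω n y y₁ x = ω * x := by
  have h1 : EqOn (pruferSpeed ω n y y₁) (fun _ => ω) (uIcc 0 x) := by
    intro t ht
    rw [uIcc_of_le hx.1] at ht
    have ht' : t ∈ Icc 0 π := ⟨ht.1, ht.2.trans hx.2⟩
    unfold pruferSpeed
    rw [hn t ht, div_eq_iff (h.energy_pos hω ht').ne']
    ring
  unfold prufer
  rw [intervalIntegral.integral_congr h1, intervalIntegral.integral_const, sub_zero, smul_eq_mul,
    mul_comm]

/-- The Prüfer angle takes intermediate values. -/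
theorem exists_prufer_eq (h : Traj n y y₁ C K) (hω : 0 < ω) {x c : ℝ} (hx : 0 ≤ x)
    (hc : 0 ≤ c) (hcx : c ≤ prufer ω n y y₁ x) : ∃ t ∈ Icc 0 x, prufer ω n y y₁ t = c :=
  intermediate_value_Icc hx (h.continuous_prufer hω).continuousOn ⟨by rwa [prufer_zero], hcx⟩

end Traj

/-- The Prüfer angle of a solution. -/
noncomputable def angle (ω κ τ : ℝ) (U : ℝ → ℝ × ℝ) (x : ℝ) : ℝ :=
  prufer ω (fun t => reaction ω κ τ t (U t).1) (fun t => (U t).1) (fun t => (U t).2) x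

theorem mul_reaction_le {ω κ τ x y : ℝ} (hκ : 0 ≤ κ) (hτ : 0 ≤ τ) :
    y * reaction ω κ τ x y ≤ ω ^ 2 * y ^ 2 := by
  have h1 : y * max (-(y + τ * |sin x|)) 0 ≤ 0 := by
    have h2 : 0 ≤ τ * |sin x| := by positivity
    rcases le_total (-(y + τ * |sin x|)) 0 with h | h
    · rw [max_eq_right h, mul_zero]
    · rw [max_eq_left h]
      exact mul_nonpos_of_nonpos_of_nonneg (by linarith) h
  have h3 := mul_nonneg hκ (neg_nonneg.2 h1)
  unfold reaction
  nlinarith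

theorem reaction_eq_of_nonneg {ω κ τ x y : ℝ} (h : 0 ≤ y + τ * |sin x|) :
    reaction ω κ τ x y = ω ^ 2 * y := by
  rw [reaction, max_eq_right (by linarith), mul_zero, add_zero]

theorem reaction_eq_of_nonpos {ω κ τ x y : ℝ} (h : y + τ * |sin x| ≤ 0) :
    reaction ω κ τ x y = (ω ^ 2 - κ) * y - κ * (τ * |sin x|) := by
  rw [reaction, max_eq_left (by linarith)]
  ring

namespace IsSol

variable {ω κ τ s : ℝ} {U : ℝ → ℝ × ℝ}

theorem angle_le (hκ : 0 ≤ κ) (hω : 0 < ω) (hτ : 0 ≤ τ) (hs : s ≠ 0) (hU : IsSol ω κ τ s U) :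
    angle ω κ τ U π ≤ ω * π :=
  (hU.traj hκ hτ hs).prufer_le_mul hω ⟨pi_pos.le, le_rfl⟩ fun _ _ => mul_reaction_le hκ hτ

/-- Without shift, the angle cannot cross a negative nodal interval. -/
theorem angle_zero_lt (hκ : 0 ≤ κ) (hω : 0 < ω) (hκω : ω ^ 2 - κ < 1) (hs : s ≠ 0)
    (hU : IsSol ω κ 0 s U) {i : ℤ} (hi0 : 0 ≤ i) (hi : (-1) ^ i * s < 0) :
    angle ω κ 0 U π < (i + 1) * π := by
  have hT := hU.traj hκ le_rfl hs
  have hUc := hU.cont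
  by_contra! hle
  have hi0' : (0 : ℝ) ≤ i := by exact_mod_cast hi0
  obtain ⟨x₂, hx₂, hθ₂⟩ := hT.exists_prufer_eq hω pi_pos.le (by positivity) hle
  obtain ⟨x₁, hx₁, hθ₁⟩ := hT.exists_prufer_eq hω hx₂.1 (c := i * π) (by positivity)
    (by rw [hθ₂]; nlinarith [pi_pos])
  have hne : x₁ ≠ x₂ := by
    rintro rfl
    rw [hθ₁] at hθ₂
    nlinarith [pi_pos]
  have hlt : x₁ < x₂ := lt_of_le_of_ne hx₁.2 hne
  have hmem₁ : x₁ ∈ Icc 0 π := ⟨hx₁.1, hx₁.2.trans hx₂.2⟩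
  have hy₁ : (U x₁).1 = 0 := by
    rw [hT.eq_zero_iff_sin_prufer hω hmem₁, hθ₁, sin_int_mul_pi]
  have hθ₂' : angle ω κ 0 U x₂ = ((i + 1 : ℤ) : ℝ) * π := by
    push_cast
    exact hθ₂
  have hy₂ : (U x₂).1 = 0 := by
    refine (hT.eq_zero_iff_sin_prufer hω hx₂).2 ?_
    rw [← angle, hθ₂', sin_int_mul_pi]
  have hneg : ∀ x ∈ Ioo x₁ x₂, (U x).1 < 0 := by
    intro x hx
    have hx' : x ∈ Icc 0 π := ⟨hx₁.1.trans hx.1.le, hx.2.le.trans hx₂.2⟩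
    have h1 := hT.lt_prufer hω hx₁.1 hx.1 hx'.2 hθ₁.ge
    have h2 : angle ω κ 0 U x < (i + 1) * π := by
      by_contra! hcon
      have h3 := hT.lt_prufer hω hx'.1 hx.2 hx₂.2 (i := i + 1) (by push_cast; exact hcon)
      exact h3.ne' hθ₂'
    have h4 := hT.sign_of_mem_Ioo hω hx' h1 h2
    simp only [hU.init₁] at h4
    rw [← mul_assoc] at h4
    exact neg_of_mul_pos_right h4 hi.le
  have hd₂ : 0 < (U x₂).2 := by
    have h1 := hT.sign₁_of_eq hω hx₂ hθ₂'
    simp only [hU.init₁] at h1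
    rw [zpow_add₀ (by norm_num), zpow_one, ← mul_assoc] at h1
    exact (mul_pos_iff_of_pos_left (by linarith)).1 h1
  have hS : 0 ≤ sin (x₂ - x₁) :=
    sin_nonneg_of_nonneg_of_le_pi (by linarith) (by linarith [hx₂.2, hx₁.1])
  have hanti : StrictAntiOn (fun x => (U x).2 * sin (x - x₁) - (U x).1 * cos (x - x₁))
      (Icc x₁ x₂) := by
    refine strictAntiOn_of_deriv_neg (convex_Icc _ _) (by fun_prop) fun x hx => ?_
    rw [interior_Icc] at hx
    have hx' : x ∈ Ioo 0 π := ⟨hx₁.1.trans_lt hx.1, hx.2.trans_le hx₂.2⟩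
    have hd : HasDerivAt (fun x => x - x₁) 1 x := (hasDerivAt_id x).sub_const x₁
    have h1 := ((hT.deriv₁ x hx' (notMem_empty x)).mul hd.sin).sub
      ((hT.deriv x hx').mul hd.cos)
    have h2 : 0 < sin (x - x₁) :=
      sin_pos_of_pos_of_lt_pi (by linarith [hx.1]) (by linarith [hx.2, hx₂.2, hx₁.1])
    have h3 := hneg x hx
    rw [reaction_eq_of_nonpos (by linarith)] at h1
    refine lt_of_eq_of_lt h1.deriv ?_
    have h4 : (1 - (ω ^ 2 - κ)) * ((U x).1 * sin (x - x₁)) < 0 :=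
      mul_neg_of_pos_of_neg (by linarith) (mul_neg_of_neg_of_pos h3 h2)
    linear_combination h4
  have h1 := hanti ⟨le_rfl, hlt.le⟩ ⟨hlt.le, le_rfl⟩ hlt
  simp only [hy₁, hy₂, sub_self, sin_zero, zero_mul, mul_zero] at h1
  have h2 := mul_nonneg hd₂.le hS
  linarith

/-- Without shift and with positive initial slope, the first bump ends before `π`. -/
theorem pi_lt_angle_zero (hκ : 0 ≤ κ) (hω : 1 < ω) (hs : 0 < s) (hU : IsSol ω κ 0 s U) :
    π < angle ω κ 0 U π := by
  have hT := hU.traj hκ le_rfl hs.ne'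
  have hω0 : 0 < ω := by linarith
  by_contra! hle
  have h1 := hT.prufer_eq_mul hω0 (x := π) ⟨pi_pos.le, le_rfl⟩ (fun t ht => by
    refine reaction_eq_of_nonneg ?_
    rw [zero_mul, add_zero]
    by_contra! hneg
    have ht0 : t ≠ 0 := by
      rintro rfl
      exact hneg.ne hT.init
    have htπ : t < π ∨ t = π := lt_or_eq_of_le ht.2
    have h2 := hT.prufer_pos hω0 ⟨lt_of_le_of_ne ht.1 ht0.symm, ht.2⟩
    have h3 : angle ω κ 0 U t ≤ π := by
      rcases htπ with htπ | rfl
      · by_contra! hcon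
        have h3 := hT.lt_prufer hω0 ht.1 htπ le_rfl (i := 1) (by rw [Int.cast_one, one_mul]; exact hcon.le)
        simp only [Int.cast_one, one_mul] at h3
        exact not_lt.2 hle h3
      · exact hle
    rcases lt_or_eq_of_le h3 with h3 | h3
    · have h4 := hT.sign_of_mem_Ioo hω0 ht (i := 0) (by simpa using h2)
        (by rw [Int.cast_zero, zero_add, one_mul]; exact h3)
      simp only [hU.init₁, zpow_zero, one_mul] at h4
      exact not_lt.2 hneg.le ((mul_pos_iff_of_pos_left hs).1 h4)
    · refine hneg.ne ((hT.eq_zero_iff_sin_prufer hω0 ht).2 ?_)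
      rw [← angle, h3, sin_pi])
  have h2 : angle ω κ 0 U π = ω * π := h1
  nlinarith [pi_pos]

theorem norm_le (hκ : 0 ≤ κ) (hτ : 0 ≤ τ) (hU : IsSol ω κ τ s U) {x : ℝ} (hx : x ∈ Icc 0 π) :
    ‖U x‖ ≤ |s| * exp ((1 + ω ^ 2 + κ) * π) := by
  have h0 : IsSol ω κ τ 0 (fun _ => 0) := by
    refine ⟨continuous_const, fun x _ => ?_⟩
    have h1 : ∀ t, reaction ω κ τ t 0 = 0 := fun t => by
      simpa using abs_reaction_le (ω := ω) (x := t) hκ hτ 0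
    simp [h1, ← Prod.zero_eq_mk]
  simpa using hU.norm_sub_le hκ h0 hx

/-- For a large shift the jump is invisible on `[0, x₀]`, where the motion is harmonic. -/
theorem eventually_angle_eq (hκ : 0 ≤ κ) (hω : 0 < ω) (hs : s ≠ 0) {x₀ : ℝ} (hx₀ : x₀ ∈ Ioo 0 π) :
    ∃ τ₁ > 0, ∀ τ ≥ τ₁, ∀ U, IsSol ω κ τ s U → angle ω κ τ U x₀ = ω * x₀ := by
  set B := |s| * exp ((1 + ω ^ 2 + κ) * π) with hB
  have hs0 : 0 < sin x₀ := sin_pos_of_pos_of_lt_pi hx₀.1 hx₀.2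
  have hB0 : 0 < B := by positivity
  have hx₀0 := hx₀.1
  refine ⟨B * x₀ / sin x₀, by positivity, fun τ hτ U hU => ?_⟩
  have hτ0 : 0 ≤ τ := le_trans (by positivity) hτ
  refine (hU.traj hκ hτ0 hs).prufer_eq_mul hω (Ioo_subset_Icc_self hx₀) fun t ht => ?_
  refine reaction_eq_of_nonneg ?_
  have ht' : t ∈ Icc 0 π := ⟨ht.1, ht.2.trans hx₀.2.le⟩
  have h1 : |(U t).1| ≤ B * t := by
    rw [hU.fst_eq ht', zero_add]
    have := intervalIntegral.norm_integral_le_of_norm_le_const (a := 0) (b := t) (C := B)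
      (f := fun t => (U t).2) (fun r hr => by
        rw [uIoc_of_le ht.1] at hr
        exact (norm_snd_le (U r)).trans (hU.norm_le hκ hτ0 ⟨hr.1.le, hr.2.trans ht'.2⟩))
    rwa [sub_zero, abs_of_nonneg ht.1] at this
  have h2 : t / x₀ * sin x₀ ≤ sin t := by
    have h3 := strictConcaveOn_sin_Icc.concaveOn.2 (⟨le_rfl, pi_pos.le⟩ : (0 : ℝ) ∈ Icc 0 π)
      (Ioo_subset_Icc_self hx₀)
      (by rw [sub_nonneg, div_le_one hx₀0]; exact ht.2 : 0 ≤ 1 - t / x₀)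
      (div_nonneg ht.1 hx₀0.le) (by ring)
    simp only [smul_eq_mul, sin_zero, mul_zero, zero_add, div_mul_cancel₀ _ hx₀0.ne'] at h3
    exact h3
  have h4 : B * t ≤ τ * sin t := by
    calc B * t = B * x₀ / sin x₀ * (t / x₀ * sin x₀) := by field_simp
      _ ≤ τ * sin t := mul_le_mul hτ h2 (mul_nonneg (div_nonneg ht.1 hx₀0.le) hs0.le) hτ0
  have h5 := mul_le_mul_of_nonneg_left (le_abs_self (sin t)) hτ0
  linarith [(abs_le.1 h1).1]

end IsSol

/-- The angle of the solution depends continuously on the shift. -/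
theorem continuousOn_angle {ω κ s : ℝ} (hκ : 0 ≤ κ) (hω : 0 < ω) (hs : s ≠ 0)
    {U : ℝ → ℝ → ℝ × ℝ} (hU : ∀ τ, IsSol ω κ τ s (U τ)) :
    ContinuousOn (fun τ => angle ω κ τ (U τ) π) (Ici 0) := by
  intro τ₀ hτ₀
  have hUt : ∀ t ∈ Icc 0 π, Tendsto (fun τ => U τ t) (𝓝[Ici 0] τ₀) (𝓝 (U τ₀ t)) := by
    intro t ht
    rw [tendsto_iff_norm_sub_tendsto_zero]
    refine squeeze_zero (fun _ => norm_nonneg _) (fun τ => (hU τ).norm_sub_le hκ (hU τ₀) ht) ?_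
    have : Continuous fun τ =>
      (|s - s| + π * (κ * |τ - τ₀|)) * exp ((1 + ω ^ 2 + κ) * π) := by fun_prop
    have h1 := (this.tendsto τ₀).mono_left (nhdsWithin_le_nhds (s := Ici 0))
    simpa using h1
  refine intervalIntegral.continuousWithinAt_of_dominated_interval
    (bound := fun _ => ω * (1 + (ω ^ 2 + κ) / ω ^ 2)) ?_ ?_ intervalIntegrable_const ?_
  · filter_upwards [self_mem_nhdsWithin] with τ hτ
    have := ((hU τ).traj hκ hτ hs).speed_intervalIntegrable hω 0 π
    rw [intervalIntegrable_iff] at this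
    exact this.aestronglyMeasurable
  · filter_upwards [self_mem_nhdsWithin] with τ hτ
    exact Eventually.of_forall fun t _ =>
      abs_pruferSpeed_le hω (by positivity) (abs_reaction_le hκ hτ _)
  · refine Eventually.of_forall fun t ht => ?_
    rw [uIoc_of_le pi_pos.le] at ht
    have ht' : t ∈ Icc 0 π := Ioc_subset_Icc_self ht
    have h1 : Tendsto (fun τ => (U τ t).1) (𝓝[Ici 0] τ₀) (𝓝 (U τ₀ t).1) :=
      (continuous_fst.tendsto _).comp (hUt t ht')
    have h2 : Tendsto (fun τ => (U τ t).2) (𝓝[Ici 0] τ₀) (𝓝 (U τ₀ t).2) :=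
      (continuous_snd.tendsto _).comp (hUt t ht')
    have h3 : Tendsto (fun τ => reaction ω κ τ t (U τ t).1) (𝓝[Ici 0] τ₀)
        (𝓝 (reaction ω κ τ₀ t (U τ₀ t).1)) := by
      unfold reaction
      exact (h1.const_mul _).add ((((h1.add ((tendsto_id.mono_left nhdsWithin_le_nhds).mul_const
        _)).neg).max tendsto_const_nhds).const_mul κ)
    exact (((h2.pow 2).add (h1.mul h3)).const_mul ω).div ((h2.pow 2).add ((h1.pow 2).const_mul _))
      (((hU τ₀).traj hκ hτ₀ hs).energy_pos hω ht').ne'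

/-- A function with positive derivative at a zero is positive just to the right of it. -/
theorem HasDerivAt.eventually_pos_right {g : ℝ → ℝ} {g' x : ℝ} (h : HasDerivAt g g' x)
    (hg' : 0 < g') (hx : g x = 0) : ∀ᶠ t in 𝓝[>] x, 0 < g t := by
  have h1 := ((hasDerivAt_iff_tendsto_slope.1 h).eventually (lt_mem_nhds hg')).filter_mono
    (nhdsWithin_mono x fun s (hs : s ∈ Ioi x) => ne_of_gt hs)
  filter_upwards [h1, self_mem_nhdsWithin] with s hs hxs
  rw [slope_def_field, hx, sub_zero] at hs
  exact (div_pos_iff_of_pos_right (sub_pos.2 hxs)).1 hs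

/-- The coefficient of the linearization of the reaction along `y`. -/
noncomputable def coef (ω κ τ : ℝ) (y : ℝ → ℝ) (x : ℝ) : ℝ :=
  if y x + τ * |sin x| < 0 then ω ^ 2 - κ else ω ^ 2

/-- The points at which the linearization is discontinuous. -/
def jumpSet (τ : ℝ) (y : ℝ → ℝ) : Set ℝ := {x ∈ Ioo 0 π | y x + τ * |sin x| = 0}

theorem measurable_coef {ω κ τ : ℝ} {y : ℝ → ℝ} (hy : Continuous y) :
    Measurable (coef ω κ τ y) := by
  unfold coef
  refine Measurable.ite ?_ measurable_const measurable_const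
  exact measurableSet_lt (by fun_prop) measurable_const

theorem abs_coef_le {ω κ τ : ℝ} (hκ : 0 ≤ κ) {y : ℝ → ℝ} (x : ℝ) :
    |coef ω κ τ y x| ≤ ω ^ 2 + κ := by
  have := sq_nonneg ω
  unfold coef
  split_ifs <;> rw [abs_le] <;> constructor <;> linarith

theorem abs_coef_sub_le {ω κ τ : ℝ} (hκ : 0 ≤ κ) {y : ℝ → ℝ} (x : ℝ) :
    |coef ω κ τ y x - ω ^ 2| ≤ κ := by
  unfold coef
  split_ifs <;> rw [abs_le] <;> constructor <;> linarith

theorem continuousAt_coef {ω κ τ : ℝ} {y : ℝ → ℝ} (hy : Continuous y) {x : ℝ}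
    (hx : y x + τ * |sin x| ≠ 0) : ContinuousAt (coef ω κ τ y) x := by
  have hc : Continuous fun t => y t + τ * |sin t| := by fun_prop
  rcases lt_or_gt_of_ne hx with h | h
  · refine (continuousAt_const (y := ω ^ 2 - κ)).congr ?_
    filter_upwards [hc.continuousAt.eventually (gt_mem_nhds h)] with t ht
    rw [coef, if_pos ht]
  · refine (continuousAt_const (y := ω ^ 2)).congr ?_
    filter_upwards [hc.continuousAt.eventually (lt_mem_nhds h)] with t ht
    rw [coef, if_neg (not_lt.2 (le_of_lt ht))]

/-- `W = (w, w')` solves the linearized equation along `y` with `w 0 = 0`, `w' 0 = 1`. -/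
structure IsLin (ω κ τ : ℝ) (y : ℝ → ℝ) (W : ℝ → ℝ × ℝ) : Prop where
  cont : Continuous W
  eq : ∀ x ∈ Icc 0 π, W x = (0, 1) + ∫ t in (0 : ℝ)..x, ((W t).2, -(coef ω κ τ y t * (W t).1))

theorem norm_linField_sub_le {ω κ τ t : ℝ} (hκ : 0 ≤ κ) {y : ℝ → ℝ} (p q : ℝ × ℝ) :
    ‖(p.2, -(coef ω κ τ y t * p.1)) - (q.2, -(coef ω κ τ y t * q.1))‖ ≤
      (1 + ω ^ 2 + κ) * ‖p - q‖ := by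
  have h1 : |p.1 - q.1| ≤ ‖p - q‖ := norm_fst_le (p - q)
  have h2 : |p.2 - q.2| ≤ ‖p - q‖ := norm_snd_le (p - q)
  have h5 := norm_nonneg (p - q)
  have h6 := sq_nonneg ω
  have h8 : 0 ≤ (ω ^ 2 + κ) * ‖p - q‖ := by positivity
  have h9 : |coef ω κ τ y t| * |p.1 - q.1| ≤ (ω ^ 2 + κ) * ‖p - q‖ :=
    mul_le_mul (abs_coef_le hκ t) h1 (abs_nonneg _) (by positivity)
  rw [Prod.mk_sub_mk, Prod.norm_mk]
  refine max_le ?_ ?_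
  · rw [Real.norm_eq_abs]
    linarith
  · rw [Real.norm_eq_abs, neg_sub_neg, ← mul_sub, abs_mul, abs_sub_comm]
    linarith

theorem intervalIntegrable_coef_mul {ω κ τ : ℝ} (hκ : 0 ≤ κ) {y g : ℝ → ℝ} (hy : Continuous y)
    (hg : Continuous g) (a b : ℝ) :
    IntervalIntegrable (fun t => coef ω κ τ y t * g t) volume a b := by
  refine intervalIntegrable_of_abs_le (g := fun t => (ω ^ 2 + κ) * |g t|)
    ((measurable_coef hy).mul hg.measurable) (by fun_prop) (fun x => ?_) a b
  rw [Pi.mul_apply, abs_mul]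
  exact mul_le_mul_of_nonneg_right (abs_coef_le hκ x) (abs_nonneg _)

theorem intervalIntegrable_linField {ω κ τ : ℝ} (hκ : 0 ≤ κ) {y : ℝ → ℝ} {W : ℝ → ℝ × ℝ}
    (hy : Continuous y) (hW : Continuous W) (a b : ℝ) :
    IntervalIntegrable (fun t => ((W t).2, -(coef ω κ τ y t * (W t).1))) volume a b := by
  have h1 : IntervalIntegrable (fun t => (W t).2) volume a b :=
    Continuous.intervalIntegrable (by fun_prop) _ _
  have h2 := (intervalIntegrable_coef_mul (ω := ω) (τ := τ) hκ hy
    (by fun_prop : Continuous fun t => (W t).1) a b).neg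
  exact ⟨h1.1.prodMk h2.1, h1.2.prodMk h2.2⟩

theorem exists_isLin {ω κ : ℝ} (hκ : 0 ≤ κ) (τ : ℝ) {y : ℝ → ℝ} (hy : Continuous y) :
    ∃ W, IsLin ω κ τ y W := by
  obtain ⟨W, hW, h⟩ := exists_volterra (E := ℝ × ℝ)
    (fun t p => (p.2, -(coef ω κ τ y t * p.1))) (L := 1 + ω ^ 2 + κ) (T := π)
    (by positivity) pi_pos.le (fun t a b => norm_linField_sub_le hκ a b)
    (fun z hz a b => intervalIntegrable_linField hκ hy hz a b) (0, 1)
  exact ⟨W, hW, h⟩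

theorem IsLin.traj {ω κ τ : ℝ} (hκ : 0 ≤ κ) {y : ℝ → ℝ} {W : ℝ → ℝ × ℝ} (hy : Continuous y)
    (hC : (jumpSet τ y).Countable) (hW : IsLin ω κ τ y W) :
    Traj (fun t => coef ω κ τ y t * (W t).1) (fun t => (W t).1) (fun t => (W t).2) (jumpSet τ y)
      (ω ^ 2 + κ) := by
  have hWc := hW.cont
  have hW₁ : Continuous fun t => (W t).1 := by fun_prop
  have hi := intervalIntegrable_coef_mul (ω := ω) (τ := τ) hκ hy hW₁
  refine Traj.of_integral one_ne_zero hW₁ (by fun_prop)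
    ((measurable_coef hy).mul hW₁.measurable) (by positivity) (fun x => ?_) hC (fun x hx hxC => ?_)
    (fun x hx => ?_) (fun x hx => ?_)
  · rw [abs_mul]
    exact mul_le_mul_of_nonneg_right (abs_coef_le hκ x) (abs_nonneg _)
  · exact (continuousAt_coef hy fun h => hxC ⟨hx, h⟩).mul hW₁.continuousAt
  · exact (fst_snd_of_volterra (Continuous.intervalIntegrable (by fun_prop) _ _) (hi 0 x).neg
      (hW.eq x hx)).1
  · exact (fst_snd_of_volterra (Continuous.intervalIntegrable (by fun_prop) _ _) (hi 0 x).neg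
      (hW.eq x hx)).2

theorem IsLin.init₁ {ω κ τ : ℝ} {y : ℝ → ℝ} {W : ℝ → ℝ × ℝ} (hW : IsLin ω κ τ y W) : (W 0).2 = 1 := by
  simp [hW.eq 0 ⟨le_rfl, pi_pos.le⟩]

theorem reaction_eq_coef {ω κ τ x : ℝ} {y : ℝ → ℝ} : reaction ω κ τ x (y x) =
    coef ω κ τ y x * y x - if y x + τ * |sin x| < 0 then κ * (τ * |sin x|) else 0 := by
  unfold coef
  split_ifs with h
  · exact reaction_eq_of_nonpos h.le
  · rw [reaction_eq_of_nonneg (not_lt.1 h), sub_zero]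

theorem abs_sin_sq_sub_sin_sq_le (a b : ℝ) : |sin a ^ 2 - sin b ^ 2| ≤ |a - b| := by
  have h1 : sin a ^ 2 - sin b ^ 2 = sin (a + b) * sin (a - b) := by
    rw [sin_add, sin_sub]
    linear_combination (sin b ^ 2) * sin_sq_add_cos_sq a - (sin a ^ 2) * sin_sq_add_cos_sq b
  rw [h1, abs_mul]
  exact (mul_le_of_le_one_left (abs_nonneg _) (abs_sin_le_one _)).trans abs_sin_le_abs

namespace Traj

variable {n y y₁ : ℝ → ℝ} {C : Set ℝ} {K ω : ℝ}

theorem pruferSpeed_eq (h : Traj n y y₁ C K) (hω : 0 < ω) {x r e : ℝ} (hx : x ∈ Icc 0 π)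
    (hn : n x = r * y x - e) : pruferSpeed ω n y y₁ x =
      ω - (ω ^ 2 - r) / ω * sin (prufer ω n y y₁ x) ^ 2 -
        ω * (y x * e) / (y₁ x ^ 2 + ω ^ 2 * y x ^ 2) := by
  obtain ⟨Z, hZ⟩ := h.polar hω
  obtain ⟨h1, h2, h3⟩ := hZ x hx
  have hR := h.energy_pos hω hx
  have hRZ : y₁ x ^ 2 + ω ^ 2 * y x ^ 2 = Z x ^ 2 := by
    rw [← mul_pow, h1, h2]
    linear_combination (Z x ^ 2) * sin_sq_add_cos_sq (prufer ω n y y₁ x)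
  have hs : sin (prufer ω n y y₁ x) ^ 2 =
      ω ^ 2 * y x ^ 2 / (y₁ x ^ 2 + ω ^ 2 * y x ^ 2) := by
    rw [eq_div_iff hR.ne', hRZ, ← mul_pow, ← mul_pow, h1, mul_comm]
  rw [hs, pruferSpeed, hn]
  field_simp
  ring

end Traj

namespace IsSol

variable {ω κ τ s : ℝ} {U W : ℝ → ℝ × ℝ}

theorem countable_jumpSet (hκ : 0 ≤ κ) (hω : 1 < ω) (hτ : 0 < τ) (hs : s ≠ 0)
    (hU : IsSol ω κ τ s U) : (jumpSet τ fun t => (U t).1).Countable := by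
  have hT := hU.traj hκ hτ.le hs
  refine Set.Countable.mono ?_
    (countable_setOfPred_isolated_right_within (s := jumpSet τ fun t => (U t).1))
  intro x hx
  refine ⟨hx, ?_⟩
  obtain ⟨hx0, hu⟩ := hx
  have hsin : ∀ t ∈ Ioo 0 π, |sin t| = sin t := fun t ht =>
    abs_of_nonneg (sin_pos_of_pos_of_lt_pi ht.1 ht.2).le
  have hd : ∀ t ∈ Ioo 0 π, HasDerivAt (fun t => (U t).1 + τ * sin t) ((U t).2 + τ * cos t) t :=
    fun t ht => (hT.deriv t ht).add ((hasDerivAt_sin t).const_mul τ)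
  have hd₁ := (hT.deriv₁ x hx0 (notMem_empty x)).add ((hasDerivAt_cos x).const_mul τ)
  have hu' : (U x).1 + τ * sin x = 0 := by rw [← hsin x hx0]; exact hu
  have hne : ∀ᶠ t in 𝓝[>] x, (U t).1 + τ * sin t ≠ 0 := by
    by_cases h0 : (U x).2 + τ * cos x = 0
    · have hpos : 0 < -reaction ω κ τ x (U x).1 + τ * -sin x := by
        rw [reaction_eq_of_nonneg (le_of_eq hu.symm)]
        have h1 : 0 < τ * sin x := mul_pos hτ (sin_pos_of_pos_of_lt_pi hx0.1 hx0.2)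
        have h2 : 0 < (ω ^ 2 - 1) * (τ * sin x) := mul_pos (by nlinarith) h1
        linear_combination h2 + ω ^ 2 * hu'
      obtain ⟨b, hb, hb'⟩ := (mem_nhdsGT_iff_exists_Ioo_subset' hx0.2).1
        (inter_mem (hd₁.eventually_pos_right hpos h0) (Ioo_mem_nhdsGT hx0.2))
      filter_upwards [Ioo_mem_nhdsGT hb] with t ht
      have hmono : StrictMonoOn (fun t => (U t).1 + τ * sin t) (Icc x t) := by
        have hUc := hU.cont
        refine strictMonoOn_of_deriv_pos (convex_Icc _ _) (by fun_prop) fun r hr => ?_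
        rw [interior_Icc] at hr
        have h1 := hb' ⟨hr.1, hr.2.trans ht.2⟩
        rw [(hd r ⟨hx0.1.trans hr.1, h1.2.2⟩).deriv]
        exact h1.1
      have := hmono ⟨le_rfl, ht.1.le⟩ ⟨ht.1.le, le_rfl⟩ ht.1
      simp only [hu'] at this
      exact this.ne'
    · exact ((hd x hx0).eventually_ne h0).filter_mono
        (nhdsWithin_mono x fun t (ht : t ∈ Ioi x) => ne_of_gt ht)
  rw [← eventually_false_iff_eq_bot, inter_comm, nhdsWithin_inter', eventually_inf_principal]
  filter_upwards [hne, Ioo_mem_nhdsGT hx0.2] with t ht ht' htC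
  rw [← hsin t ⟨hx0.1.trans ht'.1, ht'.2⟩] at ht
  exact ht htC.2

/-- The linearized flow rotates strictly less than the nonlinear one. -/
theorem prufer_lin_lt_angle (hκ : 0 < κ) (hω : 1 < ω) (hτ : 0 < τ) (hs : s ≠ 0)
    (hU : IsSol ω κ τ s U) (hW : IsLin ω κ τ (fun t => (U t).1) W)
    (hne : angle ω κ τ U π ≠ ω * π) (hπ : (U π).1 = 0) :
    prufer ω (fun t => coef ω κ τ (fun t => (U t).1) t * (W t).1) (fun t => (W t).1)
      (fun t => (W t).2) π < angle ω κ τ U π := by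
  have hω0 : 0 < ω := by linarith
  have hT := hU.traj hκ.le hτ.le hs
  have hUc := hU.cont
  have hC := hU.countable_jumpSet hκ.le hω hτ hs
  have hTW := hW.traj hκ.le (by fun_prop) hC
  set y := fun t => (U t).1 with hy
  set Ω := prufer ω (fun t => coef ω κ τ y t * (W t).1) (fun t => (W t).1) fun t => (W t).2
    with hΩ
  set θ := angle ω κ τ U with hθ
  have hyc : Continuous y := by fun_prop
  obtain ⟨x₀, hx₀, hneg⟩ : ∃ x ∈ Ioo 0 π, y x + τ * |sin x| < 0 := by
    by_contra! hcon
    refine hne (hT.prufer_eq_mul hω0 ⟨pi_pos.le, le_rfl⟩ fun t ht => reaction_eq_of_nonneg ?_)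
    rcases eq_endpoints_or_mem_Ioo_of_mem_Icc ht with rfl | rfl | ht
    · have := hT.init
      simp only [hy] at this
      simp [this]
    · simp [hπ]
    · exact hcon t ht
  set e : ℝ → ℝ := fun x => -(ω * (y x * if y x + τ * |sin x| < 0 then κ * (τ * |sin x|) else 0) /
    ((U x).2 ^ 2 + ω ^ 2 * y x ^ 2)) with he
  have he0 : ∀ x ∈ Ioo 0 π, 0 ≤ e x ∧ (y x + τ * |sin x| < 0 → 0 < e x) := by
    intro x hx
    have hR := hT.energy_pos hω0 (Ioo_subset_Icc_self hx)
    have hsin : 0 < |sin x| := abs_pos.2 (sin_pos_of_pos_of_lt_pi hx.1 hx.2).ne'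
    have hp : 0 < τ * |sin x| := mul_pos hτ hsin
    by_cases h : y x + τ * |sin x| < 0
    · have : 0 < e x := by
        simp only [he, if_pos h]
        rw [neg_pos]
        refine div_neg_of_neg_of_pos ?_ hR
        exact mul_neg_of_pos_of_neg hω0 (mul_neg_of_neg_of_pos (by linarith) (mul_pos hκ hp))
      exact ⟨this.le, fun _ => this⟩
    · simp [he, h]
  have hdθ : ∀ x ∈ Ioo 0 π, HasDerivAt θ
      (ω - (ω ^ 2 - coef ω κ τ y x) / ω * sin (θ x) ^ 2 + e x) x := by
    intro x hx
    have h1 := hT.hasDerivAt_prufer hω0 hx (notMem_empty x)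
    rwa [hT.pruferSpeed_eq hω0 (Ioo_subset_Icc_self hx) (reaction_eq_coef (y := y)),
      sub_eq_add_neg _ (_ / _)] at h1
  have hdΩ : ∀ x ∈ Ioo 0 π, x ∉ jumpSet τ y →
      HasDerivAt Ω (ω - (ω ^ 2 - coef ω κ τ y x) / ω * sin (Ω x) ^ 2) x := by
    intro x hx hxC
    have h1 := hTW.hasDerivAt_prufer hω0 hx hxC
    rw [hTW.pruferSpeed_eq hω0 (Ioo_subset_Icc_self hx) (sub_zero _).symm] at h1
    simpa using h1
  have hd : ∀ x ∈ Ioo 0 π, x ∉ jumpSet τ y → HasDerivAt (fun x => θ x - Ω x)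
      (-((ω ^ 2 - coef ω κ τ y x) / ω * (sin (θ x) ^ 2 - sin (Ω x) ^ 2)) + e x) x := by
    intro x hx hxC
    refine ((hdθ x hx).sub (hdΩ x hx hxC)).congr_deriv ?_
    ring
  have hge : ∀ x ∈ Ioo 0 π, x ∉ jumpSet τ y → -(κ / ω * |θ x - Ω x|) ≤
      -((ω ^ 2 - coef ω κ τ y x) / ω * (sin (θ x) ^ 2 - sin (Ω x) ^ 2)) + e x := by
    intro x hx hxC
    have h1 : |(ω ^ 2 - coef ω κ τ y x) / ω * (sin (θ x) ^ 2 - sin (Ω x) ^ 2)| ≤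
        κ / ω * |θ x - Ω x| := by
      rw [abs_mul, abs_div, abs_of_pos hω0, abs_sub_comm]
      exact mul_le_mul (div_le_div_of_nonneg_right (abs_coef_sub_le hκ.le x) hω0.le)
        (abs_sin_sq_sub_sin_sq_le _ _) (abs_nonneg _) (by positivity)
    linarith [(abs_le.1 h1).2, (he0 x hx).1]
  have hcont : ContinuousOn (fun x => θ x - Ω x) (Icc 0 π) :=
    ((hT.continuous_prufer hω0).sub (hTW.continuous_prufer hω0)).continuousOn
  have h0 : θ 0 - Ω 0 = 0 := by
    rw [show θ 0 = 0 from Traj.prufer_zero, show Ω 0 = 0 from Traj.prufer_zero, sub_zero]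
  by_contra! hle
  have hzero := eq_zero_of_deriv_ge_off_countable hC hcont hd hge
    (nonneg_of_deriv_ge_off_countable hC hcont hd hge h0) (sub_nonpos.2 hle)
  have hx₀C : x₀ ∉ jumpSet τ y := fun h => hneg.ne h.2
  have h1 := hd x₀ hx₀ hx₀C
  have h2 : HasDerivAt (fun x => θ x - Ω x) 0 x₀ := by
    refine (hasDerivAt_const x₀ (0 : ℝ)).congr_of_eventuallyEq ?_
    filter_upwards [Ioo_mem_nhds hx₀.1 hx₀.2] with t ht
    exact hzero t (Ioo_subset_Icc_self ht)
  have h3 := h1.unique h2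
  rw [sub_eq_zero.1 (hzero x₀ (Ioo_subset_Icc_self hx₀)), sub_self, mul_zero, neg_zero,
    zero_add] at h3
  exact ((he0 x₀ hx₀).2 hneg).ne' h3

end IsSol

/-- A function with positive derivative at a zero is negative just to the left of it. -/
theorem HasDerivAt.eventually_neg_left {g : ℝ → ℝ} {g' x : ℝ} (h : HasDerivAt g g' x)
    (hg' : 0 < g') (hx : g x = 0) : ∀ᶠ t in 𝓝[<] x, g t < 0 := by
  have h1 := ((hasDerivAt_iff_tendsto_slope.1 h).eventually (lt_mem_nhds hg')).filter_mono
    (nhdsWithin_mono x fun s (hs : s ∈ Iio x) => ne_of_lt hs)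
  filter_upwards [h1, self_mem_nhdsWithin] with s hs hxs
  rw [slope_def_field, hx, sub_zero] at hs
  by_contra! hcon
  exact not_lt.2 (div_nonpos_of_nonneg_of_nonpos hcon (sub_neg.2 hxs).le) hs

theorem exists_mul_pos_of_ne_zero {f : ℝ → ℝ} {a b : ℝ} (hab : a < b) (hf : ContinuousOn f (Icc a b))
    (h : ∀ x ∈ Ioo a b, f x ≠ 0) : ∃ ε : ℝ, ∀ x ∈ Ioo a b, 0 < ε * f x := by
  obtain ⟨m, hm⟩ := nonempty_Ioo.2 hab
  refine ⟨f m, fun x hx => ?_⟩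
  by_contra! hle
  have hsub : uIcc m x ⊆ Ioo a b := (ordConnected_Ioo).uIcc_subset hm hx
  have h0 : (0 : ℝ) ∈ uIcc (f m) (f x) := by
    rcases lt_or_gt_of_ne (h m hm) with h1 | h1
    · exact mem_uIcc.2 (Or.inl ⟨h1.le, nonneg_of_mul_nonpos_right hle h1⟩)
    · exact mem_uIcc.2 (Or.inr ⟨nonpos_of_mul_nonpos_right hle h1, h1.le⟩)
  obtain ⟨z, hz, hz0⟩ := intermediate_value_uIcc
    (hf.mono (hsub.trans Ioo_subset_Icc_self)) h0
  exact h z (hsub hz) hz0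

theorem nonneg_endpoints_of_pos {f : ℝ → ℝ} {a b : ℝ} (hab : a < b) (hf : ContinuousOn f (Icc a b))
    (h : ∀ x ∈ Ioo a b, 0 < f x) : 0 ≤ f a ∧ 0 ≤ f b := by
  have h1 : ∀ x ∈ closure (Ioo a b), 0 ≤ f x := by
    rw [← closure_Ioo hab.ne] at hf
    intro x hx
    exact closure_minimal (s := f '' Ioo a b) (t := Ici 0)
      (by rintro _ ⟨z, hz, rfl⟩; exact (h z hz).le) isClosed_Ici
      (hf.image_closure (mem_image_of_mem f hx))
  rw [closure_Ioo hab.ne] at h1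
  exact ⟨h1 a ⟨le_rfl, hab.le⟩, h1 b ⟨hab.le, le_rfl⟩⟩

/-- The Wronskian of `sin` and the first component. -/
noncomputable def wron (U : ℝ → ℝ × ℝ) (x : ℝ) : ℝ := (U x).2 * sin x - (U x).1 * cos x

/-- The value of `y'' + y` along a solution. -/
noncomputable def defect (ω κ τ : ℝ) (U : ℝ → ℝ × ℝ) (x : ℝ) : ℝ :=
  (U x).1 - reaction ω κ τ x (U x).1

/-- A solution of the Dirichlet problem together with its linearized flow. -/
structure Resonant (ω κ τ s : ℝ) (U W : ℝ → ℝ × ℝ) : Prop where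
  hκ : 0 < κ
  hω : 1 < ω
  hτ : 0 < τ
  hs : s ≠ 0
  sol : IsSol ω κ τ s U
  lin : IsLin ω κ τ (fun t => (U t).1) W
  end_eq : (U π).1 = 0

namespace Resonant

variable {ω κ τ s : ℝ} {U W : ℝ → ℝ × ℝ}

theorem traj (h : Resonant ω κ τ s U W) : Traj (fun t => reaction ω κ τ t (U t).1)
    (fun t => (U t).1) (fun t => (U t).2) ∅ (ω ^ 2 + κ) :=
  h.sol.traj h.hκ.le h.hτ.le h.hs

theorem countable (h : Resonant ω κ τ s U W) : (jumpSet τ fun t => (U t).1).Countable :=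
  h.sol.countable_jumpSet h.hκ.le h.hω h.hτ h.hs

theorem trajLin (h : Resonant ω κ τ s U W) :
    Traj (fun t => coef ω κ τ (fun t => (U t).1) t * (W t).1) (fun t => (W t).1)
      (fun t => (W t).2) (jumpSet τ fun t => (U t).1) (ω ^ 2 + κ) := by
  have := h.sol.cont
  exact h.lin.traj h.hκ.le (by fun_prop) h.countable

theorem continuous_wron (h : Resonant ω κ τ s U W) : Continuous (wron U) := by
  have := h.sol.cont
  unfold wron
  fun_prop

theorem continuous_defect (h : Resonant ω κ τ s U W) : Continuous (defect ω κ τ U) := by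
  have := h.sol.cont
  unfold defect
  fun_prop

theorem wron_zero (h : Resonant ω κ τ s U W) : wron U 0 = 0 := by
  have := h.traj.init
  simp [wron, this]

theorem wron_pi (h : Resonant ω κ τ s U W) : wron U π = 0 := by
  simp [wron, h.end_eq]

theorem defect_zero (h : Resonant ω κ τ s U W) : defect ω κ τ U 0 = 0 := by
  have := h.traj.init
  simp [defect, reaction, this]

theorem defect_pi (h : Resonant ω κ τ s U W) : defect ω κ τ U π = 0 := by
  simp [defect, reaction, h.end_eq]

theorem hasDerivAt_wron (h : Resonant ω κ τ s U W) {x : ℝ} (hx : x ∈ Ioo 0 π) :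
    HasDerivAt (wron U) (sin x * defect ω κ τ U x) x := by
  refine (((h.traj.deriv₁ x hx (notMem_empty x)).mul (hasDerivAt_sin x)).sub
    ((h.traj.deriv x hx).mul (hasDerivAt_cos x))).congr_deriv ?_
  unfold defect
  ring

theorem hasDerivAt_div_sin (h : Resonant ω κ τ s U W) {x : ℝ} (hx : x ∈ Ioo 0 π) :
    HasDerivAt (fun t => (U t).1 / sin t) (wron U x / sin x ^ 2) x :=
  (h.traj.deriv x hx).div (hasDerivAt_sin x) (sin_pos_of_pos_of_lt_pi hx.1 hx.2).ne'

theorem hasDerivAt_defect (h : Resonant ω κ τ s U W) {x : ℝ} (hx : x ∈ Ioo 0 π)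
    (hxC : x ∉ jumpSet τ fun t => (U t).1) : HasDerivAt (defect ω κ τ U)
      ((1 - coef ω κ τ (fun t => (U t).1) x) * (wron U x / sin x) +
        defect ω κ τ U x * cos x / sin x) x := by
  have hsin := sin_pos_of_pos_of_lt_pi hx.1 hx.2
  have hUc := h.sol.cont
  have hc : Continuous fun t => (U t).1 + τ * |sin t| := by fun_prop
  obtain ⟨r, c, hr, hrc⟩ : ∃ r c : ℝ, coef ω κ τ (fun t => (U t).1) x = r ∧
      ∀ᶠ t in 𝓝 x, defect ω κ τ U t = (1 - r) * (U t).1 + c * sin t := by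
    rcases lt_or_gt_of_ne (fun h0 => hxC ⟨hx, h0⟩ : (U x).1 + τ * |sin x| ≠ 0) with h1 | h1
    · refine ⟨ω ^ 2 - κ, κ * τ, if_pos h1, ?_⟩
      filter_upwards [hc.continuousAt.eventually (gt_mem_nhds h1), Ioo_mem_nhds hx.1 hx.2]
        with t ht ht'
      rw [defect, reaction_eq_of_nonpos ht.le,
        abs_of_pos (sin_pos_of_pos_of_lt_pi ht'.1 ht'.2)]
      ring
    · refine ⟨ω ^ 2, 0, if_neg (not_lt.2 h1.le), ?_⟩
      filter_upwards [hc.continuousAt.eventually (lt_mem_nhds h1)] with t ht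
      rw [defect, reaction_eq_of_nonneg (le_of_lt ht)]
      ring
  have h1 := (((h.traj.deriv x hx).const_mul (1 - r)).add
    ((hasDerivAt_sin x).const_mul c)).congr_of_eventuallyEq hrc
  refine h1.congr_deriv ?_
  rw [hr, hrc.self_of_nhds, wron]
  field_simp
  ring

theorem continuousOn_wron_div (h : Resonant ω κ τ s U W) :
    ContinuousOn (fun x => wron U x / sin x ^ 2) (Icc 0 π) := by
  have hVc := h.continuous_wron
  have hHc := h.continuous_defect
  have hd : ∀ x, HasDerivAt (fun x => sin x ^ 2) (2 * sin x * cos x) x := fun x =>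
    ((hasDerivAt_sin x).pow 2).congr_deriv (by norm_num)
  have hlim : ∀ a, a = 0 ∨ a = π → Tendsto (fun x => defect ω κ τ U x / (2 * cos x)) (𝓝 a)
      (𝓝 0) := by
    intro a ha
    have h1 : ContinuousAt (fun x => defect ω κ τ U x / (2 * cos x)) a :=
      hHc.continuousAt.div (by fun_prop) (by rcases ha with rfl | rfl <;> simp)
    have h2 := h1.tendsto
    rcases ha with rfl | rfl
    · rwa [h.defect_zero, zero_div] at h2
    · rwa [h.defect_pi, zero_div] at h2
  have hdiv : ∀ x, sin x ≠ 0 → defect ω κ τ U x / (2 * cos x) =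
      sin x * defect ω κ τ U x / (2 * sin x * cos x) := by
    intro x hx
    rw [mul_comm 2 (sin x), mul_assoc, mul_div_mul_left _ _ hx]
  intro x hx
  rcases eq_endpoints_or_mem_Ioo_of_mem_Icc hx with rfl | rfl | hx'
  · have hev : ∀ᶠ t in 𝓝[>] (0 : ℝ), t ∈ Ioo 0 (π / 2) := Ioo_mem_nhdsGT (by positivity)
    have hsc : ∀ t ∈ Ioo 0 (π / 2), 0 < sin t ∧ 0 < cos t := fun t ht =>
      ⟨sin_pos_of_pos_of_lt_pi ht.1 (by linarith [ht.2, ht.1]),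
        cos_pos_of_mem_Ioo ⟨by linarith [ht.1, pi_pos], ht.2⟩⟩
    have h1 : Tendsto (fun x => wron U x / sin x ^ 2) (𝓝[>] 0) (𝓝 0) := by
      refine HasDerivAt.lhopital_zero_nhdsGT (f' := fun x => sin x * defect ω κ τ U x)
        (g' := fun x => 2 * sin x * cos x) (hev.mono fun t ht =>
          h.hasDerivAt_wron ⟨ht.1, by linarith [ht.2, ht.1]⟩) (hev.mono fun t _ => hd t)
        (hev.mono fun t ht => ?_) ?_ ?_ ?_
      · have := hsc t ht
        exact (mul_pos (mul_pos two_pos this.1) this.2).ne'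
      · have := (hVc.tendsto 0).mono_left (nhdsWithin_le_nhds (s := Ioi 0))
        rwa [h.wron_zero] at this
      · have : Continuous fun x => sin x ^ 2 := by fun_prop
        have := (this.tendsto 0).mono_left (nhdsWithin_le_nhds (s := Ioi 0))
        simpa using this
      · exact ((hlim 0 (Or.inl rfl)).mono_left nhdsWithin_le_nhds).congr'
          (hev.mono fun t ht => hdiv t (hsc t ht).1.ne')
    have h2 : ContinuousWithinAt (fun x => wron U x / sin x ^ 2) (Ioi 0) 0 := by
      unfold ContinuousWithinAt
      simpa using h1
    exact (continuousWithinAt_Ioi_iff_Ici.1 h2).mono Icc_subset_Ici_self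
  · have hev : ∀ᶠ t in 𝓝[<] π, t ∈ Ioo (π / 2) π := Ioo_mem_nhdsLT (by linarith [pi_pos])
    have hsc : ∀ t ∈ Ioo (π / 2) π, 0 < sin t ∧ cos t < 0 := fun t ht =>
      ⟨sin_pos_of_pos_of_lt_pi (by linarith [ht.1, pi_pos]) ht.2,
        cos_neg_of_pi_div_two_lt_of_lt ht.1 (by linarith [ht.2, pi_pos])⟩
    have h1 : Tendsto (fun x => wron U x / sin x ^ 2) (𝓝[<] π) (𝓝 0) := by
      refine HasDerivAt.lhopital_zero_nhdsLT (f' := fun x => sin x * defect ω κ τ U x)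
        (g' := fun x => 2 * sin x * cos x) (hev.mono fun t ht =>
          h.hasDerivAt_wron ⟨by linarith [ht.1, pi_pos], ht.2⟩) (hev.mono fun t _ => hd t)
        (hev.mono fun t ht => ?_) ?_ ?_ ?_
      · have := hsc t ht
        exact (mul_neg_of_pos_of_neg (mul_pos two_pos this.1) this.2).ne
      · have := (hVc.tendsto π).mono_left (nhdsWithin_le_nhds (s := Iio π))
        rwa [h.wron_pi] at this
      · have : Continuous fun x => sin x ^ 2 := by fun_prop
        have := (this.tendsto π).mono_left (nhdsWithin_le_nhds (s := Iio π))
        simpa using this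
      · exact ((hlim π (Or.inr rfl)).mono_left nhdsWithin_le_nhds).congr'
          (hev.mono fun t ht => hdiv t (hsc t ht).1.ne')
    have h2 : ContinuousWithinAt (fun x => wron U x / sin x ^ 2) (Iio π) π := by
      unfold ContinuousWithinAt
      simpa using h1
    exact (continuousWithinAt_Iio_iff_Iic.1 h2).mono Icc_subset_Iic_self
  · have := sin_pos_of_pos_of_lt_pi hx'.1 hx'.2
    exact (hVc.continuousAt.div (by fun_prop) (by positivity)).continuousWithinAt

/-- A Picone-type function comparing the nonlinear and the linearized flow. -/
noncomputable def picone (ω κ τ : ℝ) (U W : ℝ → ℝ × ℝ) (x : ℝ) : ℝ :=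
  defect ω κ τ U x * (W x).1 - wron U x / sin x ^ 2 * ((W x).1 * cos x + (W x).2 * sin x)

theorem continuousOn_picone (h : Resonant ω κ τ s U W) :
    ContinuousOn (picone ω κ τ U W) (Icc 0 π) := by
  have hWc := h.lin.cont
  have hHc := h.continuous_defect
  exact ContinuousOn.sub (by fun_prop) (h.continuousOn_wron_div.mul (by fun_prop))

theorem hasDerivAt_picone (h : Resonant ω κ τ s U W) {x : ℝ} (hx : x ∈ Ioo 0 π)
    (hxC : x ∉ jumpSet τ fun t => (U t).1) : HasDerivAt (picone ω κ τ U W)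
      (2 * (wron U x * (W x).1) / sin x ^ 3) x := by
  have hsin := (sin_pos_of_pos_of_lt_pi hx.1 hx.2).ne'
  have hw := h.trajLin.deriv x hx
  have hw₁ := h.trajLin.deriv₁ x hx hxC
  have h1 := ((h.hasDerivAt_defect hx hxC).mul hw).sub
    (((h.hasDerivAt_wron hx).div ((hasDerivAt_sin x).pow 2) (pow_ne_zero 2 hsin)).mul
      ((hw.mul (hasDerivAt_cos x)).add (hw₁.mul (hasDerivAt_sin x))))
  refine HasDerivAt.congr_deriv (f := picone ω κ τ U W) h1 ?_
  simp only [Pi.mul_apply, Pi.add_apply, Pi.pow_apply, Pi.div_apply]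
  have hc : cos x ^ 2 = 1 - sin x ^ 2 := cos_sq' x
  norm_num
  field_simp
  generalize coef ω κ τ (fun t => (U t).1) x = r
  linear_combination (2 * (W x).1 * wron U x) * hc

/-- The linearized solution vanishes inside every nodal interval of the Wronskian. -/
theorem sturm (h : Resonant ω κ τ s U W) {a b : ℝ} (ha : 0 ≤ a) (hab : a < b) (hb : b ≤ π)
    (hVa : wron U a = 0) (hVb : wron U b = 0) (hV : ∀ x ∈ Ioo a b, wron U x ≠ 0)
    (hw : ∀ x ∈ Ioo a b, (W x).1 ≠ 0) : False := by
  have hVc := h.continuous_wron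
  have hWc := h.lin.cont
  have hw₁ : Continuous fun t => (W t).1 := by fun_prop
  obtain ⟨ε, hε⟩ := exists_mul_pos_of_ne_zero hab hVc.continuousOn hV
  obtain ⟨δ, hδ⟩ := exists_mul_pos_of_ne_zero hab hw₁.continuousOn hw
  obtain ⟨hwa, hwb⟩ := nonneg_endpoints_of_pos hab (hw₁.const_mul δ).continuousOn hδ
  have hsub : Ioo a b ⊆ Ioo 0 π := Ioo_subset_Ioo ha hb
  have hsubc : Icc a b ⊆ Icc 0 π := Icc_subset_Icc ha hb
  have hHa : 0 ≤ ε * defect ω κ τ U a := by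
    rcases ha.eq_or_lt with rfl | ha0
    · rw [h.defect_zero, mul_zero]
    by_contra! hneg
    have ha' : a ∈ Ioo 0 π := ⟨ha0, hab.trans_le hb⟩
    have hsin := sin_pos_of_pos_of_lt_pi ha'.1 ha'.2
    have h1 := ((h.hasDerivAt_wron ha').const_mul (-ε)).eventually_pos_right
      (by linear_combination mul_neg_of_neg_of_pos hneg hsin) (by rw [hVa, mul_zero])
    obtain ⟨t, ht, ht'⟩ := (h1.and (Ioo_mem_nhdsGT hab)).exists
    linarith [hε t ht']
  have hHb : ε * defect ω κ τ U b ≤ 0 := by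
    rcases hb.eq_or_lt with rfl | hb0
    · rw [h.defect_pi, mul_zero]
    by_contra! hpos
    have hb' : b ∈ Ioo 0 π := ⟨ha.trans_lt hab, hb0⟩
    have hsin := sin_pos_of_pos_of_lt_pi hb'.1 hb'.2
    have h1 := ((h.hasDerivAt_wron hb').const_mul ε).eventually_neg_left
      (by linear_combination mul_pos hpos hsin) (by rw [hVb, mul_zero])
    obtain ⟨t, ht, ht'⟩ := (h1.and (Ioo_mem_nhdsLT hab)).exists
    linarith [hε t ht']
  set g : ℝ → ℝ := fun x => ε * δ * picone ω κ τ U W x with hg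
  have hgc : ContinuousOn g (Icc a b) :=
    continuousOn_const.mul (h.continuousOn_picone.mono hsubc)
  have hgd : ∀ x ∈ Ioo a b, x ∉ jumpSet τ (fun t => (U t).1) →
      HasDerivAt g (ε * δ * (2 * (wron U x * (W x).1) / sin x ^ 3)) x := fun x hx hxC =>
    (h.hasDerivAt_picone (hsub hx) hxC).const_mul _
  have hgpos : ∀ x ∈ Ioo a b, 0 < ε * δ * (2 * (wron U x * (W x).1) / sin x ^ 3) := by
    intro x hx
    have hsin := sin_pos_of_pos_of_lt_pi (hsub hx).1 (hsub hx).2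
    have h1 := mul_pos (hε x hx) (hδ x hx)
    have h2 : ε * δ * (2 * (wron U x * (W x).1) / sin x ^ 3) =
        2 * (ε * wron U x * (δ * (W x).1)) / sin x ^ 3 := by ring
    rw [h2]
    positivity
  have hmono := monotoneOn_of_deriv_nonneg_off_countable h.countable hgc hgd
    fun x hx _ => (hgpos x hx).le
  have hga : 0 ≤ g a := by
    have : g a = ε * defect ω κ τ U a * (δ * (W a).1) := by
      simp only [hg, picone, hVa]
      ring
    rw [this]
    exact mul_nonneg hHa hwa
  have hgb : g b ≤ 0 := by
    have : g b = ε * defect ω κ τ U b * (δ * (W b).1) := by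
      simp only [hg, picone, hVb]
      ring
    rw [this]
    exact mul_nonpos_of_nonpos_of_nonneg hHb hwb
  have hg0 : ∀ x ∈ Ioo a b, g x = 0 := by
    intro x hx
    have h1 := hmono ⟨le_rfl, hab.le⟩ (Ioo_subset_Icc_self hx) hx.1.le
    have h2 := hmono (Ioo_subset_Icc_self hx) ⟨hab.le, le_rfl⟩ hx.2.le
    linarith
  obtain ⟨x, hx, hxC⟩ : ∃ x ∈ Ioo a b, x ∉ jumpSet τ fun t => (U t).1 := by
    by_contra! hcon
    exact (Cardinal.Real.Ioo_countable_iff.not.2 (not_le.2 hab)) (h.countable.mono hcon)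
  have h2 : HasDerivAt g 0 x := by
    refine (hasDerivAt_const x (0 : ℝ)).congr_of_eventuallyEq ?_
    filter_upwards [Ioo_mem_nhds hx.1 hx.2] with t ht
    exact hg0 t ht
  exact (hgpos x hx).ne' ((hgd x hx hxC).unique h2)

/-- At a zero of the Wronskian, the linearized flow has passed every multiple of `π` that the
nonlinear flow has passed. -/
theorem lt_prufer_lin (h : Resonant ω κ τ s U W) (i : ℕ) : ∀ x ∈ Ioc 0 π, wron U x = 0 →
    i * π < angle ω κ τ U x →
    i * π < prufer ω (fun t => coef ω κ τ (fun t => (U t).1) t * (W t).1) (fun t => (W t).1)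
      (fun t => (W t).2) x := by
  have hω0 : 0 < ω := by linarith [h.hω]
  have hT := h.traj
  have hTW := h.trajLin
  have hVc := h.continuous_wron
  set Ω := prufer ω (fun t => coef ω κ τ (fun t => (U t).1) t * (W t).1) (fun t => (W t).1)
    (fun t => (W t).2) with hΩ
  induction i with
  | zero =>
    intro x hx _ _
    simpa using hTW.prufer_pos hω0 hx
  | succ i ih =>
    intro x hx hVx hθx
    obtain ⟨x', hx', hθx'⟩ := hT.exists_prufer_eq hω0 hx.1.le (by positivity) hθx.le
    change angle ω κ τ U x' = _ at hθx'
    have hne : x' ≠ x := by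
      rintro rfl
      exact hθx.ne' hθx'
    have hlt : x' < x := lt_of_le_of_ne hx'.2 hne
    have h0 : 0 < x' := by
      refine lt_of_le_of_ne hx'.1 fun h0 => ?_
      have h1 : angle ω κ τ U 0 = 0 := Traj.prufer_zero
      rw [← h0, h1] at hθx'
      have : 0 < ((i + 1 : ℕ) : ℝ) * π := by positivity
      linarith
    have hmem : x' ∈ Ioo 0 π := ⟨h0, hlt.trans_le hx.2⟩
    have hyx' : (U x').1 = 0 := by
      refine (hT.eq_zero_iff_sin_prufer hω0 (Ioo_subset_Icc_self hmem)).2 ?_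
      rw [← angle, hθx', sin_nat_mul_pi]
    have hVx' : wron U x' ≠ 0 := by
      have h1 := hT.energy_pos hω0 (Ioo_subset_Icc_self hmem)
      have h2 := sin_pos_of_pos_of_lt_pi hmem.1 hmem.2
      have h3 : (U x').2 ≠ 0 := by
        intro h3
        simp [hyx', h3] at h1
      rw [wron, hyx', zero_mul, sub_zero]
      exact mul_ne_zero h3 h2.ne'
    obtain ⟨α, ⟨hα, hVα⟩, hαmax⟩ := (isCompact_Icc.inter_right
      (isClosed_singleton.preimage hVc) : IsCompact (Icc 0 x' ∩ wron U ⁻¹' {0})).exists_isGreatest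
      ⟨0, ⟨le_rfl, h0.le⟩, h.wron_zero⟩
    obtain ⟨β, ⟨hβ, hVβ⟩, hβmin⟩ := (isCompact_Icc.inter_right
      (isClosed_singleton.preimage hVc) : IsCompact (Icc x' x ∩ wron U ⁻¹' {0})).exists_isLeast
      ⟨x, ⟨hlt.le, le_rfl⟩, hVx⟩
    have hVα' : wron U α = 0 := hVα
    have hVβ' : wron U β = 0 := hVβ
    have hαx' : α < x' := lt_of_le_of_ne hα.2 (by rintro rfl; exact hVx' hVα')
    have hx'β : x' < β := lt_of_le_of_ne hβ.1 (by rintro rfl; exact hVx' hVβ')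
    have hV : ∀ t ∈ Ioo α β, wron U t ≠ 0 := by
      intro t ht h1
      rcases le_total t x' with h2 | h2
      · exact not_lt.2 (hαmax ⟨⟨hα.1.trans ht.1.le, h2⟩, h1⟩) ht.1
      · exact not_lt.2 (hβmin ⟨⟨h2, ht.2.le.trans hβ.2⟩, h1⟩) ht.2
    have hαπ : α ≤ π := hα.2.trans hmem.2.le
    have hβπ : β ≤ π := hβ.2.trans hx.2
    have hΩα : i * π ≤ Ω α := by
      rcases Nat.eq_zero_or_pos i with rfl | hi
      · rcases hα.1.eq_or_lt with h1 | h1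
        · rw [← h1, hΩ, Traj.prufer_zero]
          simp
        · simpa using (hTW.prufer_pos hω0 ⟨h1, hαπ⟩).le
      have hi' : (0 : ℝ) < i * π := by positivity
      have hθα : i * π < angle ω κ τ U α := by
        by_contra! hcon
        obtain ⟨z, hz, hθz⟩ := intermediate_value_Icc hα.2
          (hT.continuous_prufer hω0).continuousOn (⟨hcon, by
            change _ ≤ angle ω κ τ U x'
            rw [hθx']; push_cast; nlinarith [pi_pos]⟩ : (i : ℝ) * π ∈ Icc _ _)
        change angle ω κ τ U z = _ at hθz
        have hzx' : z < x' := by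
          refine lt_of_le_of_ne hz.2 ?_
          rintro rfl
          rw [hθx'] at hθz
          push_cast at hθz
          nlinarith [pi_pos]
        have hz0 : 0 < z := by
          refine lt_of_le_of_ne (hα.1.trans hz.1) ?_
          rintro rfl
          have h1 : angle ω κ τ U 0 = 0 := Traj.prufer_zero
          linarith
        have hyz : (U z).1 = 0 := by
          refine (hT.eq_zero_iff_sin_prufer hω0 ⟨hz0.le, hzx'.le.trans hmem.2.le⟩).2 ?_
          rw [← angle, hθz, sin_nat_mul_pi]
        have hsub : ∀ t ∈ Icc z x', t ∈ Ioo 0 π := fun t ht =>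
          ⟨hz0.trans_le ht.1, ht.2.trans_lt hmem.2⟩
        obtain ⟨ξ, hξ, hξ0⟩ := exists_hasDerivAt_eq_zero hzx'
          (f := fun t => (U t).1 / sin t) (f' := fun t => wron U t / sin t ^ 2)
          (fun t ht => (h.hasDerivAt_div_sin (hsub t ht)).continuousAt.continuousWithinAt)
          (by simp [hyz, hyx']) (fun t ht => h.hasDerivAt_div_sin (hsub t (Ioo_subset_Icc_self ht)))
        have hξ' := hsub ξ (Ioo_subset_Icc_self hξ)
        have h1 := sin_pos_of_pos_of_lt_pi hξ'.1 hξ'.2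
        refine hV ξ ⟨hz.1.trans_lt hξ.1, hξ.2.trans hx'β⟩ ?_
        simpa [h1.ne'] using hξ0
      refine (ih α ⟨lt_of_le_of_ne hα.1 ?_, hαπ⟩ hVα' hθα).le
      rintro rfl
      have h1 : angle ω κ τ U 0 = 0 := Traj.prufer_zero
      linarith
    have hΩβ : ((i + 1 : ℕ) : ℝ) * π < Ω β := by
      by_contra! hcon
      refine h.sturm hα.1 (hαx'.trans hx'β) hβπ hVα' hVβ' hV fun t ht => ?_
      have ht' : t ∈ Icc 0 π := ⟨hα.1.trans ht.1.le, ht.2.le.trans hβπ⟩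
      have h1 : (i : ℤ) * π < Ω t := hTW.lt_prufer hω0 hα.1 ht.1 ht'.2 (by simpa using hΩα)
      have h2 : Ω t < ((i : ℤ) + 1) * π := by
        by_contra! hcon'
        have h3 : ((i + 1 : ℕ) : ℤ) * π < Ω β := hTW.lt_prufer hω0 ht'.1 ht.2 hβπ
          (by push_cast; push_cast at hcon'; exact hcon')
        push_cast at h3 hcon
        linarith
      have h3 := hTW.sign_of_mem_Ioo hω0 ht' h1 h2
      intro h4
      simp [h4] at h3
    rcases hβ.2.eq_or_lt with rfl | hβx
    · exact hΩβ
    · have h3 : ((i + 1 : ℕ) : ℤ) * π < Ω x := hTW.lt_prufer hω0 (h0.le.trans hβ.1) hβx hx.2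
        (by push_cast; push_cast at hΩβ; exact hΩβ.le)
      push_cast at h3 ⊢
      exact h3

end Resonant

theorem abs_reaction_sub_coef_le {ω κ τ x a δ : ℝ} (hκ : 0 ≤ κ) {y : ℝ → ℝ}
    (h : |a - y x| ≤ δ) :
    |reaction ω κ τ x a - reaction ω κ τ x (y x) - coef ω κ τ y x * (a - y x)| ≤
      κ * (δ * if abs (y x + τ * |sin x|) ≤ δ then 1 else 0) := by
  have h0 := abs_le.1 h
  have key : reaction ω κ τ x a - reaction ω κ τ x (y x) - coef ω κ τ y x * (a - y x) =
      κ * (max (-(a + τ * |sin x|)) 0 - max (-(y x + τ * |sin x|)) 0 +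
        (if y x + τ * |sin x| < 0 then a - y x else 0)) := by
    unfold reaction coef
    split_ifs <;> ring
  rw [key, abs_mul, abs_of_nonneg hκ]
  refine mul_le_mul_of_nonneg_left ?_ hκ
  generalize τ * |sin x| = b at *
  split_ifs with h1 h2 h2
  · rw [max_eq_left (by linarith : 0 ≤ -(y x + b)), mul_one]
    rcases max_cases (-(a + b)) 0 with ⟨h3, h4⟩ | ⟨h3, h4⟩ <;> rw [h3, abs_le] <;>
      constructor <;> linarith
  · rw [abs_of_neg h1] at h2
    rw [max_eq_left (by linarith : 0 ≤ -(y x + b)), max_eq_left (by linarith), mul_zero]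
    exact (congrArg abs (by ring)).trans_le abs_zero.le
  · rw [max_eq_right (by linarith : -(y x + b) ≤ 0), mul_one]
    rcases max_cases (-(a + b)) 0 with ⟨h3, h4⟩ | ⟨h3, h4⟩ <;> rw [h3, abs_le] <;>
      constructor <;> linarith
  · rw [abs_of_nonneg (not_lt.1 h1)] at h2
    rw [max_eq_right (by linarith : -(y x + b) ≤ 0), max_eq_right (by linarith)]
    simp

namespace Resonant

variable {ω κ τ s : ℝ} {U W : ℝ → ℝ × ℝ}

theorem tendsto_integral_indicator (h : Resonant ω κ τ s U W) (c : ℝ) :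
    Tendsto (fun σ : ℝ => ∫ t in (0 : ℝ)..π,
      if abs ((U t).1 + τ * |sin t|) ≤ c * |σ - s| then (1 : ℝ) else 0) (𝓝 s) (𝓝 0) := by
  have hUc := h.sol.cont
  have hm : Measurable fun t => abs ((U t).1 + τ * |sin t|) := by fun_prop
  have key := intervalIntegral.tendsto_integral_filter_of_dominated_convergence
    (μ := volume) (a := 0) (b := π) (l := 𝓝 s)
    (F := fun σ t => if abs ((U t).1 + τ * |sin t|) ≤ c * |σ - s| then (1 : ℝ) else 0)
    (f := fun _ => 0) (fun _ => 1) ?_ ?_ intervalIntegrable_const ?_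
  · simpa using key
  · refine Eventually.of_forall fun σ => (Measurable.aestronglyMeasurable ?_)
    exact Measurable.ite (measurableSet_le hm measurable_const) measurable_const measurable_const
  · refine Eventually.of_forall fun σ => Eventually.of_forall fun t _ => ?_
    split_ifs <;> simp
  · have hnull : ∀ᵐ t ∂(volume : Measure ℝ),
        t ∉ (jumpSet τ fun t => (U t).1) ∪ {π} := by
      have := (h.countable.union (countable_singleton π)).measure_zero volume
      exact measure_eq_zero_iff_ae_notMem.1 this
    filter_upwards [hnull] with t ht htm
    rw [uIoc_of_le pi_pos.le] at htm
    have htπ : t ≠ π := fun hh => ht (Or.inr hh)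
    have ht0 : (U t).1 + τ * |sin t| ≠ 0 := fun hh =>
      ht (Or.inl ⟨⟨htm.1, lt_of_le_of_ne htm.2 htπ⟩, hh⟩)
    have hc : Continuous fun σ : ℝ => c * |σ - s| := by fun_prop
    have hev : ∀ᶠ σ in 𝓝 s, c * |σ - s| < abs ((U t).1 + τ * |sin t|) := by
      refine hc.continuousAt.eventually (gt_mem_nhds ?_)
      simpa using ht0
    refine tendsto_const_nhds.congr' ?_
    filter_upwards [hev] with σ hσ
    rw [if_neg (not_le.2 hσ)]

/-- The linearized flow is the derivative of the nonlinear flow in the initial slope. -/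
theorem hasDerivAt_slope (h : Resonant ω κ τ s U W) {V : ℝ → ℝ → ℝ × ℝ}
    (hV : ∀ σ, IsSol ω κ τ σ (V σ)) : HasDerivAt (fun σ => (V σ π).1) (W π).1 s := by
  have hκ := h.hκ.le
  have hUc := h.sol.cont
  have hWc := h.lin.cont
  have hπ : π ∈ Icc 0 π := ⟨pi_pos.le, le_rfl⟩
  set L := 1 + ω ^ 2 + κ with hL
  have hL0 : 0 ≤ L := by positivity
  set c := exp (L * π) with hc
  have hc0 : 0 < c := exp_pos _
  have hVs : ∀ x ∈ Icc 0 π, V s x = U x := fun x hx => (hV s).eqOn hκ h.sol hx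
  set J : ℝ → ℝ → ℝ := fun σ t =>
    if abs ((U t).1 + τ * |sin t|) ≤ c * |σ - s| then (1 : ℝ) else 0 with hJ
  have hJm : ∀ σ, Measurable (J σ) := fun σ => by
    have hm : Measurable fun t => abs ((U t).1 + τ * |sin t|) := by fun_prop
    exact Measurable.ite (measurableSet_le hm measurable_const) measurable_const measurable_const
  have hJ0 : ∀ σ t, 0 ≤ J σ t := fun σ t => by
    simp only [hJ]
    split_ifs <;> norm_num
  have hJ1 : ∀ σ t, |J σ t| ≤ 1 := fun σ t => by
    simp only [hJ]
    split_ifs <;> norm_num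
  have hJi : ∀ σ a b, IntervalIntegrable (J σ) volume a b := fun σ a b =>
    intervalIntegrable_of_abs_le (g := fun _ => 1) (hJm σ) continuous_const (hJ1 σ) a b
  have bound : ∀ σ, |(V σ π).1 - (U π).1 - (σ - s) * (W π).1| ≤
      (κ * c * c * ∫ t in (0 : ℝ)..π, J σ t) * |σ - s| := by
    intro σ
    have hVc := (hV σ).cont
    have hd : ∀ x ∈ Icc 0 π, ‖V σ x - U x‖ ≤ c * |σ - s| := by
      intro x hx
      have := (hV σ).norm_sub_le hκ h.sol hx
      simp only [sub_self, abs_zero, mul_zero, add_zero] at this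
      rwa [mul_comm]
    have hi1 : ∀ a b, IntervalIntegrable (fun t => ((V σ t).2, -reaction ω κ τ t (V σ t).1))
        volume a b := fun a b => Continuous.intervalIntegrable (by fun_prop) _ _
    have hi2 : ∀ a b, IntervalIntegrable (fun t => ((U t).2, -reaction ω κ τ t (U t).1))
        volume a b := fun a b => Continuous.intervalIntegrable (by fun_prop) _ _
    have hi3 := intervalIntegrable_linField (ω := ω) (κ := κ) (τ := τ) (y := fun t => (U t).1)
      hκ (by fun_prop) hWc
    have key := volterra_norm_sub_le (E := ℝ × ℝ) (U := fun x => V σ x - U x)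
      (V := fun x => (σ - s) • W x) (u₀ := (0, σ - s)) (v₀ := (0, σ - s))
      (Φ := fun t => ((V σ t).2, -reaction ω κ τ t (V σ t).1) -
        ((U t).2, -reaction ω κ τ t (U t).1))
      (Ψ := fun t => (σ - s) • ((W t).2, -(coef ω κ τ (fun t => (U t).1) t * (W t).1)))
      (e := fun t => κ * (c * |σ - s| * J σ t)) (T := π) hL0 (by fun_prop) (by fun_prop)
      (fun a b => (hi1 a b).sub (hi2 a b)) (fun a b => (hi3 a b).smul (σ - s))
      (fun a b => ((hJi σ a b).const_mul _).const_mul _)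
      (fun t => mul_nonneg hκ (mul_nonneg (by positivity) (hJ0 σ t)))
      (fun x hx => by
        rw [intervalIntegral.integral_sub (hi1 _ _) (hi2 _ _), (hV σ).eq x hx, h.sol.eq x hx]
        rw [add_sub_add_comm, Prod.mk_sub_mk, sub_zero])
      (fun x hx => by
        rw [intervalIntegral.integral_smul, h.lin.eq x hx, smul_add]
        simp)
      (fun t ht => by
        have e1 := abs_reaction_sub_coef_le (ω := ω) (τ := τ) (x := t) (a := (V σ t).1) hκ
          (y := fun t => (U t).1) (δ := c * |σ - s|) ((norm_fst_le (V σ t - U t)).trans (hd t ht))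
        have e2 := norm_fst_le ((V σ t - U t) - (σ - s) • W t)
        have e3 := norm_snd_le ((V σ t - U t) - (σ - s) • W t)
        have e4 := abs_coef_le (ω := ω) (τ := τ) hκ (y := fun t => (U t).1) t
        set R := ‖(V σ t - U t) - (σ - s) • W t‖ with hR
        have hR0 : 0 ≤ R := norm_nonneg _
        simp only [Prod.fst_sub, Prod.snd_sub, Prod.smul_fst, Prod.smul_snd, smul_eq_mul,
          Real.norm_eq_abs] at e2 e3
        have e5 : 0 ≤ κ * (c * |σ - s| * J σ t) :=
          mul_nonneg hκ (mul_nonneg (by positivity) (hJ0 σ t))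
        have e6 : |coef ω κ τ (fun t => (U t).1) t| * |(V σ t).1 - (U t).1 - (σ - s) * (W t).1| ≤
            (ω ^ 2 + κ) * R := mul_le_mul e4 e2 (abs_nonneg _) (by positivity)
        rw [← abs_mul] at e6
        have e7 : 0 ≤ (ω ^ 2 + κ) * R := by positivity
        simp only [Prod.mk_sub_mk, Prod.smul_mk, smul_eq_mul, Prod.norm_mk, Real.norm_eq_abs]
        refine max_le ?_ ?_
        · linarith
        · have e8 : -reaction ω κ τ t (V σ t).1 - -reaction ω κ τ t (U t).1 -
              (σ - s) * -(coef ω κ τ (fun t => (U t).1) t * (W t).1) =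
              -(reaction ω κ τ t (V σ t).1 - reaction ω κ τ t (U t).1 -
                coef ω κ τ (fun t => (U t).1) t * ((V σ t).1 - (U t).1)) -
              coef ω κ τ (fun t => (U t).1) t * ((V σ t).1 - (U t).1 - (σ - s) * (W t).1) := by
            ring
          rw [e8]
          refine (abs_sub _ _).trans ?_
          rw [abs_neg]
          have e9 : L * R = R + (ω ^ 2 + κ) * R := by rw [hL]; ring
          linarith [e1, e6, e9])
      π hπ
    have e1 := (norm_fst_le _).trans key
    simp only [Prod.fst_sub, Prod.smul_fst, smul_eq_mul, sub_self, norm_zero, zero_add,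
      intervalIntegral.integral_const_mul, Real.norm_eq_abs] at e1
    refine e1.trans_eq ?_
    rw [← hc]
    ring
  rw [hasDerivAt_iff_isLittleO, Asymptotics.isLittleO_iff]
  intro ε hε
  have hlim := (h.tendsto_integral_indicator c).const_mul (κ * c * c)
  rw [mul_zero] at hlim
  filter_upwards [hlim.eventually (gt_mem_nhds hε)] with σ hσ
  rw [hVs π hπ, smul_eq_mul, Real.norm_eq_abs, Real.norm_eq_abs]
  exact (bound σ).trans (mul_le_mul_of_nonneg_right hσ.le (abs_nonneg _))

/-- At a resonance the sign of the linearized flow at `π` is determined. -/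
theorem lin_pi_sign (h : Resonant ω κ τ s U W) {i : ℕ} (hi : (i : ℝ) + 1 ≠ ω)
    (hθ : angle ω κ τ U π = (i + 1) * π) : 0 < (-1) ^ (i : ℤ) * (W π).1 := by
  have hω0 : 0 < ω := by linarith [h.hω]
  have hπ : π ∈ Icc 0 π := ⟨pi_pos.le, le_rfl⟩
  have h1 := h.lt_prufer_lin i π ⟨pi_pos, le_rfl⟩ h.wron_pi
    (by rw [hθ]; nlinarith [pi_pos])
  have h2 := h.sol.prufer_lin_lt_angle h.hκ h.hω h.hτ h.hs h.lin
    (by rw [hθ]; exact fun hh => hi (mul_right_cancel₀ pi_ne_zero hh)) h.end_eq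
  rw [hθ] at h2
  have h3 := h.trajLin.sign_of_mem_Ioo hω0 hπ (i := i) (by exact_mod_cast h1) (by exact_mod_cast h2)
  simpa [h.lin.init₁] using h3

end Resonant

/-- The Prüfer angle at `π` crosses a multiple of `π` upwards as `τ` increases. -/
theorem eventually_angle_crossing {ω κ s τ₀ : ℝ} (hκ : 0 < κ) (hω : 1 < ω) (hs : s ≠ 0)
    {U : ℝ → ℝ → ℝ × ℝ} (hU : ∀ τ, IsSol ω κ τ s (U τ)) (hτ₀ : 0 < τ₀) {i : ℕ}
    (hi : (i : ℝ) + 1 ≠ ω) (hθ : angle ω κ τ₀ (U τ₀) π = (i + 1) * π) :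
    ∀ᶠ τ in 𝓝[≠] τ₀, 0 < (τ - τ₀) * (angle ω κ τ (U τ) π - (i + 1) * π) := by
  have hω0 : 0 < ω := by linarith
  have hπ : π ∈ Icc 0 π := ⟨pi_pos.le, le_rfl⟩
  have hT := fun (τ : ℝ) (hτ : 0 < τ) => (hU τ).traj hκ.le hτ.le hs
  have hend : (U τ₀ π).1 = 0 := by
    rw [(hT τ₀ hτ₀).eq_zero_iff_sin_prufer hω0 hπ]
    change sin (angle ω κ τ₀ (U τ₀) π) = 0
    rw [hθ]
    exact_mod_cast sin_int_mul_pi (i + 1)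
  obtain ⟨W, hW⟩ := exists_isLin (ω := ω) hκ.le τ₀ (y := fun t => (U τ₀ t).1)
    ((hU τ₀).cont.fst)
  have hR : Resonant ω κ τ₀ s (U τ₀) W := ⟨hκ, hω, hτ₀, hs, hU τ₀, hW, hend⟩
  have hw := hR.lin_pi_sign hi hθ
  choose V hV using fun σ => exists_isSol (ω := ω) hκ.le τ₀ σ
  have hd := hR.hasDerivAt_slope hV
  have hVs : (V s π).1 = 0 := by rw [(hV s).eqOn hκ.le (hU τ₀) hπ, hend]
  have hslope : ∀ᶠ σ in 𝓝[≠] s, 0 < (-1) ^ (i : ℤ) * ((σ - s) * (V σ π).1) := by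
    have h1 := (hasDerivAt_iff_tendsto_slope.1 hd).const_mul ((-1) ^ (i : ℤ))
    filter_upwards [h1.eventually (lt_mem_nhds hw), self_mem_nhdsWithin] with σ hσ hne
    have hne' : σ - s ≠ 0 := sub_ne_zero.2 hne
    have h2 : 0 < (σ - s) ^ 2 := by positivity
    have h3 := mul_pos h2 hσ
    rw [slope_def_field, hVs, sub_zero] at h3
    have : (σ - s) ^ 2 * ((-1) ^ (i : ℤ) * ((V σ π).1 / (σ - s))) =
        (-1) ^ (i : ℤ) * ((σ - s) * (V σ π).1) := by
      field_simp
    rwa [this] at h3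
  have hmap : Tendsto (fun τ => s * (τ₀ / τ)) (𝓝[≠] τ₀) (𝓝[≠] s) := by
    refine tendsto_nhdsWithin_iff.2 ⟨?_, ?_⟩
    · have : ContinuousAt (fun τ => s * (τ₀ / τ)) τ₀ :=
        continuousAt_const.mul (continuousAt_const.div continuousAt_id hτ₀.ne')
      have h1 := this.tendsto
      rw [div_self hτ₀.ne', mul_one] at h1
      exact h1.mono_left nhdsWithin_le_nhds
    · filter_upwards [self_mem_nhdsWithin,
        mem_nhdsWithin_of_mem_nhds (lt_mem_nhds hτ₀)] with τ hτ hτ0 hh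
      have h1 : τ₀ / τ = 1 := mul_left_cancel₀ hs (by simpa using hh)
      exact hτ ((div_eq_one_iff_eq (ne_of_gt hτ0)).1 h1).symm
  have hcont : ContinuousAt (fun τ => angle ω κ τ (U τ) π) τ₀ :=
    (continuousOn_angle hκ.le hω0 hs hU).continuousAt (Ici_mem_nhds hτ₀)
  have hnear : ∀ᶠ τ in 𝓝 τ₀, angle ω κ τ (U τ) π ∈ Ioo (i * π) ((i + 2) * π) := by
    refine hcont.eventually (Ioo_mem_nhds ?_ ?_) <;> dsimp only <;> rw [hθ] <;> nlinarith [pi_pos]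
  filter_upwards [hmap.eventually hslope, mem_nhdsWithin_of_mem_nhds hnear, self_mem_nhdsWithin,
    mem_nhdsWithin_of_mem_nhds (lt_mem_nhds hτ₀)] with τ h1 h2 hτ hτ0
  have hτ0' : 0 < τ := hτ0
  have h3 : IsSol ω κ τ₀ (s * (τ₀ / τ)) fun x => (τ₀ / τ) • U τ x := by
    have := (hU τ).smul (c := τ₀ / τ) (by positivity)
    rwa [div_mul_cancel₀ _ hτ0'.ne', mul_comm _ s] at this
  rw [(hV _).eqOn hκ.le h3 hπ, Prod.smul_fst, smul_eq_mul] at h1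
  have h4 : 0 < (-1) ^ (i : ℤ) * (s * (U τ π).1) * (τ₀ - τ) := by
    have h5 : 0 < τ ^ 2 / τ₀ := by positivity
    have h6 := mul_pos h5 h1
    have : τ ^ 2 / τ₀ * ((-1) ^ (i : ℤ) * ((s * (τ₀ / τ) - s) * (τ₀ / τ * (U τ π).1))) =
        (-1) ^ (i : ℤ) * (s * (U τ π).1) * (τ₀ - τ) := by
      field_simp
    rwa [this] at h6
  have hT' := hT τ hτ0'
  rcases lt_trichotomy (angle ω κ τ (U τ) π) ((i + 1) * π) with h5 | h5 | h5
  · have h6 := hT'.sign_of_mem_Ioo hω0 hπ (i := i) (by exact_mod_cast h2.1) (by exact_mod_cast h5)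
    rw [(hU τ).init₁] at h6
    have h7 := (mul_pos_iff_of_pos_left h6).1 h4
    exact mul_pos_of_neg_of_neg (by linarith) (by linarith)
  · have h6 : (U τ π).1 = 0 := by
      rw [hT'.eq_zero_iff_sin_prufer hω0 hπ]
      change sin (angle ω κ τ (U τ) π) = 0
      rw [h5]
      exact_mod_cast sin_int_mul_pi (i + 1)
    simp [h6] at h4
  · have h6 := hT'.sign_of_mem_Ioo hω0 hπ (i := i + 1) (by exact_mod_cast h5)
      (by push_cast; rw [add_assoc, one_add_one_eq_two]; exact_mod_cast h2.2)
    rw [(hU τ).init₁, zpow_add_one₀ (by norm_num)] at h6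
    refine mul_pos ?_ (by linarith)
    by_contra hcon
    nlinarith

/-- A continuous function which crosses every multiple of `π` upwards attains each multiple
between its extreme values exactly once. -/
theorem ncard_crossings {Θ : ℝ → ℝ} {j k : ℕ} (hΘ : ContinuousOn Θ (Ici 0))
    (h₀ : j * π < Θ 0) (h₁ : Θ 0 < (j + 1) * π) (hlt : ∀ τ, 0 ≤ τ → Θ τ < (k + 1) * π)
    {τ₁ : ℝ} (hτ₁ : 0 < τ₁) (hk : k * π < Θ τ₁)
    (hcross : ∀ τ₀, 0 < τ₀ → ∀ i : ℕ, Θ τ₀ = (i + 1) * π →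
      ∀ᶠ τ in 𝓝[≠] τ₀, 0 < (τ - τ₀) * (Θ τ - (i + 1) * π)) :
    {τ | 0 < τ ∧ ∃ i : ℕ, Θ τ = (i + 1) * π}.Finite ∧
      {τ | 0 < τ ∧ ∃ i : ℕ, Θ τ = (i + 1) * π}.ncard = k - j := by
  have hne0 : ∀ i : ℕ, Θ 0 ≠ (i + 1) * π := by
    intro i hi
    rw [hi] at h₀ h₁
    have h2 := lt_of_mul_lt_mul_right h₀ pi_pos.le
    have h3 := lt_of_mul_lt_mul_right h₁ pi_pos.le
    have h2' : j < i + 1 := by exact_mod_cast h2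
    have h3' : i + 1 < j + 1 := by exact_mod_cast h3
    omega
  have hup : ∀ (i : ℕ) (a b : ℝ), 0 ≤ a → a < b → (i + 1) * π ≤ Θ a → (i + 1) * π < Θ b := by
    intro i a b ha hab hia
    have hpos : ∀ x, a ≤ x → Θ x - (i + 1) * π = 0 → 0 < x := by
      intro x hx h
      refine lt_of_le_of_ne (ha.trans hx) fun hx0 => hne0 i ?_
      rw [hx0]
      linarith
    have key := pos_of_upcrossing (g := fun τ => Θ τ - (i + 1) * π) (a := a) (b := b)
      ((hΘ.mono fun x hx => ha.trans hx.1).sub continuousOn_const) (by linarith)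
      (fun x hx h => by
        have h1 := hcross x (hpos x hx.1 h) i (by linarith)
        filter_upwards [h1.filter_mono (nhdsWithin_mono x fun y (hy : x < y) => ne_of_gt hy),
          self_mem_nhdsWithin] with y hy hxy
        exact (mul_pos_iff_of_pos_left (sub_pos.2 hxy)).1 hy)
      (fun x hx h => by
        have h1 := hcross x (hpos x hx.1.le h) i (by linarith)
        filter_upwards [h1.filter_mono (nhdsWithin_mono x fun y (hy : y < x) => ne_of_lt hy),
          self_mem_nhdsWithin] with y hy hxy
        exact neg_of_mul_pos_right hy (sub_neg.2 hxy).le)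
      (x := b) ⟨hab, le_rfl⟩
    linarith
  have hex : ∀ i : ℕ, i ∈ Finset.Ico j k → ∃ τ, 0 < τ ∧ Θ τ = (i + 1) * π := by
    intro i hi
    rw [Finset.mem_Ico] at hi
    have h1 : ((j : ℝ) + 1) * π ≤ (i + 1) * π := by
      have : (j : ℝ) ≤ i := by exact_mod_cast hi.1
      nlinarith [pi_pos]
    have h2 : ((i : ℝ) + 1) * π ≤ k * π := by
      have : (i : ℝ) + 1 ≤ k := by exact_mod_cast hi.2
      nlinarith [pi_pos]
    obtain ⟨τ, hτ, h⟩ := intermediate_value_Ioo hτ₁.le (hΘ.mono Icc_subset_Ici_self)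
      (show ((i : ℝ) + 1) * π ∈ Ioo (Θ 0) (Θ τ₁) from ⟨by linarith, by linarith⟩)
    exact ⟨τ, hτ.1, h⟩
  choose! g hg0 hg using hex
  have himage : {τ | 0 < τ ∧ ∃ i : ℕ, Θ τ = (i + 1) * π} = g '' (Finset.Ico j k : Set ℕ) := by
    ext τ
    constructor
    · rintro ⟨hτ, i, hi⟩
      have h1 := hlt τ hτ.le
      rw [hi] at h1
      have h2 : i + 1 < k + 1 := by exact_mod_cast lt_of_mul_lt_mul_right h1 pi_pos.le
      have h3 : j ≤ i := by
        by_contra hcon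
        have h4 : ((i : ℝ) + 1) * π ≤ j * π :=
          mul_le_mul_of_nonneg_right (by exact_mod_cast not_le.1 hcon) pi_pos.le
        exact absurd hi (hup i 0 τ le_rfl hτ (by linarith)).ne'
      have hmem : i ∈ Finset.Ico j k := Finset.mem_Ico.2 ⟨h3, by omega⟩
      refine ⟨i, hmem, ?_⟩
      rcases lt_trichotomy (g i) τ with h | h | h
      · exact absurd hi (hup i _ _ (hg0 i hmem).le h (hg i hmem).ge).ne'
      · exact h
      · exact absurd (hg i hmem) (hup i _ _ hτ.le h hi.ge).ne'
    · rintro ⟨i, hi, rfl⟩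
      exact ⟨hg0 i hi, i, hg i hi⟩
  rw [himage]
  refine ⟨(Finset.finite_toSet _).image g, ?_⟩
  rw [InjOn.ncard_image, ncard_coe_finset, Nat.card_Ico]
  intro a ha b hb hab
  have h1 := hg a ha
  rw [hab, hg b hb] at h1
  have h2 : (b : ℝ) + 1 = a + 1 := mul_right_cancel₀ pi_ne_zero h1
  have h3 : (b : ℝ) = a := by linarith
  exact_mod_cast h3.symm

/-- The parameters `τ > 0` for which the solution with initial slope `s` vanishes at `π`. -/
def endSet (ω κ s : ℝ) : Set ℝ := {τ | 0 < τ ∧ ∃ U, IsSol ω κ τ s U ∧ (U π).1 = 0}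

theorem ncard_endSet {ω κ s : ℝ} {j k : ℕ} (hκ : 0 < κ) (hk : 1 ≤ k) (hωk : (k : ℝ) < ω)
    (hωk' : ω < k + 1) (hs : s ≠ 0)
    (h₀ : ∀ U, IsSol ω κ 0 s U → j * π < angle ω κ 0 U π ∧ angle ω κ 0 U π < (j + 1) * π) :
    (endSet ω κ s).Finite ∧ (endSet ω κ s).ncard = k - j := by
  have hk' : (1 : ℝ) ≤ k := by exact_mod_cast hk
  have hω : 1 < ω := by linarith
  have hω0 : 0 < ω := by linarith
  have hπ : π ∈ Icc 0 π := ⟨pi_pos.le, le_rfl⟩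
  choose U hU using fun τ => exists_isSol (ω := ω) hκ.le τ s
  have hset : endSet ω κ s = {τ | 0 < τ ∧ ∃ i : ℕ, angle ω κ τ (U τ) π = (i + 1) * π} := by
    ext τ
    refine and_congr_right fun hτ => ?_
    have hT := (hU τ).traj hκ.le hτ.le hs
    have hz := hT.eq_zero_iff_sin_prufer hω0 hπ
    have hpos := hT.prufer_pos hω0 (x := π) ⟨pi_pos, le_rfl⟩
    constructor
    · rintro ⟨V, hV, hVπ⟩
      rw [hV.eqOn hκ.le (hU τ) hπ, hz, sin_eq_zero_iff] at hVπ
      obtain ⟨n, hn⟩ := hVπ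
      rw [← hn] at hpos
      have hn0 : 0 < n := by exact_mod_cast (mul_pos_iff_of_pos_right pi_pos).1 hpos
      obtain ⟨i, rfl⟩ : ∃ i : ℕ, n = i + 1 := ⟨(n - 1).toNat, by omega⟩
      refine ⟨i, hn.symm.trans ?_⟩
      push_cast
      ring
    · rintro ⟨i, hi⟩
      refine ⟨U τ, hU τ, hz.2 ?_⟩
      change sin (angle ω κ τ (U τ) π) = 0
      rw [hi]
      exact_mod_cast sin_int_mul_pi (i + 1)
  obtain ⟨x₀, hx₀, hx₀π⟩ : ∃ x₀, k * π / ω < x₀ ∧ x₀ < π :=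
    exists_between (by rw [div_lt_iff₀ hω0]; nlinarith [pi_pos])
  have hx₀0 : 0 < x₀ := lt_trans (by positivity) hx₀
  obtain ⟨τ₁, hτ₁, h1⟩ := IsSol.eventually_angle_eq hκ.le hω0 hs ⟨hx₀0, hx₀π⟩
  have h2 := h1 τ₁ le_rfl _ (hU τ₁)
  have h3 : k * π < angle ω κ τ₁ (U τ₁) x₀ := by
    rw [h2]
    rw [div_lt_iff₀ hω0] at hx₀
    linarith
  have h4 := ((hU τ₁).traj hκ.le hτ₁.le hs).lt_prufer hω0 hx₀0.le hx₀π le_rfl (i := k)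
    (by exact_mod_cast h3.le)
  rw [hset]
  refine ncard_crossings (continuousOn_angle hκ.le hω0 hs hU) (h₀ _ (hU 0)).1 (h₀ _ (hU 0)).2
    (fun τ hτ => ?_) hτ₁ (by exact_mod_cast h4)
    (fun τ₀ hτ₀ i hi => eventually_angle_crossing hκ hω hs hU hτ₀ (fun hh => ?_) hi)
  · have := (hU τ).angle_le hκ.le hω0 hτ hs
    nlinarith [pi_pos]
  · rw [← hh] at hωk hωk'
    have h5 : k < i + 1 := by exact_mod_cast hωk
    have h6 : i + 1 < k + 1 := by exact_mod_cast hωk'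
    omega

theorem ncard_endSet_one {ω κ : ℝ} {k : ℕ} (hκ : 0 < κ) (hk : 1 ≤ k) (hωk : (k : ℝ) < ω)
    (hωk' : ω < k + 1) (hκω : ω ^ 2 - κ < 1) :
    (endSet ω κ 1).Finite ∧ (endSet ω κ 1).ncard = k - 1 := by
  have hk' : (1 : ℝ) ≤ k := by exact_mod_cast hk
  refine ncard_endSet hκ hk hωk hωk' one_ne_zero fun U hU => ⟨?_, ?_⟩
  · simpa using hU.pi_lt_angle_zero hκ.le (by linarith) one_pos
  · have := hU.angle_zero_lt hκ.le (by linarith) hκω one_ne_zero (i := 1) (by norm_num)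
      (by norm_num)
    exact_mod_cast this

theorem ncard_endSet_neg_one {ω κ : ℝ} {k : ℕ} (hκ : 0 < κ) (hk : 1 ≤ k) (hωk : (k : ℝ) < ω)
    (hωk' : ω < k + 1) (hκω : ω ^ 2 - κ < 1) :
    (endSet ω κ (-1)).Finite ∧ (endSet ω κ (-1)).ncard = k := by
  have hk' : (1 : ℝ) ≤ k := by exact_mod_cast hk
  refine ncard_endSet (j := 0) hκ hk hωk hωk' (by norm_num) fun U hU => ⟨?_, ?_⟩
  · have := (hU.traj hκ.le le_rfl (by norm_num)).prufer_pos (ω := ω) (by linarith) (x := π)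
      ⟨pi_pos, le_rfl⟩
    simpa [angle] using this
  · have := hU.angle_zero_lt hκ.le (by linarith) hκω (by norm_num) (i := 0) le_rfl
      (by norm_num)
    exact_mod_cast this

theorem contDiffOn_two_iff {u : ℝ → ℝ} {s : Set ℝ} (hs : UniqueDiffOn ℝ s) {u₂ : ℝ → ℝ} :
    (ContDiffOn ℝ 2 u s ∧ ∀ x ∈ s, iteratedDerivWithin 2 u s x = u₂ x) ↔
      ContinuousOn u₂ s ∧ ∃ u₁ : ℝ → ℝ, (∀ x ∈ s, HasDerivWithinAt u (u₁ x) s x) ∧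
        ∀ x ∈ s, HasDerivWithinAt u₁ (u₂ x) s x := by
  have hit : iteratedDerivWithin 2 u s = derivWithin (derivWithin u s) s := by
    rw [iteratedDerivWithin_succ, iteratedDerivWithin_one]
  have hcd : ContDiffOn ℝ 2 u s ↔ DifferentiableOn ℝ u s ∧
      DifferentiableOn ℝ (derivWithin u s) s ∧ ContinuousOn (derivWithin (derivWithin u s) s) s := by
    rw [show (2 : WithTop ℕ∞) = 1 + 1 from one_add_one_eq_two.symm,
      contDiffOn_succ_iff_derivWithin hs, contDiffOn_one_iff_derivWithin hs]
    simp
  rw [hit, hcd]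
  constructor
  · rintro ⟨⟨h1, h2, h3⟩, h4⟩
    refine ⟨h3.congr fun x hx => (h4 x hx).symm, derivWithin u s,
      fun x hx => (h1 x hx).hasDerivWithinAt, fun x hx => ?_⟩
    rw [← h4 x hx]
    exact (h2 x hx).hasDerivWithinAt
  · rintro ⟨hc, u₁, h1, h2⟩
    have e1 : ∀ x ∈ s, derivWithin u s x = u₁ x := fun x hx => (h1 x hx).derivWithin (hs x hx)
    have h2' : ∀ x ∈ s, HasDerivWithinAt (derivWithin u s) (u₂ x) s x := fun x hx =>
      (h2 x hx).congr e1 (e1 x hx)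
    have e2 : ∀ x ∈ s, derivWithin (derivWithin u s) s x = u₂ x := fun x hx =>
      (h2' x hx).derivWithin (hs x hx)
    exact ⟨⟨fun x hx => (h1 x hx).differentiableWithinAt,
      fun x hx => (h2' x hx).differentiableWithinAt, hc.congr e2⟩, e2⟩

theorem hasDerivWithinAt_of_eq_integral {y a : ℝ → ℝ} {s x : ℝ} (hx : x ∈ Icc 0 π)
    (ha : Continuous a) (hy : ∀ x ∈ Icc 0 π, y x = s + ∫ t in (0 : ℝ)..x, a t) :
    HasDerivWithinAt y (a x) (Icc 0 π) x :=
  ((ha.integral_hasStrictDerivAt 0 x).hasDerivAt.const_add s).hasDerivWithinAt.congr hy (hy x hx)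

theorem eq_integral_of_hasDerivWithinAt {y a : ℝ → ℝ} (ha : Continuous a)
    (h : ∀ x ∈ Icc 0 π, HasDerivWithinAt y (a x) (Icc 0 π) x) {x : ℝ} (hx : x ∈ Icc 0 π) :
    y x = y 0 + ∫ t in (0 : ℝ)..x, a t := by
  rw [intervalIntegral.integral_eq_sub_of_hasDerivAt_of_le hx.1
    (fun t ht => ((h t ⟨ht.1, ht.2.trans hx.2⟩).continuousWithinAt.mono
      (Icc_subset_Icc_right hx.2)))
    (fun t ht => (h t ⟨ht.1.le, ht.2.le.trans hx.2⟩).hasDerivAt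
      (Icc_mem_nhds ht.1 (ht.2.trans_le hx.2))) (ha.intervalIntegrable _ _)]
  ring

namespace IsSol

variable {ω κ τ s : ℝ} {U : ℝ → ℝ × ℝ}

theorem hasDerivWithinAt_fst (h : IsSol ω κ τ s U) {x : ℝ} (hx : x ∈ Icc 0 π) :
    HasDerivWithinAt (fun t => (U t).1) (U x).2 (Icc 0 π) x :=
  hasDerivWithinAt_of_eq_integral (a := fun t => (U t).2) hx h.cont.snd fun _ => h.fst_eq

theorem hasDerivWithinAt_snd (h : IsSol ω κ τ s U) {x : ℝ} (hx : x ∈ Icc 0 π) :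
    HasDerivWithinAt (fun t => (U t).2) (-reaction ω κ τ x (U x).1) (Icc 0 π) x :=
  hasDerivWithinAt_of_eq_integral (a := fun t => -reaction ω κ τ t (U t).1) hx
    (continuous_reaction h.cont.fst).neg fun _ => h.snd_eq

theorem of_hasDerivWithinAt {v v₁ : ℝ → ℝ} (hv : ContinuousOn v (Icc 0 π))
    (hv₁ : ContinuousOn v₁ (Icc 0 π)) (h₀ : v 0 = 0)
    (h : ∀ x ∈ Icc 0 π, HasDerivWithinAt v (v₁ x) (Icc 0 π) x)
    (h₁ : ∀ x ∈ Icc 0 π, HasDerivWithinAt v₁ (-reaction ω κ τ x (v x)) (Icc 0 π) x) :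
    ∃ V, IsSol ω κ τ (v₁ 0) V ∧ ∀ x ∈ Icc 0 π, (V x).1 = v x := by
  have hc : Continuous fun x => v (projIcc 0 π pi_pos.le x) :=
    hv.domRestrict.comp continuous_projIcc
  have hc₁ : Continuous fun x => v₁ (projIcc 0 π pi_pos.le x) :=
    hv₁.domRestrict.comp continuous_projIcc
  have e : ∀ x ∈ Icc 0 π, (projIcc 0 π pi_pos.le x : ℝ) = x := fun x hx => by
    rw [projIcc_of_mem _ hx]
  have h0 : (0 : ℝ) ∈ Icc 0 π := ⟨le_rfl, pi_pos.le⟩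
  refine ⟨fun x => (v (projIcc 0 π pi_pos.le x), v₁ (projIcc 0 π pi_pos.le x)),
    ⟨hc.prodMk hc₁, fun x hx => ?_⟩, fun x hx => by simp only [e x hx]⟩
  have hn : Continuous fun x => -reaction ω κ τ x (v (projIcc 0 π pi_pos.le x)) :=
    (continuous_reaction hc).neg
  refine volterra_of_fst_snd (u₀ := (0, v₁ 0)) (y := fun x => v (projIcc 0 π pi_pos.le x))
    (y₁ := fun x => v₁ (projIcc 0 π pi_pos.le x)) (hc₁.intervalIntegrable _ _) (hn.intervalIntegrable _ _) ?_ ?_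
  · have := eq_integral_of_hasDerivWithinAt (y := v) hc₁
      (fun t ht => by simpa only [e t ht] using h t ht) hx
    rw [h₀] at this
    simpa only [e x hx] using this
  · have := eq_integral_of_hasDerivWithinAt (y := v₁) hn
      (fun t ht => by simpa only [e t ht] using h₁ t ht) hx
    simpa only [e x hx] using this

end IsSol

/-- The initial slopes for which the solution with shift `τ` vanishes at `π`. -/
def slopeSet (ω κ τ : ℝ) : Set ℝ := {c | ∃ V, IsSol ω κ τ c V ∧ (V π).1 = 0}

theorem mul_mem_slopeSet_iff {ω κ τ c r : ℝ} (hr : 0 < r) :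
    r * c ∈ slopeSet ω κ (r * τ) ↔ c ∈ slopeSet ω κ τ := by
  constructor
  · rintro ⟨V, hV, h⟩
    refine ⟨fun x => r⁻¹ • V x, ?_, by simp [h]⟩
    simpa [hr.ne'] using hV.smul (inv_nonneg.2 hr.le)
  · rintro ⟨V, hV, h⟩
    exact ⟨fun x => r • V x, hV.smul hr.le, by simp [h]⟩

theorem slopeSet_eq {ω κ a : ℝ} (ha : 0 < a) :
    slopeSet ω κ a = {0} ∪ (fun τ => a / τ) '' endSet ω κ 1 ∪
      (fun τ => -(a / τ)) '' endSet ω κ (-1) := by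
  have hend : ∀ s, endSet ω κ s = {τ | 0 < τ ∧ s ∈ slopeSet ω κ τ} := fun s => rfl
  have key : ∀ s τ, 0 < τ → (a / τ * s ∈ slopeSet ω κ a ↔ s ∈ slopeSet ω κ τ) := by
    intro s τ hτ
    have := mul_mem_slopeSet_iff (ω := ω) (κ := κ) (τ := τ) (c := s) (div_pos ha hτ)
    rwa [div_mul_cancel₀ _ hτ.ne'] at this
  ext c
  rcases lt_trichotomy c 0 with hc | rfl | hc
  · have h1 := key (-1) (a / -c) (div_pos ha (by linarith))
    rw [div_div_cancel₀ ha.ne', neg_mul_neg, mul_one] at h1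
    rw [h1]
    constructor
    · intro h
      refine Or.inr ⟨a / -c, ⟨div_pos ha (by linarith), h⟩, ?_⟩
      dsimp only
      rw [div_div_cancel₀ ha.ne', neg_neg]
    · rintro ((h | ⟨τ, hτ, rfl⟩) | ⟨τ, hτ, rfl⟩)
      · exact absurd h hc.ne
      · exact absurd hc (not_lt.2 (div_pos ha hτ.1).le)
      · rw [neg_neg, div_div_cancel₀ ha.ne']
        exact hτ.2
  · refine ⟨fun _ => Or.inl (Or.inl rfl), fun _ => ?_⟩
    refine ⟨fun _ => 0, ⟨continuous_const, fun x _ => ?_⟩, rfl⟩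
    have : ∀ t, 0 ≤ a * |sin t| := fun t => by positivity
    simp [reaction, this, Prod.mk_zero_zero]
  · have h1 := key 1 (a / c) (div_pos ha hc)
    rw [div_div_cancel₀ ha.ne', mul_one] at h1
    rw [h1]
    constructor
    · intro h
      refine Or.inl (Or.inr ⟨a / c, ⟨div_pos ha hc, h⟩, ?_⟩)
      dsimp only
      rw [div_div_cancel₀ ha.ne']
    · rintro ((h | ⟨τ, hτ, rfl⟩) | ⟨τ, hτ, rfl⟩)
      · exact absurd h hc.ne'
      · rw [div_div_cancel₀ ha.ne']
        exact hτ.2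
      · exact absurd hc (not_lt.2 (neg_nonpos.2 (div_pos ha hτ.1).le))

theorem ncard_slopeSet {ω κ a : ℝ} {k : ℕ} (hκ : 0 < κ) (hk : 1 ≤ k) (hωk : (k : ℝ) < ω)
    (hωk' : ω < k + 1) (hκω : ω ^ 2 - κ < 1) (ha : 0 < a) :
    (slopeSet ω κ a).Finite ∧ (slopeSet ω κ a).ncard = 2 * k := by
  obtain ⟨hf₁, hn₁⟩ := ncard_endSet_one hκ hk hωk hωk' hκω
  obtain ⟨hf₂, hn₂⟩ := ncard_endSet_neg_one hκ hk hωk hωk' hκω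
  rw [slopeSet_eq ha]
  have hinj : Function.Injective fun τ : ℝ => a / τ := fun x y h => by
    have h' : a / (a / x) = a / (a / y) := congrArg (a / ·) h
    rwa [div_div_cancel₀ ha.ne', div_div_cancel₀ ha.ne'] at h'
  have hinj' : Function.Injective fun τ : ℝ => -(a / τ) := neg_injective.comp hinj
  have hd₁ : Disjoint {(0 : ℝ)} ((fun τ => a / τ) '' endSet ω κ 1) := by
    rw [disjoint_singleton_left]
    rintro ⟨τ, hτ, h⟩
    exact (div_pos ha hτ.1).ne' h
  have hd₂ : Disjoint ({(0 : ℝ)} ∪ (fun τ => a / τ) '' endSet ω κ 1)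
      ((fun τ => -(a / τ)) '' endSet ω κ (-1)) := by
    rw [disjoint_right]
    rintro _ ⟨τ, hτ, rfl⟩ (h | ⟨τ', hτ', h⟩)
    · exact (neg_lt_zero.2 (div_pos ha hτ.1)).ne h
    · have h1 := div_pos ha hτ.1
      have h2 := div_pos ha hτ'.1
      dsimp only at h
      linarith
  refine ⟨((finite_singleton 0).union (hf₁.image _)).union (hf₂.image _), ?_⟩
  rw [ncard_union_eq hd₂ ((finite_singleton 0).union (hf₁.image _)) (hf₂.image _),
    ncard_union_eq hd₁ (finite_singleton 0) (hf₁.image _), ncard_singleton,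
    ncard_image_of_injective _ hinj, ncard_image_of_injective _ hinj', hn₁, hn₂]
  omega

/-- Functions of class `C²` on `[0, π]` solving the boundary value problem correspond to solutions
of the shifted problem. -/
theorem solution_iff {ω κ : ℝ} (hω : 1 < ω) (u : ℝ → ℝ) :
    (ContDiffOn ℝ 2 u (Icc 0 π) ∧ u 0 = 0 ∧ u π = 0 ∧ ∀ x ∈ Icc (0 : ℝ) π,
      -(iteratedDerivWithin 2 u (Icc 0 π) x) - (ω ^ 2 * u x + κ * max (-u x) 0) = -sin x) ↔
    ∃ (c : ℝ) (V : ℝ → ℝ × ℝ), IsSol ω κ (1 / (ω ^ 2 - 1)) c V ∧ (V π).1 = 0 ∧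
      ∀ x ∈ Icc 0 π, u x = (V x).1 + 1 / (ω ^ 2 - 1) * sin x := by
  have h0 : (0 : ℝ) ∈ Icc 0 π := ⟨le_rfl, pi_pos.le⟩
  have hπ : π ∈ Icc 0 π := ⟨pi_pos.le, le_rfl⟩
  have ha : ω ^ 2 - 1 ≠ 0 := by nlinarith
  set r := 1 / (ω ^ 2 - 1) with hr
  have hra : r * ω ^ 2 = 1 + r := by
    rw [hr]
    field_simp
    ring
  have habs : ∀ x ∈ Icc 0 π, |sin x| = sin x := fun x hx => abs_of_nonneg (sin_nonneg_of_mem_Icc hx)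
  have halg : ∀ x ∈ Icc 0 π, ∀ y, -reaction ω κ r x y =
      sin x - (ω ^ 2 * (y + r * sin x) + κ * max (-(y + r * sin x)) 0) + r * sin x := by
    intro x hx y
    rw [reaction, habs x hx]
    linear_combination sin x * hra
  have huniq : UniqueDiffOn ℝ (Icc 0 π) := uniqueDiffOn_Icc pi_pos
  constructor
  · rintro ⟨hC, hu0, huπ, hode⟩
    have h2 : ∀ x ∈ Icc 0 π, iteratedDerivWithin 2 u (Icc 0 π) x =
        sin x - (ω ^ 2 * u x + κ * max (-u x) 0) := fun x hx => by linarith [hode x hx]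
    obtain ⟨-, u₁, hu₁, hu₂⟩ := (contDiffOn_two_iff huniq).1 ⟨hC, h2⟩
    have hd : ∀ x ∈ Icc 0 π, HasDerivWithinAt (fun x => u x - r * sin x) (u₁ x - r * cos x)
        (Icc 0 π) x := fun x hx =>
      (hu₁ x hx).sub ((hasDerivAt_sin x).const_mul r).hasDerivWithinAt
    have hd₁ : ∀ x ∈ Icc 0 π, HasDerivWithinAt (fun x => u₁ x - r * cos x)
        (-reaction ω κ r x (u x - r * sin x)) (Icc 0 π) x := fun x hx => by
      refine ((hu₂ x hx).sub ((hasDerivAt_cos x).const_mul r).hasDerivWithinAt).congr_deriv ?_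
      rw [halg x hx, sub_add_cancel]
      ring
    obtain ⟨V, hV, hVu⟩ := IsSol.of_hasDerivWithinAt (fun x hx => (hd x hx).continuousWithinAt)
      (fun x hx => (hd₁ x hx).continuousWithinAt) (by simp [hu0]) hd hd₁
    exact ⟨_, V, hV, by simp [hVu π hπ, huπ], fun x hx => by rw [hVu x hx, sub_add_cancel]⟩
  · rintro ⟨c, V, hV, hVπ, hu⟩
    have hV0 : (V 0).1 = 0 := by simpa using hV.fst_eq h0
    have key := (contDiffOn_two_iff (u := u) huniq
      (u₂ := fun x => sin x - (ω ^ 2 * u x + κ * max (-u x) 0))).2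
    have hd : ∀ x ∈ Icc 0 π, HasDerivWithinAt u ((V x).2 + r * cos x) (Icc 0 π) x := fun x hx =>
      ((hV.hasDerivWithinAt_fst hx).add
        ((hasDerivAt_sin x).const_mul r).hasDerivWithinAt).congr hu (hu x hx)
    have huc : ContinuousOn u (Icc 0 π) := fun x hx => (hd x hx).continuousWithinAt
    obtain ⟨hC, h2⟩ := key ⟨by fun_prop, fun x => (V x).2 + r * cos x, hd, fun x hx => by
      refine ((hV.hasDerivWithinAt_snd hx).add
        ((hasDerivAt_cos x).const_mul r).hasDerivWithinAt).congr_deriv ?_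
      rw [halg x hx, hu x hx]
      ring⟩
    refine ⟨hC, ?_, ?_, fun x hx => ?_⟩
    · rw [hu 0 h0, hV0, sin_zero, mul_zero, add_zero]
    · rw [hu π hπ, hVπ, sin_pi, mul_zero, add_zero]
    · rw [h2 x hx]
      ring

theorem IsSol.slope_unique {ω κ τ s s' : ℝ} {U V : ℝ → ℝ × ℝ} (hU : IsSol ω κ τ s U)
    (hV : IsSol ω κ τ s' V) (h : ∀ x ∈ Icc 0 π, (U x).1 = (V x).1) : s = s' := by
  have h0 : (0 : ℝ) ∈ Icc 0 π := ⟨le_rfl, pi_pos.le⟩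
  have h1 := (hV.hasDerivWithinAt_fst h0).congr (f₁ := fun t => (U t).1) h (h 0 h0)
  have h2 := (uniqueDiffOn_Icc pi_pos 0 h0).eq_deriv _ (hU.hasDerivWithinAt_fst h0) h1
  rwa [hU.init₁, hV.init₁] at h2

theorem statement9 (k : ℕ) (hk : 1 ≤ k) (ℓm ℓp : ℝ)
    (hℓm : ℓm < 1) (hℓp₁ : (k : ℝ) ^ 2 < ℓp) (hℓp₂ : ℓp < ((k : ℝ) + 1) ^ 2)
    (f : ℝ → ℝ) (hf : ∀ x : ℝ, f x = if x ≤ 0 then ℓm * x else ℓp * x)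
    (S : Set (↥(Set.Icc (0 : ℝ) Real.pi) → ℝ))
    (hS : S = {g : ↥(Set.Icc (0 : ℝ) Real.pi) → ℝ | ∃ u : ℝ → ℝ,
      ContDiffOn ℝ 2 u (Set.Icc 0 Real.pi) ∧
      u 0 = 0 ∧ u Real.pi = 0 ∧
      (∀ x ∈ Set.Icc (0 : ℝ) Real.pi,
        -(iteratedDerivWithin 2 u (Set.Icc 0 Real.pi) x) - f (u x) = -Real.sin x) ∧
      g = fun (y : ↥(Set.Icc (0 : ℝ) Real.pi)) => u ↑y}) :
    S.Finite ∧ S.ncard = 2 * k := by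
  have hk1 : (1 : ℝ) ≤ k := by exact_mod_cast hk
  have hp : 1 < ℓp := by nlinarith
  set ω := √ℓp with hω
  set κ := ℓp - ℓm with hκ
  have hω2 : ω ^ 2 = ℓp := sq_sqrt (by linarith)
  have hkω : (k : ℝ) < ω := lt_sqrt_of_sq_lt hℓp₁
  have hωk : ω < k + 1 := (sqrt_lt' (by linarith)).2 hℓp₂
  have hω1 : 1 < ω := by linarith
  have hκ0 : 0 < κ := by linarith
  have ha : 0 < 1 / (ω ^ 2 - 1) := one_div_pos.2 (by linarith)
  have hfeq : ∀ x, f x = ω ^ 2 * x + κ * max (-x) 0 := by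
    intro x
    rw [hf, hω2]
    split_ifs with hx
    · rw [max_eq_left (by linarith)]
      ring
    · rw [max_eq_right (by linarith)]
      ring
  obtain ⟨hfin, hcard⟩ := ncard_slopeSet (a := 1 / (ω ^ 2 - 1)) hκ0 hk hkω hωk
    (by linarith) ha
  choose V hV using fun c => exists_isSol (ω := ω) hκ0.le (1 / (ω ^ 2 - 1)) c
  set F : ℝ → ↥(Icc 0 π) → ℝ := fun c y => (V c y).1 + 1 / (ω ^ 2 - 1) * sin y with hF
  have hSF : S = F '' slopeSet ω κ (1 / (ω ^ 2 - 1)) := by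
    rw [hS]
    simp only [hfeq]
    ext g
    constructor
    · rintro ⟨u, h1, h2, h3, h4, rfl⟩
      obtain ⟨c, U, hU, hUπ, hu⟩ := (solution_iff hω1 u).1 ⟨h1, h2, h3, h4⟩
      refine ⟨c, ⟨U, hU, hUπ⟩, funext fun y => ?_⟩
      simp only [hF]
      rw [hu y y.2, (hV c).eqOn hκ0.le hU y.2]
    · rintro ⟨c, ⟨U, hU, hUπ⟩, rfl⟩
      rw [hU.eqOn hκ0.le (hV c) ⟨pi_pos.le, le_rfl⟩] at hUπ
      obtain ⟨h1, h2, h3, h4⟩ := (solution_iff (κ := κ) hω1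
        fun x => (V c x).1 + 1 / (ω ^ 2 - 1) * sin x).2 ⟨c, V c, hV c, hUπ, fun x _ => rfl⟩
      exact ⟨_, h1, h2, h3, h4, rfl⟩
  have hinj : Function.Injective F := fun c d h => by
    refine (hV c).slope_unique (hV d) fun x hx => ?_
    have h1 := congrFun h ⟨x, hx⟩
    simp only [hF] at h1
    linarith
  rw [hSF, ncard_image_of_injective _ hinj]
  exact ⟨hfin.image F, hcard⟩
end

section
/- Fix n ≥ 1, set h = π/(n+1) and A^h = (1/h²)·A(n), and let λ₁ = (2/h²)(1 − cos h) be the smallest eigenvalue of A^h. Fix ℓ₋ < λ₁ and vectors y, p ∈ ℝⁿ with every entry of p strictly positive. Then there exists L₀ > 0 such that for every ℓ₊ > L₀ there exists t₀ > 0 such that for every t > t₀ the equation A^h·u − f_{ℓ₋,ℓ₊}(u) = y − t·p has exactly 2ⁿ solutions u ∈ ℝⁿ. (Teles–Tomei) -/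
open Real Set

section PiecewiseLinear

open Matrix Filter Topology

variable {ι : Type*} [Fintype ι] {A : Matrix ι ι ℝ} {φ : ι → ℝ} {ℓm : ℝ}

lemma exists_le_mulVec_sub (hA : ∀ i j, i ≠ j → A i j ≤ 0) (hφ : ∀ i, 0 < φ i)
    (S : Finset ι) {w : ι → ℝ} (hw : ∀ j ∈ S, w j = 0) {j : ι} (hjS : j ∉ S) (hj : 0 ≤ w j) :
    ∃ i ∉ S, ∃ m, w j ≤ m * φ j ∧
      m * ((A *ᵥ φ) i - ℓm * φ i) ≤ (A *ᵥ w) i - ℓm * w i := by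
  classical
  obtain ⟨i, hi, hmax⟩ := Finset.exists_max_image Sᶜ (fun k => w k / φ k)
    ⟨j, Finset.mem_compl.2 hjS⟩
  have hle : ∀ k ∉ S, w k ≤ w i / φ i * φ k := fun k hk =>
    (div_le_iff₀ (hφ k)).1 (hmax k (Finset.mem_compl.2 hk))
  have hm : 0 ≤ w i / φ i :=
    (div_nonneg hj (hφ j).le).trans (hmax j (Finset.mem_compl.2 hjS))
  have hi' : w i / φ i * φ i = w i := div_mul_cancel₀ _ (hφ i).ne'
  refine ⟨i, Finset.mem_compl.1 hi, w i / φ i, hle j hjS, ?_⟩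
  have key : w i / φ i * (A *ᵥ φ) i ≤ (A *ᵥ w) i := by
    simp only [mulVec, dotProduct, Finset.mul_sum]
    refine Finset.sum_le_sum fun k _ => ?_
    rcases eq_or_ne i k with rfl | hik
    · rw [mul_left_comm, hi']
    · rw [mul_left_comm]
      refine mul_le_mul_of_nonpos_left ?_ (hA i k hik)
      by_cases hk : k ∈ S
      · rw [hw k hk]
        exact mul_nonneg hm (hφ k).le
      · exact hle k hk
  linear_combination key - ℓm * hi'

lemma neg_of_mulVec_sub_neg (hA : ∀ i j, i ≠ j → A i j ≤ 0) (hφ : ∀ i, 0 < φ i)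
    (hAφ : ∀ i, ℓm * φ i < (A *ᵥ φ) i) (S : Finset ι) {w : ι → ℝ} (hw : ∀ j ∈ S, w j = 0)
    (h : ∀ i ∉ S, (A *ᵥ w) i - ℓm * w i < 0) {j : ι} (hjS : j ∉ S) : w j < 0 := by
  by_contra! hj
  obtain ⟨i, hi, m, hm, hle⟩ := exists_le_mulVec_sub (ℓm := ℓm) hA hφ S hw hjS hj
  have hm0 : 0 ≤ m := nonneg_of_mul_nonneg_left (hj.trans hm) (hφ j)
  exact absurd (mul_nonneg hm0 (sub_pos.2 (hAφ i)).le) (not_le.2 (hle.trans_lt (h i hi)))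

lemma nonpos_of_mulVec_sub_nonpos (hA : ∀ i j, i ≠ j → A i j ≤ 0) (hφ : ∀ i, 0 < φ i)
    (hAφ : ∀ i, ℓm * φ i < (A *ᵥ φ) i) (S : Finset ι) {w : ι → ℝ} (hw : ∀ j ∈ S, w j = 0)
    (h : ∀ i ∉ S, (A *ᵥ w) i - ℓm * w i ≤ 0) {j : ι} (hjS : j ∉ S) : w j ≤ 0 := by
  by_contra! hj
  obtain ⟨i, hi, m, hm, hle⟩ := exists_le_mulVec_sub (ℓm := ℓm) hA hφ S hw hjS hj.le
  have hm0 : 0 < m := pos_of_mul_pos_left (hj.trans_le hm) (hφ j).le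
  exact absurd (mul_pos hm0 (sub_pos.2 (hAφ i))) (not_lt.2 (hle.trans (h i hi)))

variable [DecidableEq ι]

/-- The linear map `A - f` restricted to the orthant of vectors that are positive exactly on `S`. -/
def orthantMatrix (A : Matrix ι ι ℝ) (ℓm ℓp : ℝ) (S : Finset ι) : Matrix ι ι ℝ :=
  A - diagonal fun i => if i ∈ S then ℓp else ℓm

/-- `orthantMatrix A ℓm ε⁻¹ S` with the columns in `S` multiplied by `ε`; it extends continuously
to `ε = 0`. -/
def rescaledOrthantMatrix (A : Matrix ι ι ℝ) (ℓm : ℝ) (S : Finset ι) (ε : ℝ) : Matrix ι ι ℝ :=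
  A * diagonal (fun i => if i ∈ S then ε else 1) - diagonal fun i => if i ∈ S then 1 else ℓm

lemma orthantMatrix_mul_diagonal (A : Matrix ι ι ℝ) (ℓm : ℝ) {ℓp ε : ℝ} (h : ℓp * ε = 1)
    (S : Finset ι) :
    orthantMatrix A ℓm ℓp S * diagonal (fun i => if i ∈ S then ε else 1) =
      rescaledOrthantMatrix A ℓm S ε := by
  rw [orthantMatrix, rescaledOrthantMatrix, sub_mul, diagonal_mul_diagonal]
  congr 2
  ext i
  split_ifs <;> simp [h]

lemma orthantMatrix_mulVec_apply (A : Matrix ι ι ℝ) (ℓm ℓp : ℝ) (S : Finset ι) (u : ι → ℝ)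
    (i : ι) :
    (orthantMatrix A ℓm ℓp S *ᵥ u) i = (A *ᵥ u) i - (if i ∈ S then ℓp else ℓm) * u i := by
  rw [orthantMatrix, sub_mulVec, Pi.sub_apply, mulVec_diagonal]

lemma rescaledOrthantMatrix_zero_mulVec_apply (A : Matrix ι ι ℝ) (ℓm : ℝ) (S : Finset ι)
    (z : ι → ℝ) (i : ι) :
    (rescaledOrthantMatrix A ℓm S 0 *ᵥ z) i =
      (A *ᵥ fun j => if j ∈ S then 0 else z j) i - (if i ∈ S then 1 else ℓm) * z i := by
  rw [rescaledOrthantMatrix, sub_mulVec, Pi.sub_apply, mulVec_diagonal, ← mulVec_mulVec]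
  congr 3
  ext j
  rw [mulVec_diagonal]
  split_ifs <;> simp

lemma continuous_rescaledOrthantMatrix (A : Matrix ι ι ℝ) (ℓm : ℝ) (S : Finset ι) :
    Continuous (rescaledOrthantMatrix A ℓm S) := by
  unfold rescaledOrthantMatrix
  refine Continuous.sub (Continuous.matrix_mul continuous_const (Continuous.matrix_diagonal ?_))
    continuous_const
  refine continuous_pi fun i => ?_
  split_ifs <;> fun_prop

lemma det_rescaledOrthantMatrix_zero_ne_zero (hA : ∀ i j, i ≠ j → A i j ≤ 0)
    (hφ : ∀ i, 0 < φ i) (hAφ : ∀ i, ℓm * φ i < (A *ᵥ φ) i) (S : Finset ι) :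
    (rescaledOrthantMatrix A ℓm S 0).det ≠ 0 := by
  intro hdet
  obtain ⟨z, hz, hNz⟩ := exists_mulVec_eq_zero_iff.2 hdet
  set w : ι → ℝ := fun j => if j ∈ S then 0 else z j with hwdef
  have hrow : ∀ i, (A *ᵥ w) i - (if i ∈ S then 1 else ℓm) * z i = 0 := fun i => by
    rw [hwdef, ← rescaledOrthantMatrix_zero_mulVec_apply, hNz, Pi.zero_apply]
  have hwS : ∀ j ∈ S, w j = 0 := fun j hj => if_pos hj
  have hoff : ∀ i ∉ S, (A *ᵥ w) i - ℓm * w i = 0 := fun i hi => by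
    simpa [hwdef, hi] using hrow i
  have hw : w = 0 := by
    ext j
    by_cases hj : j ∈ S
    · exact hwS j hj
    refine le_antisymm
      (nonpos_of_mulVec_sub_nonpos hA hφ hAφ S hwS (fun i hi => (hoff i hi).le) hj) ?_
    have := nonpos_of_mulVec_sub_nonpos (w := -w) hA hφ hAφ S (fun i hi => by simp [hwS i hi])
      (fun i hi => by
        rw [mulVec_neg, Pi.neg_apply, Pi.neg_apply]
        linarith [hoff i hi]) hj
    simpa using this
  refine hz (funext fun j => ?_)
  by_cases hj : j ∈ S
  · simpa [hw, hj] using hrow j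
  · simpa [hwdef, hj] using congrFun hw j

lemma sign_of_rescaledOrthantMatrix_zero_mulVec (hA : ∀ i j, i ≠ j → A i j ≤ 0)
    (hφ : ∀ i, 0 < φ i) (hAφ : ∀ i, ℓm * φ i < (A *ᵥ φ) i) {p : ι → ℝ} (hp : ∀ i, 0 < p i)
    (S : Finset ι) {z : ι → ℝ} (hz : rescaledOrthantMatrix A ℓm S 0 *ᵥ z = -p) (i : ι) :
    if i ∈ S then 0 < z i else z i < 0 := by
  set w : ι → ℝ := fun j => if j ∈ S then 0 else z j with hwdef
  have hrow : ∀ i, (A *ᵥ w) i - (if i ∈ S then 1 else ℓm) * z i = -p i := fun i => by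
    rw [hwdef, ← rescaledOrthantMatrix_zero_mulVec_apply, hz, Pi.neg_apply]
  have hwS : ∀ j ∈ S, w j = 0 := fun j hj => if_pos hj
  have hneg : ∀ j ∉ S, w j < 0 := fun j hj =>
    neg_of_mulVec_sub_neg hA hφ hAφ S hwS (fun i hi => by
      have := hrow i
      rw [if_neg hi] at this
      rw [show w i = z i from if_neg hi, this]
      exact neg_neg_of_pos (hp i)) hj
  split_ifs with hi
  · have hAw : 0 ≤ (A *ᵥ w) i := by
      refine Finset.sum_nonneg fun j _ => ?_
      by_cases hj : j ∈ S
      · simp [hwS j hj]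
      · exact mul_nonneg_of_nonpos_of_nonpos (hA i j fun h => hj (h ▸ hi)) (hneg j hj).le
    have := hrow i
    rw [if_pos hi] at this
    linarith [hp i]
  · simpa [hwdef, hi] using hneg i hi

lemma eventually_sign_rescaledOrthantMatrix (hA : ∀ i j, i ≠ j → A i j ≤ 0)
    (hφ : ∀ i, 0 < φ i) (hAφ : ∀ i, ℓm * φ i < (A *ᵥ φ) i) {p : ι → ℝ} (hp : ∀ i, 0 < p i)
    (S : Finset ι) :
    ∀ᶠ ε in 𝓝 (0 : ℝ), ∃ z : ι → ℝ, (rescaledOrthantMatrix A ℓm S ε).det ≠ 0 ∧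
      rescaledOrthantMatrix A ℓm S ε *ᵥ z = -p ∧
      ∀ i, if i ∈ S then 0 < z i else z i < 0 := by
  set N := rescaledOrthantMatrix A ℓm S
  have hN : Continuous N := continuous_rescaledOrthantMatrix A ℓm S
  have hdet0 : (N 0).det ≠ 0 := det_rescaledOrthantMatrix_zero_ne_zero hA hφ hAφ S
  set z : ℝ → ι → ℝ := fun ε => (N ε).det⁻¹ • ((N ε).adjugate *ᵥ (-p)) with hzdef
  have hz : ∀ ε, (N ε).det ≠ 0 → N ε *ᵥ z ε = -p := fun ε hε => by
    rw [hzdef]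
    simp only
    rw [mulVec_smul, mulVec_mulVec, mul_adjugate, smul_mulVec, one_mulVec, smul_smul,
      inv_mul_cancel₀ hε, one_smul]
  have hzcont : ContinuousAt z 0 :=
    (hN.matrix_det.continuousAt.inv₀ hdet0).smul
      (hN.matrix_adjugate.matrix_mulVec continuous_const).continuousAt
  have hsign : ∀ᶠ ε in 𝓝 (0 : ℝ), ∀ i, if i ∈ S then 0 < z ε i else z ε i < 0 := by
    refine eventually_all.2 fun i => ?_
    have h0 := sign_of_rescaledOrthantMatrix_zero_mulVec hA hφ hAφ hp S (hz 0 hdet0) i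
    have hi : Tendsto (fun ε => z ε i) (𝓝 0) (𝓝 (z 0 i)) := tendsto_pi_nhds.1 hzcont i
    split_ifs at h0 ⊢
    · exact hi.eventually_const_lt h0
    · exact hi.eventually_lt_const h0
  filter_upwards [hsign, hN.matrix_det.continuousAt.eventually_ne hdet0] with ε hs hd
  exact ⟨z ε, hd, hz ε hd, hs⟩

/-- If `A` has nonpositive off-diagonal entries and a positive vector `φ` with `ℓm • φ < A φ`, then
for all large slopes `ℓp` every orthant contains in its interior the solution of its linear system
with right-hand side `-p`. -/
lemma exists_forall_orthantMatrix_sign (hA : ∀ i j, i ≠ j → A i j ≤ 0)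
    (hφ : ∀ i, 0 < φ i) (hAφ : ∀ i, ℓm * φ i < (A *ᵥ φ) i) {p : ι → ℝ} (hp : ∀ i, 0 < p i) :
    ∃ L₀ > (0 : ℝ), ∀ ℓp > L₀, ∀ S : Finset ι, ∃ v : ι → ℝ, (orthantMatrix A ℓm ℓp S).det ≠ 0 ∧
      orthantMatrix A ℓm ℓp S *ᵥ v = -p ∧ ∀ i, if i ∈ S then 0 < v i else v i < 0 := by
  obtain ⟨δ, hδ, h⟩ := Metric.eventually_nhds_iff.1
    (eventually_all.2 (eventually_sign_rescaledOrthantMatrix hA hφ hAφ hp))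
  refine ⟨δ⁻¹, inv_pos.2 hδ, fun ℓp hℓp S => ?_⟩
  have hpos : 0 < ℓp := (inv_pos.2 hδ).trans hℓp
  have hlt : ℓp⁻¹ < δ := inv_lt_of_inv_lt₀ hδ hℓp
  obtain ⟨z, hdet, hz, hs⟩ := h (y := ℓp⁻¹)
    (by rwa [Real.dist_eq, sub_zero, abs_of_pos (inv_pos.2 hpos)]) S
  rw [← orthantMatrix_mul_diagonal A ℓm (mul_inv_cancel₀ hpos.ne') S] at hdet hz
  rw [det_mul] at hdet
  rw [← mulVec_mulVec] at hz
  refine ⟨_, left_ne_zero_of_mul hdet, hz, fun i => ?_⟩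
  have := hs i
  rw [mulVec_diagonal]
  split_ifs at this ⊢
  · exact mul_pos (inv_pos.2 hpos) this
  · rwa [one_mul]

/-- If the system with right-hand side `-p` of every orthant has its solution in the interior of
that orthant, then `A u - f u = y - t p` has exactly one solution in each orthant for large `t`. -/
lemma exists_forall_ncard_solutions {ℓp : ℝ} {p : ι → ℝ}
    (h : ∀ S : Finset ι, ∃ v : ι → ℝ, (orthantMatrix A ℓm ℓp S).det ≠ 0 ∧
      orthantMatrix A ℓm ℓp S *ᵥ v = -p ∧ ∀ i, if i ∈ S then 0 < v i else v i < 0)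
    (y : ι → ℝ) :
    ∃ t₀ > (0 : ℝ), ∀ t > t₀,
      {u : ι → ℝ | A *ᵥ u - (fun i => if u i ≤ 0 then ℓm * u i else ℓp * u i)
        = y - t • p}.Finite ∧
      {u : ι → ℝ | A *ᵥ u - (fun i => if u i ≤ 0 then ℓm * u i else ℓp * u i)
        = y - t • p}.ncard = 2 ^ Fintype.card ι := by
  choose v hdet hv hs using h
  set B := orthantMatrix A ℓm ℓp with hB
  set x : ℝ → Finset ι → ι → ℝ := fun t S => (B S)⁻¹ *ᵥ y + t • v S with hx
  have hBx : ∀ t S, B S *ᵥ x t S = y - t • p := fun t S => by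
    rw [hx]
    simp only
    rw [mulVec_add, mulVec_mulVec, mul_nonsing_inv _ (isUnit_iff_ne_zero.2 (hdet S)), one_mulVec,
      mulVec_smul, hv, smul_neg, sub_eq_add_neg]
  have hsign : ∀ᶠ t in atTop, ∀ S i, if i ∈ S then 0 < x t S i else x t S i < 0 := by
    refine eventually_all.2 fun S => eventually_all.2 fun i => ?_
    have hi := hs S i
    split_ifs at hi ⊢
    · exact (tendsto_atTop_add_const_left _ _
        (tendsto_id.atTop_mul_const hi)).eventually_gt_atTop 0
    · exact (tendsto_atBot_add_const_left _ _
        (tendsto_id.atTop_mul_const_of_neg hi)).eventually_lt_atBot 0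
  obtain ⟨t₁, ht₁⟩ := eventually_atTop.1 hsign
  refine ⟨max t₁ 1, lt_max_of_lt_right one_pos, fun t ht => ?_⟩
  have hxs := ht₁ t ((le_max_left _ _).trans ht.le)
  have hmem : ∀ S i, i ∈ S ↔ 0 < x t S i := fun S i => by
    have := hxs S i
    split_ifs at this with hi
    · simp [hi, this]
    · simp [hi, this.le]
  have hf : ∀ (S : Finset ι) (u : ι → ℝ), (∀ i, i ∈ S ↔ 0 < u i) →
      A *ᵥ u - (fun i => if u i ≤ 0 then ℓm * u i else ℓp * u i) = B S *ᵥ u := fun S u hu => by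
    ext i
    rw [hB, orthantMatrix_mulVec_apply, Pi.sub_apply]
    by_cases hi : 0 < u i
    · simp [hu, hi]
    · simp [hu, hi, not_lt.1 hi]
  have hset : {u : ι → ℝ | A *ᵥ u - (fun i => if u i ≤ 0 then ℓm * u i else ℓp * u i)
      = y - t • p} = x t '' univ := by
    ext u
    simp only [mem_ofPred_eq, image_univ, mem_range]
    constructor
    · intro hu
      set S := Finset.univ.filter fun i => 0 < u i
      refine ⟨S, ?_⟩
      rw [hf S u (by simp [S]), ← hBx t S] at hu
      exact (mulVec_injective_of_isUnit
        ((isUnit_iff_isUnit_det _).2 (isUnit_iff_ne_zero.2 (hdet _))) hu).symm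
    · rintro ⟨S, rfl⟩
      rw [hf S _ (hmem S), hBx]
  have hinj : Function.Injective (x t) := fun S T hST => by
    ext i
    rw [hmem, hmem, hST]
  rw [hset]
  refine ⟨finite_univ.image _, ?_⟩
  rw [ncard_image_of_injective _ hinj, ncard_univ, Nat.card_eq_fintype_card, Fintype.card_finset]

end PiecewiseLinear

lemma tridiagonal_mulVec_sin {n : ℕ} {h : ℝ} (hh : h = Real.pi / (n + 1))
    {A : Matrix (Fin n) (Fin n) ℝ}
    (hA : ∀ i j : Fin n, A i j =
      if i = j then 2 else if i.val + 1 = j.val ∨ j.val + 1 = i.val then -1 else 0) (i : Fin n) :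
    A.mulVec (fun j => Real.sin ((j.val + 1) * h)) i =
      2 * (1 - Real.cos h) * Real.sin ((i.val + 1) * h) := by
  have hpi : Real.sin ((n + 1) * h) = 0 := by
    rw [hh, mul_div_cancel₀ _ (by positivity), Real.sin_pi]
  set g : ℕ → ℝ := fun k => Real.sin (k * h) with hg
  have hsplit : ∀ j : Fin n, A i j * Real.sin ((j.val + 1) * h) =
      (if j.val = i.val then 2 * g (j.val + 1) else 0)
      - (if j.val = i.val + 1 then g (j.val + 1) else 0)
      - (if j.val + 1 = i.val then g (j.val + 1) else 0) := fun j => by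
    rw [hA, hg]
    simp only [Fin.ext_iff]
    push_cast
    split_ifs <;> first | omega | ring
  have hdiag : ∑ j : Fin n, (if j.val = i.val then 2 * g (j.val + 1) else 0)
      = 2 * g (i.val + 1) := by
    rw [Fin.sum_univ_eq_sum_range (fun k => if k = i.val then 2 * g (k + 1) else 0),
      Finset.sum_ite_eq', if_pos (Finset.mem_range.2 i.2)]
  have hupper : ∑ j : Fin n, (if j.val = i.val + 1 then g (j.val + 1) else 0)
      = g (i.val + 2) := by
    rw [Fin.sum_univ_eq_sum_range (fun k => if k = i.val + 1 then g (k + 1) else 0),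
      Finset.sum_ite_eq']
    split_ifs with hi
    · rfl
    · have : i.val + 2 = n + 1 := by
        have := i.2
        rw [Finset.mem_range] at hi
        omega
      rw [this, hg]
      push_cast
      exact hpi.symm
  have hlower : ∑ j : Fin n, (if j.val + 1 = i.val then g (j.val + 1) else 0) = g i.val := by
    obtain ⟨k, hk⟩ := i
    rw [Fin.sum_univ_eq_sum_range (fun m => if m + 1 = k then g (m + 1) else 0)]
    cases k with
    | zero => simp [hg]
    | succ k =>
      simp only [add_left_inj]
      rw [Finset.sum_ite_eq', if_pos (Finset.mem_range.2 (by omega))]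
  rw [Matrix.mulVec, dotProduct, Finset.sum_congr rfl fun j _ => hsplit j, Finset.sum_sub_distrib,
    Finset.sum_sub_distrib, hdiag, hupper, hlower, hg]
  push_cast
  rw [show ((i.val : ℝ) + 2) * h = (i.val + 1) * h + h by ring,
    show (i.val : ℝ) * h = (i.val + 1) * h - h by ring, Real.sin_add, Real.sin_sub]
  ring

theorem statement10 (n : ℕ) (hn : 1 ≤ n) (h : ℝ) (hh : h = Real.pi / (n + 1))
    (A : Matrix (Fin n) (Fin n) ℝ)
    (hA : ∀ i j : Fin n, A i j =
      if i = j then 2 else if i.val + 1 = j.val ∨ j.val + 1 = i.val then -1 else 0)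
    (Ah : Matrix (Fin n) (Fin n) ℝ) (hAh : Ah = (1 / h ^ 2) • A)
    (lam1 : ℝ) (hlam1 : lam1 = 2 / h ^ 2 * (1 - Real.cos h))
    (ℓm : ℝ) (hℓm : ℓm < lam1)
    (y p : Fin n → ℝ) (hp : ∀ i, 0 < p i) :
    ∃ L₀ > (0 : ℝ), ∀ ℓp > L₀, ∃ t₀ > (0 : ℝ), ∀ t > t₀,
      ({u : Fin n → ℝ |
          Ah.mulVec u - (fun i => if u i ≤ 0 then ℓm * u i else ℓp * u i)
            = y - t • p}).Finite ∧
      ({u : Fin n → ℝ |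
          Ah.mulVec u - (fun i => if u i ≤ 0 then ℓm * u i else ℓp * u i)
            = y - t • p}).ncard = 2 ^ n := by
  have hpos : 0 < h := by
    rw [hh]
    positivity
  have hφ : ∀ i : Fin n, 0 < Real.sin ((i.val + 1) * h) := fun i => by
    refine Real.sin_pos_of_pos_of_lt_pi (by positivity) ?_
    have hi : (i.val : ℝ) < n := by exact_mod_cast i.2
    calc ((i.val : ℝ) + 1) * h < (n + 1) * h := by gcongr
      _ = Real.pi := by rw [hh, mul_div_cancel₀ _ (by positivity)]
  have hoff : ∀ i j, i ≠ j → Ah i j ≤ 0 := fun i j hij => by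
    rw [hAh, Matrix.smul_apply, hA, if_neg hij]
    refine mul_nonpos_of_nonneg_of_nonpos (by positivity) ?_
    split_ifs <;> norm_num
  have hAφ : ∀ i, ℓm * Real.sin ((i.val + 1) * h) <
      Ah.mulVec (fun j => Real.sin ((j.val + 1) * h)) i := fun i => by
    rw [hAh, Matrix.smul_mulVec, Pi.smul_apply, tridiagonal_mulVec_sin hh hA, smul_eq_mul]
    calc _ < lam1 * Real.sin ((i.val + 1) * h) := mul_lt_mul_of_pos_right hℓm (hφ i)
      _ = _ := by
        rw [hlam1]
        ring
  obtain ⟨L₀, hL₀, hsign⟩ := exists_forall_orthantMatrix_sign hoff hφ hAφ hp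
  refine ⟨L₀, hL₀, fun ℓp hℓp => ?_⟩
  simpa only [Fintype.card_fin] using exists_forall_ncard_solutions (hsign ℓp hℓp) y
end

section
/- Let A be an n×n real matrix, λ₁ ∈ ℝ, and φ₁ ∈ ℝⁿ a vector with all entries strictly positive such that A·φ₁ = λ₁·φ₁. Let ℓ₋ < λ₁ < ℓ₊ and let t > 0. Then the vectors u₊ = (t/(ℓ₊ − λ₁))·φ₁ and u₋ = (t/(ℓ₋ − λ₁))·φ₁ both satisfy A·u − f_{ℓ₋,ℓ₊}(u) = −t·φ₁; moreover u₊ has all entries strictly positive and u₋ has all entries strictly negative. -/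
open Real

/-- The piecewise linear function `f_{ℓ₋,ℓ₊}`. -/
noncomputable def fpl (ℓm ℓp x : ℝ) : ℝ := if x ≤ 0 then ℓm * x else ℓp * x

theorem statement11 (n : ℕ) (A : Matrix (Fin n) (Fin n) ℝ)
    (lam1 : ℝ) (φ : Fin n → ℝ) (hφ : ∀ i, 0 < φ i)
    (hEig : A.mulVec φ = lam1 • φ)
    (ℓm ℓp t : ℝ) (h₁ : ℓm < lam1) (h₂ : lam1 < ℓp) (ht : 0 < t)
    (up um : Fin n → ℝ)
    (hup : up = (t / (ℓp - lam1)) • φ)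
    (hum : um = (t / (ℓm - lam1)) • φ) :
    (A.mulVec up - (fun i => fpl ℓm ℓp (up i)) = (-t) • φ) ∧
    (A.mulVec um - (fun i => fpl ℓm ℓp (um i)) = (-t) • φ) ∧
    (∀ i, 0 < up i) ∧ (∀ i, um i < 0) := by
  have hp : 0 < ℓp - lam1 := sub_pos.mpr h₂
  have hm : ℓm - lam1 < 0 := sub_neg.mpr h₁
  have hup_pos : ∀ i, 0 < up i := fun i => by
    simpa [hup] using mul_pos (div_pos ht hp) (hφ i)
  have hum_neg : ∀ i, um i < 0 := fun i => by
    simpa [hum] using mul_neg_of_neg_of_pos (div_neg_of_pos_of_neg ht hm) (hφ i)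
  refine ⟨?_, ?_, hup_pos, hum_neg⟩
  · ext i
    simp only [Pi.sub_apply, fpl, if_neg (hup_pos i).not_ge]
    simp only [hup, Matrix.mulVec_smul, hEig, Pi.smul_apply, smul_eq_mul]
    field_simp
    ring
  · ext i
    simp only [Pi.sub_apply, fpl, if_pos (hum_neg i).le]
    simp only [hum, Matrix.mulVec_smul, hEig, Pi.smul_apply, smul_eq_mul]
    have := hm.ne
    field_simp
    ring
end
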